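/- Every PSCF f that satisfies population-consistency and composition-consistency yields only maximal lotteries: for every agenda A and every profile R on A, f(R) ⊆ ML(R). -/

import Mathlib

open Finset

namespace PSC

/-- `r` is a linear order (complete, transitive, antisymmetric; as a set of pairs) on `A`. -/
def IsLinearOrderOn (A : Finset ℕ) (r : Finset (ℕ × ℕ)) : Prop :=
  r ⊆ A ×ˢ A ∧ (∀ x ∈ A, (x, x) ∈ r) ∧
    (∀ x ∈ A, ∀ y ∈ A, (x, y) ∈ r ∨ (y, x) ∈ r) ∧
    (∀ x y z : ℕ, (x, y) ∈ r → (y, z) ∈ r → (x, z) ∈ r) ∧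
    (∀ x y : ℕ, (x, y) ∈ r → (y, x) ∈ r → x = y)

open Classical in
/-- The set `L(A)` of linear orders on the agenda `A`. -/
noncomputable def linOrders (A : Finset ℕ) : Finset (Finset (ℕ × ℕ)) :=
  (A ×ˢ A).powerset.filter (fun r => IsLinearOrderOn A r)

/-- `R` is a (fractional) preference profile on the agenda `A`. -/
def IsProfile (A : Finset ℕ) (R : Finset (ℕ × ℕ) → ℚ) : Prop :=
  (∀ r, r ∉ linOrders A → R r = 0) ∧ (∀ r, 0 ≤ R r) ∧ (∑ r ∈ linOrders A, R r) = 1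

open Classical in
/-- `R(x,y)`: the total weight of orders ranking `x` strictly above `y`. -/
noncomputable def pref (A : Finset ℕ) (R : Finset (ℕ × ℕ) → ℚ) (x y : ℕ) : ℚ :=
  ∑ r ∈ (linOrders A).filter (fun r => (x, y) ∈ r ∧ (y, x) ∉ r), R r

/-- The majority margin `M_R(x,y) = R(x,y) - R(y,x)`. -/
noncomputable def margin (A : Finset ℕ) (R : Finset (ℕ × ℕ) → ℚ) (x y : ℕ) : ℚ :=
  pref A R x y - pref A R y x

/-- `p` is a lottery on `A`. -/
def IsLottery (A : Finset ℕ) (p : ℕ → ℚ) : Prop :=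
  (∀ x, x ∉ A → p x = 0) ∧ (∀ x, 0 ≤ p x) ∧ (∑ x ∈ A, p x) = 1

/-- `Δ(A)`, the set of lotteries on `A`. -/
def lotteries (A : Finset ℕ) : Set (ℕ → ℚ) := {p | IsLottery A p}

/-- 1-norm distance between two profiles on `A`. -/
noncomputable def profileDist (A : Finset ℕ) (R R' : Finset (ℕ × ℕ) → ℚ) : ℚ :=
  ∑ r ∈ linOrders A, |R r - R' r|

/-- 1-norm distance between two lotteries on `A`. -/
noncomputable def lotteryDist (A : Finset ℕ) (p q : ℕ → ℚ) : ℚ :=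
  ∑ x ∈ A, |p x - q x|

/-- Restriction of an order to `B`. -/
def restrictOrder (B : Finset ℕ) (r : Finset (ℕ × ℕ)) : Finset (ℕ × ℕ) := r ∩ B ×ˢ B

open Classical in
/-- The restriction `R|_B` of a profile on `A` to `B`. -/
noncomputable def restrictProfile (A B : Finset ℕ) (R : Finset (ℕ × ℕ) → ℚ) :
    Finset (ℕ × ℕ) → ℚ :=
  fun s => ∑ r ∈ (linOrders A).filter (fun r => restrictOrder B r = s), R r

/-- `B` is a component in the profile `R` on `A`. -/
def IsComponent (A B : Finset ℕ) (R : Finset (ℕ × ℕ) → ℚ) : Prop :=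
  B ⊆ A ∧ ∀ a ∈ A \ B, ∀ b ∈ B, ∀ b' ∈ B, ∀ r ∈ linOrders A, 0 < R r →
    ((a, b) ∈ r ↔ (a, b') ∈ r)

/-- The composed lottery `p ×_b q` (where `B` is the component). -/
def compLottery (B : Finset ℕ) (b : ℕ) (p q : ℕ → ℚ) : ℕ → ℚ :=
  fun x => if x ∈ B then p b * q x else p x

/-- `X ×_b Y` for sets of lotteries. -/
def compSet (B : Finset ℕ) (b : ℕ) (X Y : Set (ℕ → ℚ)) : Set (ℕ → ℚ) :=
  {pr | ∃ p ∈ X, ∃ q ∈ Y, pr = compLottery B b p q}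

/-- A probabilistic social choice function: to every (finite nonempty) agenda `A ⊆ ℕ` and
every profile on `A` it assigns a nonempty convex set of lotteries on `A`; it is upper
hemi-continuous and satisfies unanimity and decisiveness. -/
structure PSCF where
  choice : Finset ℕ → (Finset (ℕ × ℕ) → ℚ) → Set (ℕ → ℚ)
  nonempty : ∀ A : Finset ℕ, A.Nonempty → ∀ R, IsProfile A R → (choice A R).Nonempty
  subset_lotteries : ∀ A : Finset ℕ, A.Nonempty → ∀ R, IsProfile A R →
    choice A R ⊆ lotteries A
  convex : ∀ A : Finset ℕ, A.Nonempty → ∀ R, IsProfile A R →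
    ∀ p ∈ choice A R, ∀ q ∈ choice A R, ∀ t : ℚ, 0 ≤ t → t ≤ 1 →
      (fun x => t * p x + (1 - t) * q x) ∈ choice A R
  continuity : ∀ A : Finset ℕ, A.Nonempty → ∀ R, IsProfile A R → ∀ ε : ℚ, 0 < ε →
    ∃ δ : ℚ, 0 < δ ∧ ∀ R', IsProfile A R' → profileDist A R R' < δ →
      ∀ p ∈ choice A R', ∃ q ∈ choice A R, lotteryDist A p q < ε
  unanimity : ∀ x y : ℕ, ∀ R, IsProfile {x, y} R → pref {x, y} R x y = 1 →
    choice {x, y} R = {fun z => if z = x then 1 else 0}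
  decisive : ∀ A : Finset ℕ, A.Nonempty → ∀ R, IsProfile A R → ∀ ε : ℚ, 0 < ε →
    ∃ R', IsProfile A R' ∧ profileDist A R R' < ε ∧ ∃ p, choice A R' = {p}

/-- Population-consistency. -/
def PopulationConsistent (f : PSCF) : Prop :=
  ∀ A : Finset ℕ, A.Nonempty → ∀ R' R'', IsProfile A R' → IsProfile A R'' →
    ∀ l : ℚ, 0 ≤ l → l ≤ 1 →
      f.choice A R' ∩ f.choice A R'' ⊆ f.choice A (fun r => l * R' r + (1 - l) * R'' r)

/-- Composition-consistency. -/
def CompositionConsistent (f : PSCF) : Prop :=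
  ∀ A' B : Finset ℕ, ∀ b : ℕ, A' ∩ B = {b} →
    ∀ R, IsProfile (A' ∪ B) R → IsComponent (A' ∪ B) B R →
      f.choice (A' ∪ B) R =
        compSet B b (f.choice A' (restrictProfile (A' ∪ B) A' R))
          (f.choice B (restrictProfile (A' ∪ B) B R))

/-- The maximal-lotteries correspondence. -/
noncomputable def ML (A : Finset ℕ) (R : Finset (ℕ × ℕ) → ℚ) : Set (ℕ → ℚ) :=
  {p | IsLottery A p ∧ ∀ q, IsLottery A q →
    0 ≤ ∑ x ∈ A, ∑ y ∈ A, p x * margin A R x y * q y}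

/-- The uniform profile `uni(L(A))` on `A`. -/
noncomputable def uniProfile (A : Finset ℕ) : Finset (ℕ × ℕ) → ℚ :=
  fun r => if r ∈ linOrders A then ((Nat.factorial A.card : ℕ) : ℚ)⁻¹ else 0

/-- The uniform lottery `uni(A)` on `A`. -/
def uniLottery (A : Finset ℕ) : ℕ → ℚ :=
  fun x => if x ∈ A then (A.card : ℚ)⁻¹ else 0

/-- The degenerate lottery on `x`. -/
def degLottery (x : ℕ) : ℕ → ℚ := fun z => if z = x then 1 else 0

/-- `x` is a (weak) Condorcet winner in `R`. -/
def IsCondorcetWinner (A : Finset ℕ) (R : Finset (ℕ × ℕ) → ℚ) (x : ℕ) : Prop :=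
  x ∈ A ∧ ∀ y ∈ A, 0 ≤ margin A R x y

/-- `R` is regular on `A'`. -/
def Regular (A A' : Finset ℕ) (R : Finset (ℕ × ℕ) → ℚ) : Prop :=
  ∀ x ∈ A', (∑ y ∈ A', margin A R x y) = 0

/-- `R` is strongly regular on `A'`. -/
def StronglyRegular (A A' : Finset ℕ) (R : Finset (ℕ × ℕ) → ℚ) : Prop :=
  ∀ x ∈ A', ∀ y ∈ A', margin A R x y = 0

/-- Image of an order under a renaming `π`. -/
def mapOrder (π : ℕ → ℕ) (r : Finset (ℕ × ℕ)) : Finset (ℕ × ℕ) :=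
  r.image (fun xy => (π xy.1, π xy.2))

open Classical in
/-- The image `π(R)` of a profile on `A` under a renaming `π`. -/
noncomputable def mapProfile (π : ℕ → ℕ) (A : Finset ℕ) (R : Finset (ℕ × ℕ) → ℚ) :
    Finset (ℕ × ℕ) → ℚ :=
  fun s => ∑ r ∈ (linOrders A).filter (fun r => mapOrder π r = s), R r

open Classical in
/-- The image `π(p)` of a lottery on `A` under a renaming `π`. -/
noncomputable def mapLottery (π : ℕ → ℕ) (A : Finset ℕ) (p : ℕ → ℚ) : ℕ → ℚ :=
  fun y => ∑ x ∈ A.filter (fun x => π x = y), p x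

/-- The bound `ε_n = (4^n · ∏_{k=1}^n k!)⁻¹`. -/
noncomputable def epsN (n : ℕ) : ℚ :=
  (((4 ^ n * ∏ k ∈ Finset.Icc 1 n, Nat.factorial k : ℕ) : ℚ))⁻¹

theorem rat_proj : ∃ π : ℝ →ₗ[ℚ] ℚ, π 1 = 1 := by
  have hinj : LinearMap.ker (Algebra.linearMap ℚ ℝ) = ⊥ :=
    LinearMap.ker_eq_bot.2 (algebraMap ℚ ℝ).injective
  obtain ⟨g, hg⟩ := (Algebra.linearMap ℚ ℝ).exists_leftInverse_of_injective hinj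
  refine ⟨g, ?_⟩
  have := congrArg (fun h => h 1) hg
  simpa using this

def castV {ι : Type} (x : ι → ℚ) : ι → ℝ := fun i => (x i : ℝ)

theorem mem_of_cast_mem_hull {ι : Type} [Fintype ι] (K : Set (ι → ℚ))
    (hadd : ∀ x ∈ K, ∀ y ∈ K, x + y ∈ K) (hsmul : ∀ c : ℚ, 0 < c → ∀ x ∈ K, c • x ∈ K)
    (x : ι → ℚ) (hx : castV x ∈ convexHull ℝ (castV '' K)) : x ∈ K := by
  obtain ⟨π, hπ⟩ := rat_proj
  obtain ⟨κ, _, z, w, hz, hai, hw, hw1, hwx⟩ := eq_pos_convex_span_of_mem_convexHull hx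
  have hz' : ∀ k, ∃ y ∈ K, castV y = z k := fun k => hz ⟨k, rfl⟩
  choose y hyK hyz using hz'
  have hπq : ∀ (a : ℝ) (q : ℚ), π (a * (q : ℝ)) = q * π a := by
    intro a q
    have : a * (q : ℝ) = q • a := by rw [Rat.smul_def]; ring
    rw [this, map_smul]; simp
  -- the projected weights
  have h1 : ∑ k, π (w k) = 1 := by rw [← map_sum, hw1, hπ]
  have h2 : ∀ i, ∑ k, π (w k) * y k i = x i := by
    intro i
    have h := congrFun hwx i
    simp only [Finset.sum_apply, Pi.smul_apply, smul_eq_mul, ← hyz, castV] at h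
    have h' := congrArg π h
    rw [map_sum] at h'
    simp only [hπq] at h'
    have h3 : π ((x i : ℝ)) = x i := by
      have := hπq 1 (x i); simpa [hπ] using this
    rw [h3] at h'
    rw [← h']; exact Finset.sum_congr rfl (fun k _ => mul_comm _ _)
  -- uniqueness
  have h3 : ∀ k, ((π (w k) : ℚ) : ℝ) = w k := by
    rw [affineIndependent_iff] at hai
    have := hai Finset.univ (fun k => ((π (w k) : ℚ) : ℝ) - w k) (by
      simp only [Finset.sum_sub_distrib, hw1]
      rw [← Rat.cast_sum, h1]; simp) (by
      simp only [sub_smul, Finset.sum_sub_distrib, hwx]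
      ext i
      have := h2 i
      simp only [Pi.sub_apply, Finset.sum_apply, Pi.smul_apply, smul_eq_mul, ← hyz, castV,
        Pi.zero_apply]
      rw [← this]; push_cast; ring)
    intro k
    have := this k (Finset.mem_univ k)
    linarith
  have h4 : x = ∑ k, π (w k) • y k := by
    ext i; rw [Finset.sum_apply]; simp only [Pi.smul_apply, smul_eq_mul]; rw [h2]
  have hne : (Finset.univ : Finset κ).Nonempty := by
    rw [Finset.nonempty_iff_ne_empty]
    intro h; rw [h] at hw1; simp at hw1
  rw [h4]
  refine Finset.sum_induction_nonempty _ (fun v => v ∈ K) (fun a b ha hb => hadd a ha b hb) hne ?_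
  intro k _
  apply hsmul _ _ _ (hyK k)
  have := hw k
  rw [← h3 k] at this
  exact_mod_cast this

theorem sepFin {ι : Type} [Fintype ι] [DecidableEq ι] (K : Set (ι → ℚ)) (hne : K.Nonempty)
    (hadd : ∀ x ∈ K, ∀ y ∈ K, x + y ∈ K) (hsmul : ∀ c : ℚ, 0 < c → ∀ x ∈ K, c • x ∈ K)
    (hφ : ∀ φ : ι → ℝ, (∀ k ∈ K, 0 ≤ ∑ i, φ i * (k i : ℝ)) → ∀ i, φ i = 0)
    (x : ι → ℚ) : x ∈ K := by
  apply mem_of_cast_mem_hull K hadd hsmul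
  set C := convexHull ℝ (castV '' K) with hC
  have hconv : Convex ℝ C := convex_convexHull _ _
  have hKC : ∀ k ∈ K, castV k ∈ C := fun k hk => subset_convexHull _ _ ⟨k, hk, rfl⟩
  -- functionals
  have hrep : ∀ (g : (ι → ℝ) →ₗ[ℝ] ℝ) (v : ι → ℝ), g v = ∑ i, g (Pi.single i 1) * v i := by
    intro g v
    conv_lhs => rw [pi_eq_sum_univ' v]
    rw [map_sum]
    refine Finset.sum_congr rfl (fun i _ => ?_)
    rw [map_smul, smul_eq_mul, mul_comm]
  have hφ' : ∀ g : (ι → ℝ) →ₗ[ℝ] ℝ, (∀ k ∈ K, 0 ≤ g (castV k)) → g = 0 := by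
    intro g hg
    have := hφ (fun i => g (Pi.single i 1)) (fun k hk => by
      have := hg k hk; rw [hrep] at this; exact this)
    ext v
    simp [this]
  have hscale : ∀ (g : (ι → ℝ) →ₗ[ℝ] ℝ) (u : ℝ), (∀ k ∈ K, g (castV k) ≤ u) →
      ∀ k ∈ K, g (castV k) ≤ 0 := by
    intro g u hg k hk
    by_contra hpos
    push Not at hpos
    obtain ⟨n, hn⟩ := exists_nat_gt (u / g (castV k))
    have h1 := hg _ (hsmul ((n : ℚ) + 1) (by positivity) k hk)
    have h2 : castV (((n : ℚ) + 1) • k) = ((n : ℝ) + 1) • castV k := by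
      ext i; simp [castV]
    rw [h2, map_smul, smul_eq_mul] at h1
    rw [div_lt_iff₀ hpos] at hn
    nlinarith
  have hint : (interior C).Nonempty := by
    rw [hconv.interior_nonempty_iff_affineSpan_eq_top]
    by_contra hne'
    obtain ⟨k0, hk0⟩ := hne
    have hdir : (affineSpan ℝ C).direction ≠ ⊤ := by
      intro h
      apply hne'
      rwa [← AffineSubspace.direction_eq_top_iff_of_nonempty]
      exact ⟨castV k0, subset_affineSpan _ _ (hKC k0 hk0)⟩
    obtain ⟨g, hg0, hg⟩ := Submodule.exists_le_ker_of_lt_top _ (lt_top_iff_ne_top.2 hdir)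
    have hconst : ∀ k ∈ K, g (castV k) = g (castV k0) := by
      intro k hk
      have := hg (AffineSubspace.vsub_mem_direction (subset_affineSpan ℝ _ (hKC k hk))
        (subset_affineSpan ℝ _ (hKC k0 hk0)))
      rw [LinearMap.mem_ker] at this
      simpa [sub_eq_zero] using this
    apply hg0
    have h1 : ∀ k ∈ K, g (castV k) ≤ 0 :=
      hscale g (g (castV k0)) (fun k hk => (hconst k hk).le)
    have := hφ' (-g) (fun k hk => by simpa using h1 k hk)
    simpa using this
  by_contra hx
  have hx' : castV x ∉ interior C := fun h => hx (interior_subset h)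
  obtain ⟨g, hg⟩ := geometric_hahn_banach_open_point hconv.interior isOpen_interior hx'
  have hle : ∀ v ∈ C, g v ≤ g (castV x) := by
    intro v hv
    have hcl : v ∈ closure (interior C) := by
      rw [hconv.closure_interior_eq_closure_of_nonempty_interior hint]
      exact subset_closure hv
    have : closure (interior C) ⊆ {v | g v ≤ g (castV x)} :=
      closure_minimal (fun v hv => (hg v hv).le) (isClosed_le g.continuous continuous_const)
    exact this hcl
  have h1 := hscale g.toLinearMap (g (castV x)) (fun k hk => hle _ (hKC k hk))
  have h2 := hφ' (-g.toLinearMap) (fun k hk => by simpa using h1 k hk)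
  obtain ⟨v, hv⟩ := hint
  have h3 := hg v hv
  have h4 : ∀ v, g v = 0 := by
    intro v
    have := congrArg (fun h => h v) h2
    simpa using this
  rw [h4, h4] at h3
  exact lt_irrefl _ h3

theorem sep {α : Type} (s : Finset α) (K : Set (α → ℚ)) (hne : K.Nonempty)
    (hadd : ∀ x ∈ K, ∀ y ∈ K, x + y ∈ K) (hsmul : ∀ c : ℚ, 0 < c → ∀ x ∈ K, c • x ∈ K)
    (hsupp : ∀ k ∈ K, ∀ a ∉ s, k a = 0)
    (hφ : ∀ φ : α → ℝ, (∀ k ∈ K, 0 ≤ ∑ a ∈ s, φ a * (k a : ℝ)) → ∀ a ∈ s, φ a = 0)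
    (x : α → ℚ) (hx : ∀ a ∉ s, x a = 0) : x ∈ K := by
  classical
  let res : (α → ℚ) → (↥s → ℚ) := fun k i => k i
  have hres : ∀ k k' : α → ℚ, (∀ a ∉ s, k a = 0) → (∀ a ∉ s, k' a = 0) → res k = res k' →
      k = k' := by
    intro k k' h h' he
    ext a
    by_cases ha : a ∈ s
    · exact congrFun he ⟨a, ha⟩
    · rw [h a ha, h' a ha]
  have := sepFin (res '' K) (hne.image _) (by
    rintro _ ⟨a, ha, rfl⟩ _ ⟨b, hb, rfl⟩; exact ⟨a + b, hadd a ha b hb, rfl⟩) (by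
    rintro c hc _ ⟨a, ha, rfl⟩; exact ⟨c • a, hsmul c hc a ha, rfl⟩) (by
    intro φ h i
    have := hφ (fun a => if ha : a ∈ s then φ ⟨a, ha⟩ else 0) (by
      intro k hk
      have := h (res k) ⟨k, hk, rfl⟩
      rw [← Finset.sum_coe_sort s]
      simpa [res] using this) i i.2
    simpa using this) (res x)
  obtain ⟨k, hk, hkx⟩ := this
  rw [← hres k x (hsupp k hk) hx hkx]; exact hk

/-- the order (best first) given by a list -/
def ord : List ℕ → Finset (ℕ × ℕ)
  | [] => ∅
  | a :: l => ((a :: l).toFinset.image (fun y => (a, y))) ∪ ord l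

theorem mem_ord_nil (x y : ℕ) : (x, y) ∈ ord [] ↔ False := by simp [ord]

theorem mem_ord_cons (a : ℕ) (l : List ℕ) (x y : ℕ) :
    (x, y) ∈ ord (a :: l) ↔ (x = a ∧ (y = a ∨ y ∈ l)) ∨ (x, y) ∈ ord l := by
  simp only [ord, mem_union, mem_image, List.mem_toFinset, List.mem_cons, Prod.mk.injEq]
  grind

theorem mem_of_mem_ord {l : List ℕ} {x y : ℕ} (h : (x, y) ∈ ord l) : x ∈ l ∧ y ∈ l := by
  induction l with
  | nil => simp [ord] at h
  | cons a l ih => rw [mem_ord_cons] at h; grind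

theorem mem_ord_append (l m : List ℕ) (x y : ℕ) :
    (x, y) ∈ ord (l ++ m) ↔ (x, y) ∈ ord l ∨ (x, y) ∈ ord m ∨ (x ∈ l ∧ y ∈ m) := by
  induction l with
  | nil => simp [ord]
  | cons a l ih =>
    rw [List.cons_append, mem_ord_cons, mem_ord_cons, ih, List.mem_append, List.mem_cons]
    grind

def good (A : Finset ℕ) (l : List ℕ) : Prop := l.Nodup ∧ ∀ x, x ∈ l ↔ x ∈ A

theorem ord_total (l : List ℕ) : ∀ x ∈ l, ∀ y ∈ l, (x, y) ∈ ord l ∨ (y, x) ∈ ord l := by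
  induction l with
  | nil => simp
  | cons a l ih => intro x hx y hy; rw [mem_ord_cons, mem_ord_cons]; grind

theorem ord_trans (l : List ℕ) (hl : l.Nodup) :
    ∀ x y z, (x, y) ∈ ord l → (y, z) ∈ ord l → (x, z) ∈ ord l := by
  induction l with
  | nil => simp [ord]
  | cons a l ih =>
    intro x y z
    rw [mem_ord_cons, mem_ord_cons, mem_ord_cons]
    have := @mem_of_mem_ord l x y
    have := @mem_of_mem_ord l y z
    have := ih (List.nodup_cons.1 hl).2 x y z
    have := (List.nodup_cons.1 hl).1
    grind

theorem ord_antisymm (l : List ℕ) (hl : l.Nodup) :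
    ∀ x y, (x, y) ∈ ord l → (y, x) ∈ ord l → x = y := by
  induction l with
  | nil => simp [ord]
  | cons a l ih =>
    intro x y
    rw [mem_ord_cons, mem_ord_cons]
    have := @mem_of_mem_ord l x y
    have := @mem_of_mem_ord l y x
    have := ih (List.nodup_cons.1 hl).2 x y
    have := (List.nodup_cons.1 hl).1
    grind

theorem mem_linOrders {A : Finset ℕ} {r} : r ∈ linOrders A ↔ IsLinearOrderOn A r := by
  classical
  unfold linOrders
  rw [mem_filter, mem_powerset]
  exact ⟨fun h => h.2, fun h => ⟨h.1, h⟩⟩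

theorem ord_mem {A : Finset ℕ} {l : List ℕ} (hl : good A l) : ord l ∈ linOrders A := by
  rw [mem_linOrders]
  refine ⟨?_, ?_, ?_, ord_trans l hl.1, ord_antisymm l hl.1⟩
  · rintro ⟨x, y⟩ h
    have := mem_of_mem_ord h
    rw [hl.2, hl.2] at this
    exact mem_product.2 this
  · intro x hx
    have := ord_total l x ((hl.2 x).2 hx) x ((hl.2 x).2 hx)
    tauto
  · intro x hx y hy
    exact ord_total l x ((hl.2 x).2 hx) y ((hl.2 y).2 hy)

theorem restrict_ord (B : Finset ℕ) (l : List ℕ) :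
    restrictOrder B (ord l) = ord (l.filter (· ∈ B)) := by
  unfold restrictOrder
  ext ⟨x, y⟩
  rw [mem_inter, mem_product]
  induction l with
  | nil => simp [ord]
  | cons a l ih =>
    rw [List.filter_cons, mem_ord_cons]
    split_ifs with h
    · rw [mem_ord_cons, ← ih]; simp only [decide_eq_true_eq] at h; grind
    · rw [← ih]; simp only [decide_eq_true_eq] at h; grind

theorem good_filter {A B : Finset ℕ} {l : List ℕ} (hl : good A l) (hB : B ⊆ A) :
    good B (l.filter (· ∈ B)) := by
  refine ⟨hl.1.filter _, fun x => ?_⟩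
  rw [List.mem_filter, hl.2]
  simp only [decide_eq_true_eq]
  exact ⟨fun h => h.2, fun h => ⟨hB h, h⟩⟩

theorem exists_top (A : Finset ℕ) (r) (h : IsLinearOrderOn A r) (hA : A.Nonempty) :
    ∃ a ∈ A, ∀ y ∈ A, (a, y) ∈ r := by
  obtain ⟨_, hrefl, htot, htr, -⟩ := h
  have : ∀ B : Finset ℕ, B ⊆ A → B.Nonempty → ∃ a ∈ B, ∀ y ∈ B, (a, y) ∈ r := by
    intro B
    induction B using Finset.induction_on with
    | empty => simp
    | insert b B hb ih =>
      intro hBA _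
      by_cases hne : B.Nonempty
      · obtain ⟨a, ha, hay⟩ := ih (fun x hx => hBA (mem_insert_of_mem hx)) hne
        have haA := hBA (mem_insert_of_mem ha)
        have hbA := hBA (mem_insert_self b B)
        rcases htot a haA b hbA with h | h
        · exact ⟨a, mem_insert_of_mem ha, by
            intro y hy; rcases mem_insert.1 hy with rfl | hy
            · exact h
            · exact hay y hy⟩
        · exact ⟨b, mem_insert_self _ _, by
            intro y hy; rcases mem_insert.1 hy with rfl | hy
            · exact hrefl _ hbA
            · exact htr _ _ _ h (hay y hy)⟩
      · rw [not_nonempty_iff_eq_empty] at hne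
        subst hne
        exact ⟨b, by simp, by simpa using hrefl b (hBA (by simp))⟩
  exact this A (Finset.Subset.refl _) hA

theorem ord_surj : ∀ (n : ℕ) (A : Finset ℕ) (_ : A.card = n) (r) (_ : r ∈ linOrders A),
    ∃ l, good A l ∧ ord l = r := by
  intro n
  induction n with
  | zero =>
    intro A hA r hr
    rw [card_eq_zero] at hA
    subst hA
    rw [mem_linOrders] at hr
    refine ⟨[], ⟨by simp, by simp⟩, ?_⟩
    have := hr.1
    simp at this
    rw [this]; rfl
  | succ n ih =>
    intro A hA r hr
    rw [mem_linOrders] at hr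
    obtain ⟨a, ha, hay⟩ := exists_top A r hr (card_pos.1 (by omega))
    obtain ⟨hsub, hrefl, htot, htr, hanti⟩ := hr
    obtain ⟨l, hl, hlr⟩ := ih (A.erase a) (by rw [card_erase_of_mem ha]; omega)
      (restrictOrder (A.erase a) r) (by
        rw [mem_linOrders]
        unfold restrictOrder
        refine ⟨inter_subset_right, ?_, ?_, ?_, ?_⟩
        · intro x hx
          exact mem_inter.2 ⟨hrefl x (mem_of_mem_erase hx), mem_product.2 ⟨hx, hx⟩⟩
        · intro x hx y hy
          simp only [mem_inter, mem_product]
          rcases htot x (mem_of_mem_erase hx) y (mem_of_mem_erase hy) with h | h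
          · left; exact ⟨h, hx, hy⟩
          · right; exact ⟨h, hy, hx⟩
        · intro x y z
          simp only [mem_inter, mem_product]
          rintro ⟨h1, h2, h3⟩ ⟨h4, h5, h6⟩
          exact ⟨htr _ _ _ h1 h4, h2, h6⟩
        · intro x y
          simp only [mem_inter]
          rintro ⟨h1, _⟩ ⟨h2, _⟩
          exact hanti _ _ h1 h2)
    refine ⟨a :: l, ⟨?_, ?_⟩, ?_⟩
    · rw [List.nodup_cons, hl.2]; exact ⟨by simp, hl.1⟩
    · intro x; rw [List.mem_cons, hl.2, mem_erase]; grind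
    · ext ⟨x, y⟩
      rw [mem_ord_cons, hlr, hl.2]
      unfold restrictOrder
      simp only [mem_inter, mem_product, mem_erase]
      constructor
      · rintro (⟨rfl, rfl | ⟨_, h⟩⟩ | ⟨h, _⟩)
        · exact hay _ ha
        · exact hay _ h
        · exact h
      · intro h
        have hxy := mem_product.1 (hsub h)
        by_cases hxa : x = a
        · left; refine ⟨hxa, ?_⟩
          by_cases hya : y = a
          · exact Or.inl hya
          · exact Or.inr ⟨hya, hxy.2⟩
        · right
          refine ⟨h, ⟨hxa, hxy.1⟩, ?_, hxy.2⟩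
          rintro rfl
          exact hxa (hanti _ _ h (hay x hxy.1))

/-! ### weighted lists -/

noncomputable def ev {E : Type} [AddCommGroup E] [Module ℚ E] (g : List ℕ → E) :
    (List ℕ →₀ ℚ) →ₗ[ℚ] E := Finsupp.linearCombination ℚ g

noncomputable def mass : (List ℕ →₀ ℚ) →ₗ[ℚ] ℚ := ev (fun _ => (1 : ℚ))

noncomputable def toProf : (List ℕ →₀ ℚ) →ₗ[ℚ] (Finset (ℕ × ℕ) → ℚ) :=
  ev (fun l r => if ord l = r then 1 else 0)

theorem ev_single {E : Type} [AddCommGroup E] [Module ℚ E] (g : List ℕ → E) (l : List ℕ) (c : ℚ) :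
    ev g (Finsupp.single l c) = c • g l := by
  simp [ev]

theorem ev_map {E : Type} [AddCommGroup E] [Module ℚ E] (g : List ℕ → E) (h : List ℕ → List ℕ)
    (μ : List ℕ →₀ ℚ) : ev g (μ.mapDomain h) = ev (fun l => g (h l)) μ := by
  unfold ev
  rw [Finsupp.linearCombination_mapDomain]; rfl

theorem ev_congr {E : Type} [AddCommGroup E] [Module ℚ E] {g g' : List ℕ → E}
    {μ : List ℕ →₀ ℚ} (h : ∀ l ∈ μ.support, g l = g' l) : ev g μ = ev g' μ := by
  unfold ev
  rw [Finsupp.linearCombination_apply, Finsupp.linearCombination_apply]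
  exact Finset.sum_congr rfl (fun l hl => by simp only [h l hl])

theorem mass_map (h : List ℕ → List ℕ) (μ : List ℕ →₀ ℚ) : mass (μ.mapDomain h) = mass μ :=
  ev_map _ _ _

theorem mass_single (l : List ℕ) (c : ℚ) : mass (Finsupp.single l c) = c := by
  simp [mass, ev_single]

theorem ev_eq_sum {E : Type} [AddCommGroup E] [Module ℚ E] (g : List ℕ → E) (μ : List ℕ →₀ ℚ) :
    ev g μ = ∑ l ∈ μ.support, μ l • g l := by
  unfold ev; rw [Finsupp.linearCombination_apply]; rfl

theorem toProf_apply (μ : List ℕ →₀ ℚ) (r) :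
    toProf μ r = ∑ l ∈ μ.support, if ord l = r then μ l else 0 := by
  unfold toProf
  rw [ev_eq_sum, Finset.sum_apply]
  simp

def OK (A : Finset ℕ) (μ : List ℕ →₀ ℚ) : Prop :=
  (∀ l ∈ μ.support, good A l) ∧ ∀ l, 0 ≤ μ l

theorem sum_toProf {E : Type} [AddCommGroup E] [Module ℚ E] {A : Finset ℕ} {μ : List ℕ →₀ ℚ}
    (h : ∀ l ∈ μ.support, good A l) (g : Finset (ℕ × ℕ) → E) :
    ∑ r ∈ linOrders A, toProf μ r • g r = ev (fun l => g (ord l)) μ := by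
  rw [ev_eq_sum]
  simp only [toProf_apply, Finset.sum_smul]
  rw [Finset.sum_comm]
  refine Finset.sum_congr rfl (fun l hl => ?_)
  rw [Finset.sum_eq_single (ord l)]
  · simp
  · intro r _ hr; simp [hr.symm]
  · intro hn; exact absurd (ord_mem (h l hl)) hn

theorem sum_toProf_mass {A : Finset ℕ} {μ : List ℕ →₀ ℚ} (h : ∀ l ∈ μ.support, good A l) :
    ∑ r ∈ linOrders A, toProf μ r = mass μ := by
  have := sum_toProf h (fun _ => (1 : ℚ))
  simpa [mass] using this

theorem toProf_supp {A : Finset ℕ} {μ : List ℕ →₀ ℚ} (h : ∀ l ∈ μ.support, good A l) (r)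
    (hr : r ∉ linOrders A) : toProf μ r = 0 := by
  rw [toProf_apply]
  refine Finset.sum_eq_zero (fun l hl => ?_)
  rw [if_neg]
  rintro rfl
  exact hr (ord_mem (h l hl))

theorem toProf_nonneg {μ : List ℕ →₀ ℚ} (h : ∀ l, 0 ≤ μ l) (r) : 0 ≤ toProf μ r := by
  rw [toProf_apply]
  refine Finset.sum_nonneg (fun l _ => ?_)
  split_ifs
  · exact h l
  · exact le_rfl

theorem restrict_toProf {A B : Finset ℕ} {μ : List ℕ →₀ ℚ} (h : ∀ l ∈ μ.support, good A l) :
    restrictProfile A B (toProf μ) = toProf (μ.mapDomain (fun l => l.filter (· ∈ B))) := by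
  classical
  ext s
  unfold restrictProfile
  rw [Finset.sum_filter]
  have h1 := sum_toProf h (fun r => if restrictOrder B r = s then (1 : ℚ) else 0)
  simp only [smul_eq_mul, mul_ite, mul_one, mul_zero] at h1
  rw [h1]
  simp only [restrict_ord]
  unfold toProf
  rw [ev_map, ev_eq_sum, ev_eq_sum, Finset.sum_apply]
  simp

theorem exists_list {A : Finset ℕ} {R : Finset (ℕ × ℕ) → ℚ} (h0 : ∀ r, r ∉ linOrders A → R r = 0)
    (h1 : ∀ r, 0 ≤ R r) : ∃ μ, OK A μ ∧ toProf μ = R := by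
  have hs := fun r (hr : r ∈ linOrders A) => ord_surj _ A rfl r hr
  choose! L hL using hs
  have hnn : ∀ l, 0 ≤ (∑ r ∈ linOrders A, Finsupp.single (L r) (R r)) l := by
    intro l
    rw [Finsupp.finsetSum_apply]
    refine Finset.sum_nonneg (fun r _ => ?_)
    rw [Finsupp.single_apply]
    split_ifs
    · exact h1 r
    · exact le_rfl
  refine ⟨∑ r ∈ linOrders A, Finsupp.single (L r) (R r), ⟨?_, hnn⟩, ?_⟩
  · intro l hl
    rw [Finsupp.mem_support_iff, Finsupp.finsetSum_apply] at hl
    obtain ⟨r, hr, hrl⟩ := Finset.exists_ne_zero_of_sum_ne_zero hl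
    rw [Finsupp.single_apply] at hrl
    split_ifs at hrl with h
    · rw [← h]; exact (hL r hr).1
    · exact absurd rfl hrl
  · ext s
    rw [map_sum, Finset.sum_apply]
    simp only [toProf, ev_single, Pi.smul_apply, smul_eq_mul, mul_ite, mul_one, mul_zero]
    by_cases hs : s ∈ linOrders A
    · rw [Finset.sum_eq_single s]
      · simp [(hL s hs).2]
      · intro r hr hrs; rw [(hL r hr).2, if_neg hrs]
      · intro h; exact absurd hs h
    · rw [h0 s hs]
      refine Finset.sum_eq_zero (fun r hr => ?_)
      rw [(hL r hr).2, if_neg]; rintro rfl; exact hs hr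

/-- sign of `a` versus `b` in a list -/
def sg (l : List ℕ) (a b : ℕ) : ℚ :=
  (if (a, b) ∈ ord l then 1 else 0) - (if (b, a) ∈ ord l then 1 else 0)

theorem margin_toProf {A : Finset ℕ} {μ : List ℕ →₀ ℚ} (h : ∀ l ∈ μ.support, good A l)
    (x y : ℕ) : margin A (toProf μ) x y = ev (fun l => sg l x y) μ := by
  classical
  have h1 := sum_toProf h (fun r => (if (x, y) ∈ r then (1 : ℚ) else 0) -
    (if (y, x) ∈ r then (1 : ℚ) else 0))
  change _ = ev (fun l => sg l x y) μ at h1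
  rw [← h1]
  unfold margin pref
  rw [Finset.sum_filter, Finset.sum_filter, ← Finset.sum_sub_distrib]
  refine Finset.sum_congr rfl (fun r _ => ?_)
  by_cases ha : (x, y) ∈ r <;> by_cases hb : (y, x) ∈ r <;> simp [ha, hb]

class Nice (f : PSCF) : Prop where
  pc : PopulationConsistent f
  cc : CompositionConsistent f

theorem OK.add {A : Finset ℕ} {μ ν : List ℕ →₀ ℚ} (h1 : OK A μ) (h2 : OK A ν) : OK A (μ + ν) := by
  classical
  refine ⟨fun l hl => ?_, fun l => by
    rw [Finsupp.add_apply]; exact add_nonneg (h1.2 l) (h2.2 l)⟩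
  rcases Finset.mem_union.1 (Finsupp.support_add hl) with h | h
  · exact h1.1 l h
  · exact h2.1 l h

theorem OK.smul {A : Finset ℕ} {μ : List ℕ →₀ ℚ} (h1 : OK A μ) {c : ℚ} (hc : 0 ≤ c) :
    OK A (c • μ) := by
  refine ⟨fun l hl => h1.1 l (Finsupp.support_smul hl), fun l => ?_⟩
  rw [Finsupp.smul_apply, smul_eq_mul]
  exact mul_nonneg hc (h1.2 l)

theorem OK.single {A : Finset ℕ} {l : List ℕ} (hl : good A l) {c : ℚ} (hc : 0 ≤ c) :
    OK A (Finsupp.single l c) := by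
  refine ⟨fun m hm => ?_, fun m => ?_⟩
  · have := Finsupp.support_single_subset hm
    rw [mem_singleton] at this
    rw [this]; exact hl
  · rw [Finsupp.single_apply]; split_ifs <;> simp [hc]

theorem OK.zero {A : Finset ℕ} : OK A 0 := ⟨by simp, by simp⟩

theorem OK.map {A B : Finset ℕ} {μ : List ℕ →₀ ℚ} (h1 : OK A μ) {h : List ℕ → List ℕ}
    (hh : ∀ l, good A l → good B (h l)) : OK B (μ.mapDomain h) := by
  classical
  refine ⟨fun m hm => ?_, fun m => ?_⟩
  · obtain ⟨l, hl, rfl⟩ := Finset.mem_image.1 (Finsupp.mapDomain_support hm)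
    exact hh l (h1.1 l hl)
  · rw [Finsupp.mapDomain, Finsupp.sum, Finsupp.finsetSum_apply]
    refine Finset.sum_nonneg (fun l _ => ?_)
    rw [Finsupp.single_apply]; split_ifs <;> simp [h1.2]

theorem OK.mass_nonneg {A : Finset ℕ} {μ : List ℕ →₀ ℚ} (h1 : OK A μ) : 0 ≤ mass μ := by
  rw [mass, ev_eq_sum]
  exact Finset.sum_nonneg (fun l _ => by simp [h1.2 l])

theorem OK.mass_pos {A : Finset ℕ} {μ : List ℕ →₀ ℚ} (h1 : OK A μ) {l : List ℕ} (hl : 0 < μ l) :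
    0 < mass μ := by
  rw [mass, ev_eq_sum]
  exact Finset.sum_pos' (fun l _ => by simp [h1.2 l]) ⟨l, by
    simp only [Finsupp.mem_support_iff]; exact hl.ne', by simpa using hl⟩

def SO (f : PSCF) (A : Finset ℕ) (p : ℕ → ℚ) (R : Finset (ℕ × ℕ) → ℚ) : Prop :=
  A.Nonempty ∧ (∀ r, r ∉ linOrders A → R r = 0) ∧ (∀ r, 0 ≤ R r) ∧ 0 < ∑ r ∈ linOrders A, R r ∧
    p ∈ f.choice A ((∑ r ∈ linOrders A, R r)⁻¹ • R)

theorem normalize {A : Finset ℕ} {R : Finset (ℕ × ℕ) → ℚ} (h0 : ∀ r, r ∉ linOrders A → R r = 0)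
    (h1 : ∀ r, 0 ≤ R r) (h2 : 0 < ∑ r ∈ linOrders A, R r) :
    IsProfile A ((∑ r ∈ linOrders A, R r)⁻¹ • R) := by
  refine ⟨fun r hr => by simp [h0 r hr], fun r => ?_, ?_⟩
  · simp only [Pi.smul_apply, smul_eq_mul]
    exact mul_nonneg (inv_nonneg.2 h2.le) (h1 r)
  · simp only [Pi.smul_apply, smul_eq_mul]
    rw [← Finset.mul_sum, inv_mul_cancel₀ h2.ne']

theorem SO.smul {f : PSCF} {A : Finset ℕ} {p R} (h : SO f A p R) {c : ℚ} (hc : 0 < c) :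
    SO f A p (c • R) := by
  obtain ⟨hA, h0, h1, h2, h3⟩ := h
  have hs : ∑ r ∈ linOrders A, (c • R) r = c * ∑ r ∈ linOrders A, R r := by
    simp [Finset.mul_sum]
  refine ⟨hA, fun r hr => by simp [h0 r hr], fun r => ?_, ?_, ?_⟩
  · simpa using mul_nonneg hc.le (h1 r)
  · rw [hs]; positivity
  · rw [hs, mul_inv, mul_comm c⁻¹, mul_smul, smul_smul c⁻¹ c, inv_mul_cancel₀ hc.ne', one_smul]
    exact h3

theorem SO.add {f : PSCF} [Nice f] {A : Finset ℕ} {p R R'} (h : SO f A p R) (h' : SO f A p R') :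
    SO f A p (R + R') := by
  obtain ⟨hA, h0, h1, h2, h3⟩ := h
  obtain ⟨-, h0', h1', h2', h3'⟩ := h'
  have hs : ∑ r ∈ linOrders A, (R + R') r = ∑ r ∈ linOrders A, R r + ∑ r ∈ linOrders A, R' r := by
    simp [Finset.sum_add_distrib]
  refine ⟨hA, fun r hr => by simp [h0 r hr, h0' r hr], fun r => ?_, ?_, ?_⟩
  · exact add_nonneg (h1 r) (h1' r)
  · rw [hs]; positivity
  · rw [hs]
    have := Nice.pc (f := f) A hA _ _ (normalize h0 h1 h2) (normalize h0' h1' h2')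
      ((∑ r ∈ linOrders A, R r) / (∑ r ∈ linOrders A, R r + ∑ r ∈ linOrders A, R' r))
      (by positivity) (by rw [div_le_one (by positivity)]; linarith) ⟨h3, h3'⟩
    convert this using 2
    funext r
    simp only [Pi.smul_apply, Pi.add_apply, smul_eq_mul]
    generalize (∑ r ∈ linOrders A, R r) = s at *
    generalize (∑ r ∈ linOrders A, R' r) = s' at *
    have : s + s' ≠ 0 := by positivity
    field_simp
    ring

def S (f : PSCF) (A : Finset ℕ) (p : ℕ → ℚ) (μ : List ℕ →₀ ℚ) : Prop :=
  OK A μ ∧ SO f A p (toProf μ)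

theorem S_iff {f : PSCF} {A p μ} : S f A p μ ↔ OK A μ ∧ A.Nonempty ∧ 0 < mass μ ∧
    p ∈ f.choice A ((mass μ)⁻¹ • toProf μ) := by
  constructor
  · rintro ⟨h1, hA, _, _, h2, h3⟩
    rw [sum_toProf_mass h1.1] at h2 h3
    exact ⟨h1, hA, h2, h3⟩
  · rintro ⟨h1, hA, h2, h3⟩
    refine ⟨h1, hA, toProf_supp h1.1, toProf_nonneg h1.2, ?_, ?_⟩
    · rwa [sum_toProf_mass h1.1]
    · rwa [sum_toProf_mass h1.1]

theorem isProf {A : Finset ℕ} {μ} (h : OK A μ) (hm : 0 < mass μ) :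
    IsProfile A ((mass μ)⁻¹ • toProf μ) := by
  have := normalize (toProf_supp h.1) (toProf_nonneg h.2) (by rwa [sum_toProf_mass h.1])
  rwa [sum_toProf_mass h.1] at this

theorem S.ok {f A p μ} (h : S f A p μ) : OK A μ := h.1
theorem S.ne {f A p μ} (h : S f A p μ) : A.Nonempty := h.2.1
theorem S.pos {f A p μ} (h : S f A p μ) : 0 < mass μ := (S_iff.1 h).2.2.1

theorem S.lot {f A p μ} (h : S f A p μ) : IsLottery A p := by
  obtain ⟨h1, hA, h2, h3⟩ := S_iff.1 h
  exact f.subset_lotteries A hA _ (isProf h1 h2) h3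

theorem S.add {f : PSCF} [Nice f] {A p μ ν} (h : S f A p μ) (h' : S f A p ν) :
    S f A p (μ + ν) := by
  refine ⟨h.1.add h'.1, ?_⟩
  rw [map_add]; exact h.2.add h'.2

theorem S.smul {f : PSCF} {A p μ} (h : S f A p μ) {c : ℚ} (hc : 0 < c) : S f A p (c • μ) := by
  refine ⟨h.1.smul hc.le, ?_⟩
  rw [map_smul]; exact h.2.smul hc

theorem S.conv {f : PSCF} {A p q μ} (h : S f A p μ) (h' : S f A q μ) {t : ℚ} (h0 : 0 ≤ t)
    (h1 : t ≤ 1) : S f A (fun x => t * p x + (1 - t) * q x) μ := by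
  have h2 := S_iff.1 h
  have h3 := S_iff.1 h'
  exact S_iff.2 ⟨h2.1, h2.2.1, h2.2.2.1, f.convex A h2.2.1 _ (isProf h2.1 h2.2.2.1) p h2.2.2.2 q
    h3.2.2.2 t h0 h1⟩

theorem S_exists (f : PSCF) {A : Finset ℕ} {μ} (hA : A.Nonempty) (h : OK A μ) (hm : 0 < mass μ) :
    ∃ p, S f A p μ := by
  obtain ⟨p, hp⟩ := f.nonempty A hA _ (isProf h hm)
  exact ⟨p, S_iff.2 ⟨h, hA, hm, hp⟩⟩

theorem restrict_smul (A B : Finset ℕ) (c : ℚ) (R) :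
    restrictProfile A B (c • R) = c • restrictProfile A B R := by
  classical
  ext s
  simp [restrictProfile, Finset.mul_sum]

theorem S_comp {f : PSCF} [Nice f] {A' B : Finset ℕ} {b : ℕ} (hb : A' ∩ B = {b}) {ν}
    (hν : OK (A' ∪ B) ν)
    (hc : ∀ l ∈ ν.support, ∀ a ∈ (A' ∪ B) \ B, ∀ b ∈ B, ∀ b' ∈ B,
      ((a, b) ∈ ord l ↔ (a, b') ∈ ord l)) (r : ℕ → ℚ) :
    S f (A' ∪ B) r ν ↔ ∃ p q, S f A' p (ν.mapDomain (fun l => l.filter (· ∈ A'))) ∧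
      S f B q (ν.mapDomain (fun l => l.filter (· ∈ B))) ∧ r = compLottery B b p q := by
  have hbb : b ∈ A' ∩ B := by rw [hb]; simp
  have hA' : A'.Nonempty := ⟨b, (mem_inter.1 hbb).1⟩
  have hB : B.Nonempty := ⟨b, (mem_inter.1 hbb).2⟩
  have hA : (A' ∪ B).Nonempty := hA'.inl
  have ok1 : OK A' (ν.mapDomain (fun l => l.filter (· ∈ A'))) :=
    hν.map (fun l hl => good_filter hl subset_union_left)
  have ok2 : OK B (ν.mapDomain (fun l => l.filter (· ∈ B))) :=
    hν.map (fun l hl => good_filter hl subset_union_right)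
  by_cases hm : 0 < mass ν
  swap
  · constructor
    · intro h; exact absurd h.pos hm
    · rintro ⟨p, q, h, _⟩; have := h.pos; rw [mass_map] at this; exact absurd this hm
  have key := Nice.cc (f := f) A' B b hb ((mass ν)⁻¹ • toProf ν) (isProf hν hm) (by
    refine ⟨subset_union_right, fun a ha b1 hb1 b2 hb2 s hs hpos => ?_⟩
    have : toProf ν s ≠ 0 := by
      intro h; simp [h] at hpos
    rw [toProf_apply] at this
    obtain ⟨l, hl, hl'⟩ := Finset.exists_ne_zero_of_sum_ne_zero this
    split_ifs at hl' with h
    · rw [← h]; exact hc l hl a ha b1 hb1 b2 hb2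
    · exact absurd rfl hl')
  rw [restrict_smul, restrict_smul, restrict_toProf hν.1, restrict_toProf hν.1] at key
  constructor
  · intro h
    obtain ⟨_, _, _, h3⟩ := S_iff.1 h
    rw [key] at h3
    obtain ⟨p, hp, q, hq, rfl⟩ := h3
    refine ⟨p, q, S_iff.2 ⟨ok1, hA', ?_, ?_⟩, S_iff.2 ⟨ok2, hB, ?_, ?_⟩, rfl⟩ <;>
      rw [mass_map] <;> assumption
  · rintro ⟨p, q, hp, hq, rfl⟩
    refine S_iff.2 ⟨hν, hA, hm, ?_⟩
    rw [key]
    have hp' := (S_iff.1 hp).2.2.2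
    have hq' := (S_iff.1 hq).2.2.2
    rw [mass_map] at hp' hq'
    exact ⟨p, hp', q, hq', rfl⟩

def sub (x : ℕ) (s : List ℕ) (l : List ℕ) : List ℕ := l.flatMap (fun a => if a = x then s else [a])

theorem sub_of_notMem {x : ℕ} {s l : List ℕ} (h : x ∉ l) : sub x s l = l := by
  induction l with
  | nil => rfl
  | cons a l ih =>
    rw [List.mem_cons, not_or] at h
    have := ih h.2
    unfold sub at this ⊢
    rw [List.flatMap_cons, this, if_neg (fun e => h.1 e.symm)]; rfl

theorem sub_eq {x : ℕ} {s W V : List ℕ} (hW : x ∉ W) (hV : x ∉ V) :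
    sub x s (W ++ x :: V) = W ++ s ++ V := by
  have h1 := sub_of_notMem (s := s) hW
  have h2 := sub_of_notMem (s := s) hV
  unfold sub at *
  rw [List.flatMap_append, List.flatMap_cons, h1, h2, if_pos rfl, List.append_assoc]

theorem good_split {A : Finset ℕ} {l : List ℕ} (hl : good A l) {x : ℕ} (hx : x ∈ A) :
    ∃ W V, l = W ++ x :: V ∧ x ∉ W ∧ x ∉ V := by
  obtain ⟨W, V, rfl⟩ := List.append_of_mem ((hl.2 x).2 hx)
  have := hl.1
  rw [List.nodup_append, List.nodup_cons] at this
  exact ⟨W, V, rfl, by grind, by grind⟩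

theorem sub_good {A B : Finset ℕ} {x : ℕ} (hb : A ∩ B = {x}) {l s : List ℕ} (hl : good A l)
    (hs : good B s) : good (A ∪ B) (sub x s l) := by
  have hx : ∀ a, a ∈ A ∧ a ∈ B ↔ a = x := by
    intro a; rw [← mem_inter, hb, mem_singleton]
  obtain ⟨W, V, rfl, hW, hV⟩ := good_split hl ((hx x).2 rfl).1
  rw [sub_eq hW hV]
  have h1 := hl.1
  have h2 := hl.2
  have h3 := hs.1
  have h4 := hs.2
  constructor
  · rw [List.append_assoc, List.nodup_append, List.nodup_append]
    rw [List.nodup_append, List.nodup_cons] at h1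
    simp only [List.mem_append, List.mem_cons] at *
    refine ⟨h1.1, ⟨h3, h1.2.1.2, ?_⟩, ?_⟩
    · intro a ha b hb hab
      have := hx b; grind
    · intro a ha b hb hab
      have := hx b; grind
  · intro a
    have := hx a
    have := h2 a
    have := h4 a
    have := h4 x
    simp only [List.mem_append, List.mem_cons, mem_union] at *
    grind

theorem sub_filterA {A B : Finset ℕ} {x : ℕ} (hb : A ∩ B = {x}) {l s : List ℕ} (hl : good A l)
    (hs : good B s) : (sub x s l).filter (· ∈ A) = l := by
  have hx : ∀ a, a ∈ A ∧ a ∈ B ↔ a = x := by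
    intro a; rw [← mem_inter, hb, mem_singleton]
  obtain ⟨W, V, rfl, hW, hV⟩ := good_split hl ((hx x).2 rfl).1
  obtain ⟨W', V', rfl, hW', hV'⟩ := good_split hs ((hx x).2 rfl).2
  rw [sub_eq hW hV]
  have h2 := hl.2
  have h4 := hs.2
  have e1 : W.filter (· ∈ A) = W := by
    rw [List.filter_eq_self]; intro a ha; have := h2 a; simp; grind
  have e2 : V.filter (· ∈ A) = V := by
    rw [List.filter_eq_self]; intro a ha; have := h2 a; simp; grind
  have e3 : W'.filter (· ∈ A) = [] := by
    rw [List.filter_eq_nil_iff]; intro a ha; have := h4 a; have := hx a; simp; grind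
  have e4 : V'.filter (· ∈ A) = [] := by
    rw [List.filter_eq_nil_iff]; intro a ha; have := h4 a; have := hx a; simp; grind
  have e5 : x ∈ A := ((hx x).2 rfl).1
  rw [List.filter_append, List.filter_append, List.filter_append, List.filter_cons, e1, e2, e3, e4]
  simp [e5]

theorem sub_filterB {A B : Finset ℕ} {x : ℕ} (hb : A ∩ B = {x}) {l s : List ℕ} (hl : good A l)
    (hs : good B s) : (sub x s l).filter (· ∈ B) = s := by
  have hx : ∀ a, a ∈ A ∧ a ∈ B ↔ a = x := by
    intro a; rw [← mem_inter, hb, mem_singleton]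
  obtain ⟨W, V, rfl, hW, hV⟩ := good_split hl ((hx x).2 rfl).1
  rw [sub_eq hW hV]
  have h2 := hl.2
  have h4 := hs.2
  have e1 : W.filter (· ∈ B) = [] := by
    rw [List.filter_eq_nil_iff]; intro a ha; have := h2 a; have := hx a; simp; grind
  have e2 : V.filter (· ∈ B) = [] := by
    rw [List.filter_eq_nil_iff]; intro a ha; have := h2 a; have := hx a; simp; grind
  have e3 : s.filter (· ∈ B) = s := by
    rw [List.filter_eq_self]; intro a ha; have := h4 a; simp; grind
  rw [List.filter_append, List.filter_append, e1, e2, e3]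
  simp

theorem sub_comp {A B : Finset ℕ} {x : ℕ} (hb : A ∩ B = {x}) {l s : List ℕ} (hl : good A l)
    (hs : good B s) {a b c : ℕ} (ha : a ∈ (A ∪ B) \ B) (hb1 : b ∈ B) (hc1 : c ∈ B)
    (h : (a, b) ∈ ord (sub x s l)) : (a, c) ∈ ord (sub x s l) := by
  have hx : ∀ a, a ∈ A ∧ a ∈ B ↔ a = x := by
    intro a; rw [← mem_inter, hb, mem_singleton]
  obtain ⟨W, V, rfl, hW, hV⟩ := good_split hl ((hx x).2 rfl).1
  rw [sub_eq hW hV, List.append_assoc, mem_ord_append, mem_ord_append] at *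
  have h2 := hl.2
  have h4 := hs.2
  have k1 := hx b
  have k2 := h2 b
  have k3 := h4 a
  have k4 := @mem_of_mem_ord W a b
  have k5 := @mem_of_mem_ord s a b
  have k6 := @mem_of_mem_ord V a b
  simp only [List.mem_append, List.mem_cons, mem_sdiff] at *
  grind

theorem map_sub_filterA {A B : Finset ℕ} {x : ℕ} (hb : A ∩ B = {x}) {s : List ℕ} (hs : good B s)
    {μ} (hμ : OK A μ) :
    (μ.mapDomain (sub x s)).mapDomain (fun l => l.filter (· ∈ A)) = μ := by
  rw [← Finsupp.mapDomain_comp]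
  conv_rhs => rw [← Finsupp.mapDomain_id (v := μ)]
  exact Finsupp.mapDomain_congr (fun l hl => sub_filterA hb (hμ.1 l hl) hs)

theorem map_const (s : List ℕ) (μ : List ℕ →₀ ℚ) :
    μ.mapDomain (fun _ => s) = Finsupp.single s (mass μ) := by
  induction μ using Finsupp.induction_linear with
  | zero => simp
  | add a b ha hb => rw [Finsupp.mapDomain_add, ha, hb, map_add, Finsupp.single_add]
  | single l c => rw [Finsupp.mapDomain_single, mass_single]

theorem map_sub_filterB {A B : Finset ℕ} {x : ℕ} (hb : A ∩ B = {x}) {s : List ℕ} (hs : good B s)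
    {μ} (hμ : OK A μ) :
    (μ.mapDomain (sub x s)).mapDomain (fun l => l.filter (· ∈ B)) = Finsupp.single s (mass μ) := by
  rw [← Finsupp.mapDomain_comp, ← map_const]
  exact Finsupp.mapDomain_congr (fun l hl => sub_filterB hb (hμ.1 l hl) hs)

theorem OK.sum {ι : Type} {A : Finset ℕ} (I : Finset ι) {μ : ι → List ℕ →₀ ℚ}
    (h : ∀ i ∈ I, OK A (μ i)) : OK A (∑ i ∈ I, μ i) := by
  classical
  induction I using Finset.induction_on with
  | empty => simpa using OK.zero
  | insert i I hi ih =>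
    rw [Finset.sum_insert hi]
    exact (h i (mem_insert_self _ _)).add (ih (fun j hj => h j (mem_insert_of_mem hj)))

theorem S_subs {f : PSCF} [Nice f] {ι : Type} (I : Finset ι) {A B : Finset ℕ} {x : ℕ}
    (hb : A ∩ B = {x}) {s : ι → List ℕ} (hs : ∀ i, good B (s i)) {μ : ι → List ℕ →₀ ℚ}
    (hμ : ∀ i, OK A (μ i)) (r : ℕ → ℚ) :
    S f (A ∪ B) r (∑ i ∈ I, (μ i).mapDomain (sub x (s i))) ↔
      ∃ p q, S f A p (∑ i ∈ I, μ i) ∧ S f B q (∑ i ∈ I, Finsupp.single (s i) (mass (μ i))) ∧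
        r = compLottery B x p q := by
  classical
  rw [S_comp hb]
  · have e : ∀ (h : List ℕ → List ℕ) (g : ι → List ℕ →₀ ℚ),
        (∑ i ∈ I, g i).mapDomain h = ∑ i ∈ I, (g i).mapDomain h := by
      intro h g
      exact map_sum (Finsupp.mapDomain.addMonoidHom h) g I
    rw [e, e]
    have e1 : ∑ i ∈ I, ((μ i).mapDomain (sub x (s i))).mapDomain (fun l => l.filter (· ∈ A))
        = ∑ i ∈ I, μ i := Finset.sum_congr rfl (fun i _ => map_sub_filterA hb (hs i) (hμ i))
    have e2 : ∑ i ∈ I, ((μ i).mapDomain (sub x (s i))).mapDomain (fun l => l.filter (· ∈ B))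
        = ∑ i ∈ I, Finsupp.single (s i) (mass (μ i)) :=
      Finset.sum_congr rfl (fun i _ => map_sub_filterB hb (hs i) (hμ i))
    rw [e1, e2]
  · exact OK.sum I (fun i _ => (hμ i).map (fun l hl => sub_good hb hl (hs i)))
  · intro l hl a ha b hb1 c hc1
    have : l ∈ (I.biUnion fun i => ((μ i).mapDomain (sub x (s i))).support) :=
      Finsupp.support_finsetSum hl
    obtain ⟨i, hi, hl'⟩ := Finset.mem_biUnion.1 this
    obtain ⟨l0, hl0, rfl⟩ := Finset.mem_image.1 (Finsupp.mapDomain_support hl')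
    exact ⟨sub_comp hb ((hμ i).1 l0 hl0) (hs i) ha hb1 hc1,
      sub_comp hb ((hμ i).1 l0 hl0) (hs i) ha hc1 hb1⟩

theorem good_pair {x z : ℕ} (h : x ≠ z) : good {x, z} [x, z] := by
  refine ⟨by simp [h], by simp⟩

theorem good_pair' {x z : ℕ} (h : x ≠ z) : good {x, z} [z, x] := by
  refine ⟨by simp [h.symm], by simp; tauto⟩

theorem inter_pair {A : Finset ℕ} {x z : ℕ} (hx : x ∈ A) (hz : z ∉ A) : A ∩ {x, z} = {x} := by
  ext a; simp; grind

theorem union_pair {A : Finset ℕ} {x z : ℕ} (hx : x ∈ A) : A ∪ {x, z} = insert z A := by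
  ext a; simp; grind

noncomputable def ins (x z : ℕ) (μ1 μ2 : List ℕ →₀ ℚ) : List ℕ →₀ ℚ :=
  μ1.mapDomain (sub x [z, x]) + μ2.mapDomain (sub x [x, z])

noncomputable def pair (x z : ℕ) (a b : ℚ) : List ℕ →₀ ℚ :=
  Finsupp.single [z, x] a + Finsupp.single [x, z] b

theorem S_ins {f : PSCF} [Nice f] {A : Finset ℕ} {x z : ℕ} (hx : x ∈ A) (hz : z ∉ A)
    {μ1 μ2} (h1 : OK A μ1) (h2 : OK A μ2) (r : ℕ → ℚ) :
    S f (insert z A) r (ins x z μ1 μ2) ↔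
      ∃ p q, S f A p (μ1 + μ2) ∧ S f {x, z} q (pair x z (mass μ1) (mass μ2)) ∧
        r = compLottery {x, z} x p q := by
  have hxz : x ≠ z := by rintro rfl; exact hz hx
  have := S_subs (f := f) (Finset.univ : Finset Bool) (inter_pair hx hz)
    (s := fun i => if i then [z, x] else [x, z])
    (by intro i; cases i
        · simpa using good_pair hxz
        · simpa using good_pair' hxz)
    (μ := fun i => if i then μ1 else μ2) (by intro i; cases i <;> simpa) r
  simpa [union_pair hx, ins, pair] using this

theorem OK_ins {A : Finset ℕ} {x z : ℕ} (hx : x ∈ A) (hz : z ∉ A)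
    {μ1 μ2} (h1 : OK A μ1) (h2 : OK A μ2) : OK (insert z A) (ins x z μ1 μ2) := by
  have hxz : x ≠ z := by rintro rfl; exact hz hx
  rw [← union_pair hx]
  exact (h1.map (fun l hl => sub_good (inter_pair hx hz) hl (good_pair' hxz))).add
    (h2.map (fun l hl => sub_good (inter_pair hx hz) hl (good_pair hxz)))

theorem mass_ins (x z μ1 μ2) : mass (ins x z μ1 μ2) = mass μ1 + mass μ2 := by
  rw [ins, map_add, mass_map, mass_map]

theorem S_unan {f : PSCF} {x z : ℕ} (h : x ≠ z) {c : ℚ} (hc : 0 < c) (q : ℕ → ℚ) :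
    S f {x, z} q (Finsupp.single [x, z] c) ↔ q = degLottery x := by
  have ok : OK {x, z} (Finsupp.single [x, z] c) := OK.single (good_pair h) hc.le
  have hm : mass (Finsupp.single [x, z] c) = c := mass_single _ _
  have hpr := isProf ok (by rw [hm]; exact hc)
  have hmar := margin_toProf ok.1 x z
  have := f.unanimity x z _ hpr (by
    classical
    rw [hm]
    have h1 := sum_toProf ok.1 (fun r => if (x, z) ∈ r ∧ (z, x) ∉ r then (1 : ℚ) else 0)
    unfold pref
    rw [Finset.sum_filter]
    rw [ev_single] at h1
    simp only [smul_eq_mul, mul_ite, mul_one, mul_zero] at h1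
    simp only [Pi.smul_apply, smul_eq_mul]
    rw [if_pos] at h1
    · have e : ∀ r, (if (x, z) ∈ r ∧ (z, x) ∉ r then c⁻¹ * toProf (Finsupp.single [x, z] c) r else 0)
          = c⁻¹ * (if (x, z) ∈ r ∧ (z, x) ∉ r then toProf (Finsupp.single [x, z] c) r else 0) := by
        intro r; split_ifs <;> simp
      simp only [e]
      rw [← Finset.mul_sum, h1, inv_mul_cancel₀ hc.ne']
    · simp only [mem_ord_cons, mem_ord_nil]; simp; grind)
  rw [S_iff, this, hm]
  constructor
  · rintro ⟨_, _, _, h⟩; exact h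
  · rintro h'; exact ⟨ok, by simp, hc, h'⟩

theorem ofNotMem {f A p μ} (h : S f A p μ) {x : ℕ} (hx : x ∉ A) : p x = 0 := h.lot.1 x hx

/-- neutrality for a fresh alternative -/
theorem neut1 {f : PSCF} [Nice f] {A : Finset ℕ} {x z : ℕ} (hx : x ∈ A) (hz : z ∉ A)
    {μ p} (h : S f A p μ) :
    S f (insert z (A.erase x)) (p ∘ Equiv.swap x z) (μ.mapDomain (List.map (Equiv.swap x z))) := by
  have hxz : x ≠ z := by rintro rfl; exact hz hx
  have hok := h.ok
  have hm := h.pos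
  have hx' : x ∉ insert z (A.erase x) := by simp [hxz]
  have hz' : z ∈ insert z (A.erase x) := by simp
  have hmap : ∀ l, good A l → good (insert z (A.erase x)) (l.map (Equiv.swap x z)) := by
    intro l hl
    refine ⟨hl.1.map (Equiv.injective _), fun a => ?_⟩
    rw [List.mem_map]
    constructor
    · rintro ⟨b, hb, rfl⟩
      rw [hl.2] at hb
      rw [Equiv.swap_apply_def]
      split_ifs <;> simp_all
    · intro ha
      refine ⟨Equiv.swap x z a, ?_, by simp⟩
      rw [hl.2, Equiv.swap_apply_def]
      split_ifs <;> simp_all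
  have hok' : OK (insert z (A.erase x)) (μ.mapDomain (List.map (Equiv.swap x z))) := hok.map hmap
  have hset : insert x (insert z (A.erase x)) = insert z A := by
    ext a; simp; grind
  have h1 : S f (insert z A) p (ins x z 0 μ) := by
    rw [S_ins hx hz OK.zero hok]
    refine ⟨p, degLottery x, by simpa using h, ?_, ?_⟩
    · have := (S_unan (f := f) hxz hm (degLottery x)).2 rfl
      simpa [pair] using this
    · ext a
      have := ofNotMem h hz
      simp only [compLottery, degLottery, mem_insert, mem_singleton]
      grind
  have e : ins x z 0 μ = ins z x (μ.mapDomain (List.map (Equiv.swap x z))) 0 := by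
    simp only [ins, Finsupp.mapDomain_zero, zero_add, add_zero]
    rw [← Finsupp.mapDomain_comp]
    refine Finsupp.mapDomain_congr (fun l hl => ?_)
    obtain ⟨W, V, rfl, hW, hV⟩ := good_split (hok.1 l hl) hx
    have hgl := (hok.1 _ hl).2
    have hzl : z ∉ W ++ x :: V := by rw [hgl]; exact hz
    rw [sub_eq hW hV, Function.comp_apply, List.map_append, List.map_cons, Equiv.swap_apply_left]
    have e1 : ∀ U : List ℕ, x ∉ U → z ∉ U → U.map (Equiv.swap x z) = U := by
      intro U h1 h2
      conv_rhs => rw [← List.map_id U]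
      refine List.map_congr_left (fun a ha => ?_)
      rw [Equiv.swap_apply_of_ne_of_ne] <;> grind
    rw [e1 W hW (by grind), e1 V hV (by grind), sub_eq (by grind) (by grind)]
  rw [e, ← hset, S_ins hz' hx' hok' OK.zero] at h1
  obtain ⟨p', q, hp', hq, hpq⟩ := h1
  rw [add_zero] at hp'
  have hq' : q = degLottery x := by
    rw [mass_map, Finset.pair_comm] at hq
    exact (S_unan (f := f) hxz hm q).1 (by simpa [pair] using hq)
  convert hp' using 1
  ext a
  have h3 := ofNotMem hp' hx'
  subst hq'
  rw [hpq]
  simp only [compLottery, degLottery, mem_insert, mem_singleton, Function.comp_apply]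
  rw [Equiv.swap_apply_def]
  split_ifs <;> simp_all

theorem map_swap_eq {A : Finset ℕ} {x z : ℕ} (hx : x ∉ A) (hz : z ∉ A) {μ} (h : OK A μ) :
    μ.mapDomain (List.map (Equiv.swap x z)) = μ := by
  conv_rhs => rw [← Finsupp.mapDomain_id (v := μ)]
  refine Finsupp.mapDomain_congr (fun l hl => ?_)
  have := (h.1 l hl).2
  conv_rhs => rw [id, ← List.map_id l]
  refine List.map_congr_left (fun a ha => ?_)
  rw [Equiv.swap_apply_of_ne_of_ne] <;> grind

/-- neutrality for a swap of two members -/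
theorem neut2 {f : PSCF} [Nice f] {A : Finset ℕ} {x z : ℕ} (hx : x ∈ A) (hz : z ∈ A)
    {μ p} (h : S f A p μ) :
    S f A (p ∘ Equiv.swap x z) (μ.mapDomain (List.map (Equiv.swap x z))) := by
  by_cases hxz : x = z
  · subst hxz
    have e : (μ.mapDomain (List.map (Equiv.swap x x))) = μ := by
      simp only [Equiv.swap_self, Equiv.coe_refl, List.map_id_fun, Finsupp.mapDomain_id]
    rw [e]
    simpa using h
  obtain ⟨c, hc⟩ := Infinite.exists_notMem_finset A
  have hcx : c ≠ x := by rintro rfl; exact hc hx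
  have hcz : c ≠ z := by rintro rfl; exact hc hz
  have h1 := neut1 hx hc h
  have h2 := neut1 (x := z) (z := x) (by simp [hz, Ne.symm hxz]) (by simp [hcx.symm]) h1
  have h3 := neut1 (x := c) (z := z) (by simp [hcx, hcz]) (by simp [hcz.symm, Ne.symm hxz]) h2
  have hs : insert z ((insert x ((insert c (A.erase x)).erase z)).erase c) = A := by
    ext a; simp; grind
  rw [hs] at h3
  have he : ∀ a, Equiv.swap c z (Equiv.swap z x (Equiv.swap x c a)) =
      if a = c then c else Equiv.swap x z a := by
    intro a
    simp only [Equiv.swap_apply_def]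
    split_ifs <;> simp_all
  have he2 : ∀ a, Equiv.swap x c (Equiv.swap z x (Equiv.swap c z a)) =
      if a = c then c else Equiv.swap x z a := by
    intro a
    simp only [Equiv.swap_apply_def]
    split_ifs <;> simp_all
  convert h3 using 1
  · ext a
    simp only [Function.comp_apply, he2]
    split_ifs with ha
    · rw [ha, Equiv.swap_apply_of_ne_of_ne hcx hcz]
    · rfl
  · rw [← Finsupp.mapDomain_comp, ← Finsupp.mapDomain_comp]
    refine Finsupp.mapDomain_congr (fun l hl => ?_)
    simp only [Function.comp_apply, List.map_map]
    refine List.map_congr_left (fun a ha => ?_)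
    simp only [Function.comp_apply, he]
    rw [if_neg]
    rintro rfl
    exact hc (((h.ok.1 l hl).2 _).1 ha)

theorem pair_add (x z a b a' b') : pair x z a b + pair x z a' b' = pair x z (a + a') (b + b') := by
  unfold pair; rw [Finsupp.single_add, Finsupp.single_add]; abel

theorem pair_smul (x z) (c a b : ℚ) : c • pair x z a b = pair x z (c * a) (c * b) := by
  unfold pair; rw [smul_add, Finsupp.smul_single, Finsupp.smul_single]; rfl

theorem mass_pair (x z a b) : mass (pair x z a b) = a + b := by
  rw [pair, map_add, mass_single, mass_single]

theorem OK_pair {x z : ℕ} (h : x ≠ z) {a b : ℚ} (ha : 0 ≤ a) (hb : 0 ≤ b) :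
    OK {x, z} (pair x z a b) := (OK.single (good_pair' h) ha).add (OK.single (good_pair h) hb)

theorem pair_comm' (x z : ℕ) (a b : ℚ) : pair x z a b = pair z x b a := by
  unfold pair; rw [add_comm]

theorem pair_swap {f : PSCF} [Nice f] {x z : ℕ} {a b : ℚ} {q} (h : S f {x, z} q (pair x z a b)) :
    S f {x, z} (q ∘ Equiv.swap x z) (pair x z b a) := by
  have := neut2 (x := x) (z := z) (by simp) (by simp) h
  convert this using 1
  unfold pair
  rw [Finsupp.mapDomain_add, Finsupp.mapDomain_single, Finsupp.mapDomain_single]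
  simp [add_comm]

theorem lot_pair {x z : ℕ} (hxz : x ≠ z) {q} (h : IsLottery {x, z} q) : q x = 1 - q z := by
  have := h.2.2
  rw [Finset.sum_pair hxz] at this; linarith

theorem lot_ext {x z : ℕ} (hxz : x ≠ z) {q q'} (h : IsLottery {x, z} q) (h' : IsLottery {x, z} q')
    (e : q z = q' z) : q = q' := by
  ext a
  have h1 := lot_pair hxz h
  have h2 := lot_pair hxz h'
  by_cases hz : a = z
  · rw [hz, e]
  by_cases hx : a = x
  · rw [hx, h1, h2, e]
  rw [h.1 a (by simp [hx, hz]), h'.1 a (by simp [hx, hz])]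

theorem lot_deg {A : Finset ℕ} {x : ℕ} (h : x ∈ A) : IsLottery A (degLottery x) := by
  refine ⟨fun a ha => ?_, fun a => ?_, ?_⟩
  · unfold degLottery; rw [if_neg]; rintro rfl; exact ha h
  · unfold degLottery; split_ifs <;> simp
  · simp [degLottery, h]

theorem pair_idem {f : PSCF} [Nice f] {x z : ℕ} (hxz : x ≠ z) {a b : ℚ} (ha : 0 ≤ a) (hb : 0 ≤ b)
    {q} (h : S f {x, z} q (pair x z a b)) (hu : ∀ q', S f {x, z} q' (pair x z a b) → q' = q) :
    q z * q z = q z := by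
  obtain ⟨w, hw⟩ := Infinite.exists_notMem_finset {x, z}
  have hwx : w ≠ x := by rintro rfl; simp at hw
  have hwz : w ≠ z := by rintro rfl; simp at hw
  have hq' := neut1 (x := x) (z := w) (by simp) hw h
  have e1 : insert w (({x, z} : Finset ℕ).erase x) = {z, w} := by ext a; simp; grind
  have e2 : (pair x z a b).mapDomain (List.map (Equiv.swap x w)) = pair z w b a := by
    unfold pair
    rw [Finsupp.mapDomain_add, Finsupp.mapDomain_single, Finsupp.mapDomain_single]
    simp [Equiv.swap_apply_of_ne_of_ne hxz.symm hwz.symm, add_comm]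
  rw [e1, e2] at hq'
  have oz : OK {x, z} (Finsupp.single [x, z] b) := OK.single (good_pair hxz) hb
  have ox : OK {x, z} (Finsupp.single [z, x] a) := OK.single (good_pair' hxz) ha
  have h1 := (S_ins (x := z) (z := w) (f := f) (by simp) hw oz ox
    (compLottery {z, w} z q (q ∘ Equiv.swap x w))).2 ⟨q, _, by
      rw [add_comm]; exact h, by rw [mass_single, mass_single]; exact hq', rfl⟩
  have e3 : ins z w (Finsupp.single [x, z] b) (Finsupp.single [z, x] a) =
      ins x w (Finsupp.single [z, x] a) (Finsupp.single [x, z] b) := by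
    unfold ins
    simp only [Finsupp.mapDomain_single]
    simp [sub, hxz, hxz.symm, add_comm]
  rw [e3, S_ins (x := x) (z := w) (f := f) (by simp) hw ox oz] at h1
  obtain ⟨p', q', hp', _, hpq⟩ := h1
  have hp2 := hu p' hp'
  subst hp2
  have := congrFun hpq z
  simp only [compLottery, Function.comp_apply] at this
  simpa [hxz, hxz.symm, hwz.symm, Equiv.swap_apply_of_ne_of_ne hxz.symm hwz.symm] using this

theorem two_list {x z : ℕ} (hxz : x ≠ z) {l} (h : good {x, z} l) : l = [x, z] ∨ l = [z, x] := by
  have h1 : l.Perm [x, z] := by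
    rw [List.perm_ext_iff_of_nodup h.1 (good_pair hxz).1]
    intro a; rw [h.2, (good_pair hxz).2]
  have := h1.length_eq
  match l, this with
  | [c, d], _ =>
    have hn := h.1
    have h2 := h.2
    have hc := (h2 c).1 (by simp)
    have hd := (h2 d).1 (by simp)
    simp at hn hc hd ⊢
    grind

theorem two_meas {x z : ℕ} (hxz : x ≠ z) {ν} (h : OK {x, z} ν) :
    ν = pair x z (ν [z, x]) (ν [x, z]) := by
  have hne : [x, z] ≠ [z, x] := by simp [hxz]
  ext l
  unfold pair
  rw [Finsupp.add_apply, Finsupp.single_apply, Finsupp.single_apply]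
  by_cases hl : l ∈ ν.support
  · rcases two_list hxz (h.1 l hl) with rfl | rfl
    · rw [if_neg hne.symm]; simp
    · rw [if_neg hne]; simp
  · rw [Finsupp.notMem_support_iff] at hl
    split_ifs with h1 h2 h2 <;> simp_all

theorem toProf_pair {x z : ℕ} (hxz : x ≠ z) (a b : ℚ) :
    toProf (pair x z a b) (ord [z, x]) = a := by
  have : ord [x, z] ≠ ord [z, x] := by
    intro h
    have h1 : (x, z) ∈ ord [x, z] := by simp only [mem_ord_cons, mem_ord_nil]; simp
    rw [h] at h1
    simp only [mem_ord_cons, mem_ord_nil] at h1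
    simp at h1; grind
  unfold pair toProf
  rw [map_add, ev_single, ev_single]
  simp [this]

theorem pair_dec (f : PSCF) {x z : ℕ} (hxz : x ≠ z) {t ε : ℚ} (h0 : 0 ≤ t) (h1 : t ≤ 1)
    (hε : 0 < ε) : ∃ a q, 0 ≤ a ∧ a ≤ 1 ∧ |t - a| < ε ∧
      ∀ q', S f {x, z} q' (pair x z a (1 - a)) ↔ q' = q := by
  have ok : OK {x, z} (pair x z t (1 - t)) := OK_pair hxz h0 (by linarith)
  have hm : mass (pair x z t (1 - t)) = 1 := by rw [mass_pair]; ring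
  have hpr := isProf ok (by rw [hm]; exact one_pos)
  rw [hm, inv_one, one_smul] at hpr
  obtain ⟨R', hR', hd, q, hq⟩ := f.decisive {x, z} (by simp) _ hpr ε hε
  obtain ⟨ν, hν, rfl⟩ := exists_list hR'.1 hR'.2.1
  have hmν : mass ν = 1 := by rw [← sum_toProf_mass hν.1]; exact hR'.2.2
  have e := two_meas hxz hν
  have e2 : ν [z, x] + ν [x, z] = 1 := by rw [e, mass_pair] at hmν; exact hmν
  have e3 : ν [x, z] = 1 - ν [z, x] := by linarith
  rw [e3] at e
  refine ⟨ν [z, x], q, hν.2 _, by have := hν.2 [x, z]; linarith, ?_, ?_⟩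
  · refine lt_of_le_of_lt ?_ hd
    unfold profileDist
    have := Finset.single_le_sum (f := fun r => |toProf (pair x z t (1 - t)) r - toProf ν r|)
      (fun r _ => abs_nonneg _) (ord_mem (good_pair' hxz))
    refine le_trans (le_of_eq ?_) this
    rw [toProf_pair hxz]
    conv_rhs => rw [e, toProf_pair hxz]
  · intro q'
    rw [← e, S_iff, hmν, inv_one, one_smul, hq]
    constructor
    · rintro ⟨_, _, _, h⟩; exact h
    · intro h; exact ⟨hν, by simp, one_pos, h⟩

theorem pair_unan {f : PSCF} {x z : ℕ} (hxz : x ≠ z) {c : ℚ} (hc : 0 < c) :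
    S f {x, z} (degLottery z) (pair x z c 0) := by
  have := (S_unan (f := f) hxz.symm hc (degLottery z)).2 rfl
  rw [Finset.pair_comm] at this
  simpa [pair] using this

theorem pair_unan' {f : PSCF} {x z : ℕ} (hxz : x ≠ z) {c : ℚ} (hc : 0 < c) :
    S f {x, z} (degLottery x) (pair x z 0 c) := by
  have := (S_unan (f := f) hxz hc (degLottery x)).2 rfl
  simpa [pair] using this

/-- some interior profile above one half and below `t` with unique outcome `z` -/
theorem pair_mid {f : PSCF} [Nice f] {x z : ℕ} (hxz : x ≠ z) {t : ℚ} (h : 1 / 2 < t) (h1 : t ≤ 1) :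
    ∃ a, 1 / 2 < a ∧ a < t ∧ ∀ q', S f {x, z} q' (pair x z a (1 - a)) ↔ q' = degLottery z := by
  obtain ⟨a, q, ha0, ha1, hd, hq⟩ := pair_dec f hxz (t := (1 / 2 + t) / 2)
    (ε := (t - 1 / 2) / 2) (by linarith) (by linarith) (by linarith)
  rw [abs_lt] at hd
  have h2 : 1 / 2 < a := by linarith
  have h3 : a < t := by linarith
  refine ⟨a, h2, h3, ?_⟩
  suffices hz : S f {x, z} (degLottery z) (pair x z a (1 - a)) by
    have := (hq _).1 hz
    rw [this]; exact hq
  have hS := (hq q).2 rfl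
  have hid := pair_idem hxz ha0 (by linarith) hS (fun q' h => (hq q').1 h)
  have hl := hS.lot
  have : q z = 1 ∨ q z = 0 := by
    rcases eq_or_ne (q z) 0 with h | h
    · exact Or.inr h
    · left; exact mul_left_cancel₀ h (by rw [hid, mul_one])
  rcases this with h4 | h4
  · have : q = degLottery z := lot_ext hxz hl (lot_deg (by simp)) (by rw [h4]; simp [degLottery])
    rw [← this]; exact hS
  · have : q ∘ Equiv.swap x z = degLottery z := by
      have hx := lot_pair hxz hl
      ext b
      simp only [Function.comp_apply, degLottery, Equiv.swap_apply_def]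
      have := hl.1 b
      simp at this
      split_ifs <;> simp_all
    have hS' := pair_swap hS
    rw [this] at hS'
    have hpos : 0 < a := by linarith
    rcases eq_or_lt_of_le ha1 with h5 | h5
    · subst h5
      simpa using pair_unan (f := f) hxz one_pos
    · have := (hS'.smul (c := (1 - a) / a) (div_pos (by linarith) hpos)).add
        (pair_unan (f := f) hxz (c := a - (1 - a) / a * (1 - a)) (by
          rw [sub_pos, div_mul_eq_mul_div, div_lt_iff₀ hpos]; nlinarith))
      rw [pair_smul, pair_add] at this
      convert this using 2
      · ring
      · field_simp; ring

theorem pair_gt_mem {f : PSCF} [Nice f] {x z : ℕ} (hxz : x ≠ z) {a b : ℚ} (hb : 0 ≤ b)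
    (hab : b < a) : S f {x, z} (degLottery z) (pair x z a b) := by
  have hs : 0 < a + b := by linarith
  obtain ⟨s, h1, h2, h3⟩ := pair_mid (f := f) hxz (t := a / (a + b))
    (by rw [lt_div_iff₀ hs]; linarith) (by rw [div_le_one hs]; linarith)
  rw [lt_div_iff₀ hs] at h2
  have hS := (h3 _).2 rfl
  rcases eq_or_lt_of_le hb with h | h
  · subst h; exact pair_unan hxz hab
  · have hs1 : s < 1 := by nlinarith
    have h5 : 0 < 1 - s := by linarith
    have := (hS.smul (c := b / (1 - s)) (div_pos h h5)).add (pair_unan (f := f) hxz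
      (c := a - b / (1 - s) * s) (by
        rw [sub_pos, div_mul_eq_mul_div, div_lt_iff₀ h5]; nlinarith))
    rw [pair_smul, pair_add] at this
    convert this using 2
    · ring
    · field_simp; ring

theorem pair_dist {x z : ℕ} (hxz : x ≠ z) (a b a' b' : ℚ) :
    profileDist {x, z} (toProf (pair x z a b)) (toProf (pair x z a' b')) ≤ |a - a'| + |b - b'| := by
  unfold profileDist
  have e : ∀ r, |toProf (pair x z a b) r - toProf (pair x z a' b') r| ≤
      (if ord [z, x] = r then |a - a'| else 0) + (if ord [x, z] = r then |b - b'| else 0) := by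
    intro r
    rw [← Pi.sub_apply, ← map_sub]
    have : pair x z a b - pair x z a' b' = pair x z (a - a') (b - b') := by
      unfold pair; rw [Finsupp.single_sub, Finsupp.single_sub]; abel
    rw [this]
    unfold pair toProf
    rw [map_add, ev_single, ev_single, Pi.add_apply]
    refine (abs_add_le _ _).trans (add_le_add ?_ ?_)
    · simp only [Pi.smul_apply]; split_ifs <;> simp
    · simp only [Pi.smul_apply]; split_ifs <;> simp
  refine (Finset.sum_le_sum (fun r _ => e r)).trans ?_
  rw [Finset.sum_add_distrib, Finset.sum_ite_eq, Finset.sum_ite_eq]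
  rw [if_pos (ord_mem (good_pair' hxz)), if_pos (ord_mem (good_pair hxz))]

theorem pair_half_near {f : PSCF} [Nice f] {x z : ℕ} (hxz : x ≠ z) {ε : ℚ} (hε : 0 < ε) :
    ∃ q, S f {x, z} q (pair x z (1 / 2) (1 / 2)) ∧ 1 - ε < q z := by
  have ok : OK {x, z} (pair x z (1 / 2) (1 / 2)) := OK_pair hxz (by norm_num) (by norm_num)
  have hm : mass (pair x z (1 / 2) (1 / 2)) = 1 := by rw [mass_pair]; norm_num
  have hpr := isProf ok (by rw [hm]; exact one_pos)
  rw [hm, inv_one, one_smul] at hpr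
  obtain ⟨δ, hδ, hc⟩ := f.continuity {x, z} (by simp) _ hpr ε hε
  set η := min (δ / 3) (1 / 2) with hη
  have hη0 : 0 < η := lt_min (by linarith) (by norm_num)
  have hη1 : η ≤ δ / 3 := min_le_left _ _
  have hη2 : η ≤ 1 / 2 := min_le_right _ _
  have ok' : OK {x, z} (pair x z (1 / 2 + η) (1 / 2 - η)) := OK_pair hxz (by linarith) (by linarith)
  have hm' : mass (pair x z (1 / 2 + η) (1 / 2 - η)) = 1 := by rw [mass_pair]; ring
  have hpr' := isProf ok' (by rw [hm']; exact one_pos)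
  have hS := pair_gt_mem (f := f) hxz (a := 1 / 2 + η) (b := 1 / 2 - η) (by linarith) (by linarith)
  have hmem := (S_iff.1 hS).2.2.2
  rw [hm', inv_one, one_smul] at hpr' hmem
  obtain ⟨q, hq, hd⟩ := hc _ hpr' (by
    refine lt_of_le_of_lt (pair_dist hxz _ _ _ _) ?_
    have e1 : |(1 : ℚ) / 2 - (1 / 2 + η)| = η := by rw [abs_sub_comm, abs_of_pos] <;> linarith
    have e2 : |(1 : ℚ) / 2 - (1 / 2 - η)| = η := by rw [abs_of_pos] <;> linarith
    rw [e1, e2]; linarith) _ hmem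
  refine ⟨q, S_iff.2 ⟨ok, by simp, by rw [hm]; exact one_pos, by
    rw [hm, inv_one, one_smul]; exact hq⟩, ?_⟩
  have := Finset.single_le_sum (f := fun a => |degLottery z a - q a|) (s := {x, z})
      (fun r _ => abs_nonneg _) (a := z) (by simp)
  have h2 := lt_of_le_of_lt this hd
  simp only [degLottery, if_true] at h2
  have := le_abs_self (1 - q z)
  linarith

/-- ties -/
theorem pair_eq {f : PSCF} [Nice f] {x z : ℕ} (hxz : x ≠ z) {a : ℚ} (ha : 0 < a) {q}
    (hq : IsLottery {x, z} q) (h0 : 0 < q z) (h1 : q z < 1) : S f {x, z} q (pair x z a a) := by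
  suffices h : S f {x, z} q (pair x z (1 / 2) (1 / 2)) by
    have := h.smul (c := 2 * a) (by linarith)
    rw [pair_smul] at this
    convert this using 2 <;> ring
  obtain ⟨q1, hq1, hz1⟩ := pair_half_near (f := f) hxz (ε := 1 - q z) (by linarith)
  obtain ⟨q2, hq2, hz2⟩ := pair_half_near (f := f) hxz.symm (ε := q z) (by linarith)
  rw [pair_comm', Finset.pair_comm] at hq2
  have hz3 := lot_pair hxz hq2.lot
  have hlt : 0 < q1 z - q2 z := by linarith
  have := hq1.conv hq2 (t := (q z - q2 z) / (q1 z - q2 z))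
    (div_nonneg (by linarith) hlt.le) (by rw [div_le_one hlt]; linarith)
  convert this using 1
  refine lot_ext hxz hq this.lot ?_
  field_simp
  ring

theorem pair_gt {f : PSCF} [Nice f] {x z : ℕ} (hxz : x ≠ z) {a b : ℚ} (hb : 0 ≤ b)
    (hab : b < a) {q} (h : S f {x, z} q (pair x z a b)) : q = degLottery z := by
  have hs : 0 < a + b := by linarith
  obtain ⟨s, h1, h2, h3⟩ := pair_mid (f := f) hxz (t := a / (a + b))
    (by rw [lt_div_iff₀ hs]; linarith) (by rw [div_le_one hs]; linarith)
  rw [lt_div_iff₀ hs] at h2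
  have hl := h.lot
  have hx := lot_pair hxz hl
  have hx0 := hl.2.1 x
  have hz0 := hl.2.1 z
  rcases eq_or_lt_of_le hz0 with h4 | h4
  · have e : q = degLottery x := lot_ext hxz hl (lot_deg (by simp)) (by
      rw [← h4]; simp [degLottery, hxz.symm])
    rw [e] at h ⊢
    have ha : 0 < a := by linarith
    have := (h.smul (c := s / a) (div_pos (by linarith) ha)).add (pair_unan' (f := f) hxz
      (c := 1 - s - s / a * b) (by
        have : s / a * (a + b) < 1 := by rw [div_mul_eq_mul_div, div_lt_one ha]; exact h2
        have e : s / a * a = s := by field_simp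
        nlinarith))
    rw [pair_smul, pair_add] at this
    rw [← h3]
    convert this using 2
    · field_simp; ring
    · ring
  rcases eq_or_lt_of_le hx0 with h5 | h5
  · exact lot_ext hxz hl (lot_deg (by simp)) (by simp [degLottery]; linarith)
  have hd : 0 < a - b := by linarith
  set c := (2 * s - 1) / (a - b) with hcdef
  have hc : 0 < c := div_pos (by linarith) hd
  have hcd : c * (a - b) = 2 * s - 1 := by rw [hcdef]; field_simp
  have hhalf := pair_eq (f := f) hxz (a := s - c * a) (by
    have : c * (a + b) < 1 := by
      rw [hcdef, div_mul_eq_mul_div, div_lt_one hd]; nlinarith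
    nlinarith) hl h4 (by linarith)
  have := (h.smul hc).add hhalf
  rw [pair_smul, pair_add] at this
  rw [← h3]
  convert this using 2
  · ring
  · linarith


theorem ins_zero {f : PSCF} [Nice f] {A : Finset ℕ} {x z : ℕ} (hx : x ∈ A) (hz : z ∉ A)
    {μ1 μ2} (h1 : OK A μ1) (h2 : OK A μ2) {p} (h : S f A p (μ1 + μ2)) (hp : p x = 0) :
    S f (insert z A) p (ins x z μ1 μ2) := by
  have hxz : x ≠ z := by rintro rfl; exact hz hx
  obtain ⟨q, hq⟩ := S_exists f (A := {x, z}) (by simp)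
    (OK_pair hxz h1.mass_nonneg h2.mass_nonneg) (by rw [mass_pair, ← map_add]; exact h.pos)
  refine (S_ins hx hz h1 h2 p).2 ⟨p, q, h, hq, ?_⟩
  have := ofNotMem h hz
  ext a
  simp only [compLottery, mem_insert, mem_singleton, hp]
  grind

theorem ins_lt {f : PSCF} [Nice f] {A : Finset ℕ} {x z : ℕ} (hx : x ∈ A) (hz : z ∉ A)
    {μ1 μ2} (h1 : OK A μ1) (h2 : OK A μ2) (hm : mass μ1 < mass μ2) {p} (h : S f A p (μ1 + μ2)) :
    S f (insert z A) p (ins x z μ1 μ2) := by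
  have hxz : x ≠ z := by rintro rfl; exact hz hx
  have hq := pair_gt_mem (f := f) hxz.symm h1.mass_nonneg hm
  rw [pair_comm', Finset.pair_comm] at hq
  refine (S_ins hx hz h1 h2 p).2 ⟨p, _, h, hq, ?_⟩
  have := ofNotMem h hz
  ext a
  simp only [compLottery, degLottery, mem_insert, mem_singleton]
  grind

theorem ins_gt {f : PSCF} [Nice f] {A : Finset ℕ} {x z : ℕ} (hx : x ∈ A) (hz : z ∉ A)
    {μ1 μ2} (h1 : OK A μ1) (h2 : OK A μ2) (hm : mass μ2 < mass μ1) {p} (h : S f A p (μ1 + μ2)) :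
    S f (insert z A) (p ∘ Equiv.swap x z) (ins x z μ1 μ2) := by
  have hxz : x ≠ z := by rintro rfl; exact hz hx
  have hq := pair_gt_mem (f := f) hxz h2.mass_nonneg hm
  refine (S_ins hx hz h1 h2 _).2 ⟨p, _, h, hq, ?_⟩
  have := ofNotMem h hz
  ext a
  simp only [compLottery, degLottery, mem_insert, mem_singleton, Function.comp_apply,
    Equiv.swap_apply_def]
  grind

theorem ins_eq {f : PSCF} [Nice f] {A : Finset ℕ} {x z : ℕ} (hx : x ∈ A) (hz : z ∉ A)
    {μ1 μ2} (h1 : OK A μ1) (h2 : OK A μ2) (hm : mass μ1 = mass μ2) {p} (h : S f A p (μ1 + μ2))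
    {r : ℕ → ℚ} (hr : ∀ a, a ≠ x → a ≠ z → r a = p a) (hs : r x + r z = p x) (hrx : 0 < r x)
    (hrz : 0 < r z) :
    S f (insert z A) r (ins x z μ1 μ2) := by
  have hxz : x ≠ z := by rintro rfl; exact hz hx
  have hpos := h.pos
  rw [map_add, ← hm] at hpos
  have hpx : 0 < p x := by linarith
  set q : ℕ → ℚ := fun a => if a = x then r x / p x else if a = z then r z / p x else 0 with hqdef
  have hqx : q x = r x / p x := by simp [hqdef]
  have hqz : q z = r z / p x := by simp [hqdef, hxz.symm]
  have hl : IsLottery {x, z} q := by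
    refine ⟨fun a ha => ?_, fun a => ?_, ?_⟩
    · simp at ha; simp [hqdef, ha]
    · simp only [hqdef]; split_ifs <;> positivity
    · rw [Finset.sum_pair hxz, hqx, hqz, ← add_div, hs, div_self hpx.ne']
  have hq := pair_eq (f := f) hxz (a := mass μ1) (by linarith) hl (by rw [hqz]; positivity) (by
    rw [hqz, div_lt_one hpx]; linarith)
  refine (S_ins hx hz h1 h2 _).2 ⟨p, q, h, by rw [← hm]; exact hq, ?_⟩
  ext a
  simp only [compLottery, mem_insert, mem_singleton]
  by_cases ha : a = x
  · rw [if_pos (Or.inl ha), ha, hqx, mul_div_cancel₀ _ hpx.ne']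
  by_cases ha' : a = z
  · rw [if_pos (Or.inr ha'), ha', hqz, mul_div_cancel₀ _ hpx.ne']
  · rw [if_neg (by tauto), hr a ha ha']

def rho (x z a : ℕ) : ℕ := if a = z then x else a

theorem mem_ord_sub {A : Finset ℕ} {x z : ℕ} (hx : x ∈ A) (hz : z ∉ A) {l : List ℕ}
    (hl : good A l) {s : List ℕ} (hs : s = [z, x] ∨ s = [x, z]) {a b : ℕ}
    (hab : ¬ (a = x ∧ b = z) ∧ ¬ (a = z ∧ b = x)) :
    (a, b) ∈ ord (sub x s l) ↔ (rho x z a, rho x z b) ∈ ord l := by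
  have hxz : x ≠ z := by rintro rfl; exact hz hx
  obtain ⟨W, V, rfl, hW, hV⟩ := good_split hl hx
  have hzl : z ∉ W ++ x :: V := by rw [hl.2]; exact hz
  have k : ∀ (U : List ℕ) (a b : ℕ), (a, b) ∈ ord U → a ∈ U ∧ b ∈ U := fun U a b => mem_of_mem_ord
  rw [sub_eq hW hV, List.append_assoc]
  have k1 := k W a b
  have k2 := k V a b
  have k3 := k W (rho x z a) (rho x z b)
  have k4 := k V (rho x z a) (rho x z b)
  rcases hs with rfl | rfl <;>
  simp only [mem_ord_append, mem_ord_cons, mem_ord_nil, List.mem_append, List.mem_cons, List.not_mem_nil] at * <;>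
  unfold rho at * <;>
  split_ifs at * <;> grind

theorem sg_sub {A : Finset ℕ} {x z : ℕ} (hx : x ∈ A) (hz : z ∉ A) {l : List ℕ}
    (hl : good A l) {s : List ℕ} (hs : s = [z, x] ∨ s = [x, z]) {a b : ℕ}
    (hab : ¬ (a = x ∧ b = z) ∧ ¬ (a = z ∧ b = x)) :
    sg (sub x s l) a b = sg l (rho x z a) (rho x z b) := by
  unfold sg
  have h1 := mem_ord_sub hx hz hl hs hab
  have h2 := mem_ord_sub (a := b) (b := a) hx hz hl hs ⟨by tauto, by tauto⟩
  simp only [h1, h2]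

theorem sg_neg (l a b) : sg l a b = - sg l b a := by unfold sg; ring

theorem sg_adj {W V : List ℕ} {z x : ℕ} (h : (W ++ z :: x :: V).Nodup) :
    sg (W ++ z :: x :: V) z x = 1 := by
  have k : ∀ (U : List ℕ) (a b : ℕ), (a, b) ∈ ord U → a ∈ U ∧ b ∈ U := fun U a b => mem_of_mem_ord
  rw [List.nodup_append, List.nodup_cons, List.nodup_cons] at h
  have k1 := k W x z
  have k2 := k V x z
  unfold sg
  rw [if_pos, if_neg]
  · ring
  · simp only [mem_ord_append, mem_ord_cons, List.mem_cons] at *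
    grind
  · simp only [mem_ord_append, mem_ord_cons, List.mem_cons] at *
    grind

theorem sg_up {A : Finset ℕ} {x z : ℕ} (hx : x ∈ A) (hz : z ∉ A) {l : List ℕ}
    (hl : good A l) : sg (sub x [z, x] l) z x = 1 := by
  have hxz : x ≠ z := by rintro rfl; exact hz hx
  have := sub_good (inter_pair hx hz) hl (good_pair' hxz)
  obtain ⟨W, V, rfl, hW, hV⟩ := good_split hl hx
  rw [sub_eq hW hV, List.append_assoc] at this ⊢
  exact sg_adj this.1

theorem sg_dn {A : Finset ℕ} {x z : ℕ} (hx : x ∈ A) (hz : z ∉ A) {l : List ℕ}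
    (hl : good A l) : sg (sub x [x, z] l) x z = 1 := by
  have hxz : x ≠ z := by rintro rfl; exact hz hx
  have := sub_good (inter_pair hx hz) hl (good_pair hxz)
  obtain ⟨W, V, rfl, hW, hV⟩ := good_split hl hx
  rw [sub_eq hW hV, List.append_assoc] at this ⊢
  exact sg_adj this.1

theorem ev_ins {E : Type} [AddCommGroup E] [Module ℚ E] (g : List ℕ → E) (x z μ1 μ2) :
    ev g (ins x z μ1 μ2) = ev (fun l => g (sub x [z, x] l)) μ1 +
      ev (fun l => g (sub x [x, z] l)) μ2 := by
  rw [ins, map_add, ev_map, ev_map]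

theorem mar_ins {A : Finset ℕ} {x z : ℕ} (hx : x ∈ A) (hz : z ∉ A) {μ1 μ2} (h1 : OK A μ1)
    (h2 : OK A μ2) {a b : ℕ} (hab : ¬ (a = x ∧ b = z) ∧ ¬ (a = z ∧ b = x)) :
    ev (fun l => sg l a b) (ins x z μ1 μ2) =
      ev (fun l => sg l (rho x z a) (rho x z b)) (μ1 + μ2) := by
  rw [ev_ins, map_add]
  congr 1
  · exact ev_congr (fun l hl => sg_sub hx hz (h1.1 l hl) (Or.inl rfl) hab)
  · exact ev_congr (fun l hl => sg_sub hx hz (h2.1 l hl) (Or.inr rfl) hab)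

theorem mar_ins_zx {A : Finset ℕ} {x z : ℕ} (hx : x ∈ A) (hz : z ∉ A) {μ1 μ2} (h1 : OK A μ1)
    (h2 : OK A μ2) : ev (fun l => sg l z x) (ins x z μ1 μ2) = mass μ1 - mass μ2 := by
  rw [ev_ins, sub_eq_add_neg]
  congr 1
  · exact ev_congr (fun l hl => sg_up hx hz (h1.1 l hl))
  · rw [mass, ← LinearMap.neg_apply]
    have : -ev (fun _ => (1 : ℚ)) = ev (fun _ => (-1 : ℚ)) := by
      ext l; simp [ev]
    rw [this]
    exact ev_congr (fun l hl => by rw [sg_neg, sg_dn hx hz (h2.1 l hl)])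

theorem mar_neg (a b : ℕ) (μ) : ev (fun l => sg l a b) μ = - ev (fun l => sg l b a) μ := by
  rw [ev_eq_sum, ev_eq_sum, ← Finset.sum_neg_distrib]
  exact Finset.sum_congr rfl (fun l _ => by rw [sg_neg]; simp)

theorem ins_add (x z μ1 μ2 ν1 ν2) :
    ins x z μ1 μ2 + ins x z ν1 ν2 = ins x z (μ1 + ν1) (μ2 + ν2) := by
  unfold ins; rw [Finsupp.mapDomain_add, Finsupp.mapDomain_add]; abel

theorem ins_smul (x z) (c : ℚ) (μ1 μ2) : c • ins x z μ1 μ2 = ins x z (c • μ1) (c • μ2) := by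
  unfold ins; rw [Finsupp.mapDomain_smul, Finsupp.mapDomain_smul, smul_add]

def Full (f : PSCF) (T A : Finset ℕ) (μ : List ℕ →₀ ℚ) : Prop :=
  ∀ p, IsLottery A p → (∀ a, 0 < p a ↔ a ∈ T) → S f A p μ

structure Adh (f : PSCF) (T A : Finset ℕ) (μ : List ℕ →₀ ℚ) : Prop where
  sub : T ⊆ A
  ok : OK A μ
  pos : 0 < mass μ
  mar : ∀ a ∈ T, ∀ b ∈ T, ev (fun l => sg l a b) μ = 0
  per : ∀ T', T' ⊆ T → T'.Nonempty → ∃ ν, OK A ν ∧ 0 < mass ν ∧ ∀ ε : ℚ, 0 < ε →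
    Full f T' A (μ + ε • ν)

theorem Adh.add {f : PSCF} [Nice f] {T A μ μ'} (h : Adh f T A μ) (h' : Adh f T A μ') :
    Adh f T A (μ + μ') := by
  refine ⟨h.sub, h.ok.add h'.ok, by rw [map_add]; exact add_pos h.pos h'.pos, fun a ha b hb => by
    rw [map_add, h.mar a ha b hb, h'.mar a ha b hb, add_zero], fun T' hT' hne => ?_⟩
  obtain ⟨ν, h1, h2, h3⟩ := h.per T' hT' hne
  obtain ⟨ν', h1', h2', h3'⟩ := h'.per T' hT' hne
  refine ⟨ν + ν', h1.add h1', by rw [map_add]; exact add_pos h2 h2', fun ε hε p hp hpT => ?_⟩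
  have := (h3 ε hε p hp hpT).add (h3' ε hε p hp hpT)
  convert this using 1
  rw [smul_add]; abel

theorem Adh.smul {f : PSCF} {T A μ} (h : Adh f T A μ) {c : ℚ} (hc : 0 < c) :
    Adh f T A (c • μ) := by
  refine ⟨h.sub, h.ok.smul hc.le, by rw [map_smul]; exact mul_pos hc h.pos, fun a ha b hb => by
    rw [map_smul, h.mar a ha b hb, smul_zero], fun T' hT' hne => ?_⟩
  obtain ⟨ν, h1, h2, h3⟩ := h.per T' hT' hne
  refine ⟨c • ν, h1.smul hc.le, by rw [map_smul]; exact mul_pos hc h2, fun ε hε p hp hpT => ?_⟩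
  have := (h3 ε hε p hp hpT).smul hc
  convert this using 1
  rw [smul_add, smul_comm]

theorem lot_mono {A : Finset ℕ} {z : ℕ} (hz : z ∉ A) {p} (h : IsLottery (insert z A) p)
    (hpz : p z = 0) : IsLottery A p := by
  refine ⟨fun a ha => ?_, h.2.1, ?_⟩
  · by_cases e : a = z
    · rw [e, hpz]
    · exact h.1 a (by simp [e, ha])
  · have := h.2.2
    rw [Finset.sum_insert hz, hpz, zero_add] at this
    exact this

theorem adh_base (f : PSCF) (x : ℕ) : Adh f {x} {x} (Finsupp.single [x] 1) := by
  have hg : good {x} [x] := ⟨by simp, by simp⟩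
  have ok : OK {x} (Finsupp.single [x] (1 : ℚ)) := OK.single hg zero_le_one
  refine ⟨subset_rfl, ok, by rw [mass_single]; exact one_pos, fun a ha b hb => ?_, fun T' _ _ =>
    ⟨Finsupp.single [x] 1, ok, by rw [mass_single]; exact one_pos, fun ε hε p hp _ => ?_⟩⟩
  · rw [mem_singleton] at ha hb
    rw [ha, hb, ev_single]; simp [sg]
  · have hm : 0 < mass (Finsupp.single [x] (1 : ℚ) + ε • Finsupp.single [x] 1) := by
      rw [map_add, map_smul, mass_single]; simp; linarith
    obtain ⟨p', hp'⟩ := S_exists f (by simp) (ok.add (ok.smul hε.le)) hm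
    have : p = p' := by
      have h1 := hp.2.2
      have h2 := hp'.lot.2.2
      rw [Finset.sum_singleton] at h1 h2
      ext a
      by_cases ha : a = x
      · rw [ha, h1, h2]
      · rw [hp.1 a (by simpa using ha), hp'.lot.1 a (by simpa using ha)]
    rw [this]; exact hp'

theorem dn_per {f : PSCF} [Nice f] {T' A : Finset ℕ} {x z : ℕ} (hx : x ∈ A) (hz : z ∉ A)
    (hzT : z ∉ T') {μ1 μ2} (h1 : OK A μ1) (h2 : OK A μ2) (hm : mass μ1 ≤ mass μ2) {ν0}
    (h3 : OK A ν0) (h4 : 0 < mass ν0) (h5 : ∀ ε : ℚ, 0 < ε → Full f T' A (μ1 + μ2 + ε • ν0)) :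
    ∃ ν, OK (insert z A) ν ∧ 0 < mass ν ∧ ∀ ε : ℚ, 0 < ε →
    Full f T' (insert z A) (ins x z μ1 μ2 + ε • ν) := by
  refine ⟨ins x z 0 ν0, OK_ins hx hz OK.zero h3, by rw [mass_ins]; simpa using h4,
    fun ε hε p hp hpT => ?_⟩
  have hpz : p z = 0 := by
    have := mt (hpT z).1 hzT
    exact le_antisymm (not_lt.1 this) (hp.2.1 z)
  have := h5 ε hε p (lot_mono hz hp hpz) hpT
  rw [ins_smul, ins_add]
  refine ins_lt hx hz (by simpa using h1) (h2.add (h3.smul hε.le)) ?_ ?_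
  · rw [smul_zero, add_zero, map_add, map_smul, smul_eq_mul]
    have := mul_pos hε h4; linarith
  · rw [smul_zero, add_zero, ← add_assoc]; exact this

theorem adh_b {f : PSCF} [Nice f] {T A : Finset ℕ} {x z : ℕ} (hx : x ∈ A) (hz : z ∉ A)
    {μ1 μ2} (h1 : OK A μ1) (h2 : OK A μ2) (hm : mass μ1 ≤ mass μ2) (h : Adh f T A (μ1 + μ2)) :
    Adh f T (insert z A) (ins x z μ1 μ2) := by
  have hzT : z ∉ T := fun e => hz (h.sub e)
  refine ⟨h.sub.trans (subset_insert _ _), OK_ins hx hz h1 h2, by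
    rw [mass_ins, ← map_add]; exact h.pos, fun a ha b hb => ?_, fun T' hT' hne => ?_⟩
  · have ea : a ≠ z := by rintro rfl; exact hzT ha
    have eb : b ≠ z := by rintro rfl; exact hzT hb
    rw [mar_ins hx hz h1 h2 ⟨by tauto, by tauto⟩, rho, rho, if_neg ea, if_neg eb]
    exact h.mar a ha b hb
  · obtain ⟨ν0, h3, h4, h5⟩ := h.per T' hT' hne
    exact dn_per hx hz (fun e => hzT (hT' e)) h1 h2 hm h3 h4 h5

theorem sum_update2 {A : Finset ℕ} {x z : ℕ} (hx : x ∈ A) (hz : z ∉ A) {p p0 : ℕ → ℚ}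
    (hne : ∀ a, a ≠ x → a ≠ z → p0 a = p a) (hxx : p0 x = p x + p z) :
    ∑ a ∈ A, p0 a = ∑ a ∈ insert z A, p a := by
  have hxz : x ≠ z := by rintro rfl; exact hz hx
  rw [Finset.sum_insert hz, ← Finset.add_sum_erase A _ hx, ← Finset.add_sum_erase A p hx, hxx]
  have : ∑ a ∈ A.erase x, p0 a = ∑ a ∈ A.erase x, p a :=
    Finset.sum_congr rfl (fun a ha => hne a (ne_of_mem_erase ha) (by
      rintro rfl; exact hz (mem_of_mem_erase ha)))
  rw [this]; ring

theorem adh_a {f : PSCF} [Nice f] {T A : Finset ℕ} {x z : ℕ} (hxT : x ∈ T) (hz : z ∉ A)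
    {μ1 μ2} (h1 : OK A μ1) (h2 : OK A μ2) (hm : mass μ1 = mass μ2) (h : Adh f T A (μ1 + μ2)) :
    Adh f (insert z T) (insert z A) (ins x z μ1 μ2) := by
  have hzT : z ∉ T := fun e => hz (h.sub e)
  have hx := h.sub hxT
  have hxz : x ≠ z := by rintro rfl; exact hz hx
  refine ⟨insert_subset_insert _ h.sub, OK_ins hx hz h1 h2, by
    rw [mass_ins, ← map_add]; exact h.pos, fun a ha b hb => ?_, fun T' hT' hne => ?_⟩
  · have hr : ∀ c ∈ insert z T, rho x z c ∈ T := by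
      intro c hc; unfold rho; split_ifs with e
      · exact hxT
      · exact mem_of_mem_insert_of_ne hc e
    by_cases e1 : a = x ∧ b = z
    · rw [e1.1, e1.2, mar_neg, mar_ins_zx hx hz h1 h2, hm, sub_self, neg_zero]
    by_cases e2 : a = z ∧ b = x
    · rw [e2.1, e2.2, mar_ins_zx hx hz h1 h2, hm, sub_self]
    rw [mar_ins hx hz h1 h2 ⟨e1, e2⟩]
    exact h.mar _ (hr a ha) _ (hr b hb)
  · by_cases hz' : z ∈ T'
    swap
    · obtain ⟨ν0, h3, h4, h5⟩ := h.per T' (fun a ha => mem_of_mem_insert_of_ne (hT' ha) (by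
        rintro rfl; exact hz' ha)) hne
      exact dn_per hx hz hz' h1 h2 hm.le h3 h4 h5
    have hsub : T'.erase z ⊆ T := fun a ha =>
      mem_of_mem_insert_of_ne (hT' (mem_of_mem_erase ha)) (ne_of_mem_erase ha)
    by_cases hx' : x ∈ T'
    · obtain ⟨ν0, h3, h4, h5⟩ := h.per (T'.erase z) hsub ⟨x, mem_erase.2 ⟨hxz, hx'⟩⟩
      have h3' := h3.smul (c := 1 / 2) (by norm_num)
      refine ⟨ins x z ((1 / 2 : ℚ) • ν0) ((1 / 2 : ℚ) • ν0), OK_ins hx hz h3' h3', ?_,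
        fun ε hε p hp hpT => ?_⟩
      · rw [mass_ins, map_smul, smul_eq_mul]; linarith
      · set p0 : ℕ → ℚ := fun a => if a = x then p x + p z else if a = z then 0 else p a with hp0
        have hpx0 := hp.2.1 x
        have hpz0 := hp.2.1 z
        have e0 : p0 x = p x + p z := by simp [hp0]
        have ez : p0 z = 0 := by simp [hp0, hxz.symm]
        have ea : ∀ a, a ≠ x → a ≠ z → p0 a = p a := by
          intro a h1 h2; simp [hp0, h1, h2]
        have hS := h5 ε hε p0 ⟨fun a ha => by
            by_cases e : a = z
            · rw [e, ez]
            · rw [ea a (by rintro rfl; exact ha hx) e]; exact hp.1 a (by simp [e, ha]),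
          fun a => by simp only [hp0]; split_ifs <;> first | positivity | exact hp.2.1 a,
          by rw [sum_update2 hx hz ea e0]; exact hp.2.2⟩ (by
            intro a
            by_cases e1 : a = x
            · have := (hpT x).2 hx'
              rw [e1, e0]; simp [hxz, hx']; linarith
            by_cases e2 : a = z
            · rw [e2, ez]; simp
            rw [ea a e1 e2, hpT]; simp [e2])
        rw [ins_smul, ins_add]
        refine ins_eq (p := p0) hx hz (h1.add (h3'.smul hε.le)) (h2.add (h3'.smul hε.le)) ?_ ?_
          (fun a h1 h2 => (ea a h1 h2).symm) e0.symm ((hpT x).2 hx') ((hpT z).2 hz')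
        · rw [map_add, map_add, hm]
        · convert hS using 1
          module
    · obtain ⟨ν0, h3, h4, h5⟩ := h.per (insert x (T'.erase z)) (insert_subset hxT hsub) (by simp)
      refine ⟨ins x z ν0 0, OK_ins hx hz h3 OK.zero, by rw [mass_ins]; simpa using h4,
        fun ε hε p hp hpT => ?_⟩
      have hpx : p x = 0 := le_antisymm (not_lt.1 (mt (hpT x).1 hx')) (hp.2.1 x)
      have hS := h5 ε hε (p ∘ Equiv.swap x z) ⟨fun a ha => by
          rw [Function.comp_apply]
          by_cases e : a = z
          · rw [e, Equiv.swap_apply_right, hpx]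
          · have e2 : a ≠ x := by rintro rfl; exact ha hx
            rw [Equiv.swap_apply_of_ne_of_ne e2 e]
            exact hp.1 a (by simp [e, ha]), fun a => hp.2.1 _, by
          rw [sum_update2 (p := p) hx hz]
          · exact hp.2.2
          · intro a h1 h2; rw [Function.comp_apply, Equiv.swap_apply_of_ne_of_ne h1 h2]
          · simp [hpx]⟩ (by
            intro a
            rw [Function.comp_apply, hpT]
            simp only [Equiv.swap_apply_def, mem_insert, mem_erase]
            split_ifs <;> simp_all)
      rw [ins_smul, ins_add]
      have := ins_gt hx hz (h1.add (h3.smul hε.le)) h2 (by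
        rw [map_add, map_smul, hm, smul_eq_mul]
        have := mul_pos hε h4; linarith) (p := p ∘ Equiv.swap x z) (by
        convert hS using 1; abel)
      convert this using 1
      · ext a; simp
      · rw [smul_zero, add_zero]

theorem map_ge {A : Finset ℕ} {μ : List ℕ →₀ ℚ} (h : OK A μ) (g : List ℕ → List ℕ) (l : List ℕ) :
    μ l ≤ μ.mapDomain g (g l) := by
  classical
  have hsplit : μ = Finsupp.single l (μ l) + μ.erase l := (Finsupp.single_add_erase l μ).symm
  have hok : OK A (μ.erase l) := by
    refine ⟨fun m hm => h.1 m (by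
      rw [Finsupp.support_erase] at hm; exact mem_of_mem_erase hm), fun m => ?_⟩
    rw [Finsupp.erase_apply]; split_ifs
    · exact le_rfl
    · exact h.2 m
  conv_rhs => rw [hsplit]
  rw [Finsupp.mapDomain_add, Finsupp.mapDomain_single, Finsupp.add_apply, Finsupp.single_eq_same]
  have hnn : 0 ≤ (μ.erase l).mapDomain g (g l) := by
    rw [Finsupp.mapDomain, Finsupp.sum, Finsupp.finsetSum_apply]
    refine Finset.sum_nonneg (fun l _ => ?_)
    rw [Finsupp.single_apply]; split_ifs <;> simp [hok.2]
  linarith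

theorem good_erase_cons {A : Finset ℕ} {z : ℕ} {l : List ℕ} (h : good A (z :: l)) :
    good (A.erase z) l := by
  refine ⟨(List.nodup_cons.1 h.1).2, fun a => ?_⟩
  have h1 := (List.nodup_cons.1 h.1).1
  have := h.2 a
  rw [List.mem_cons] at this
  rw [mem_erase]
  grind

theorem supp {f : PSCF} [Nice f] : ∀ (n : ℕ) (m : List ℕ) (_ : m.length = n) (A T : Finset ℕ)
    (_ : T ⊆ A) (_ : T.Nonempty) (_ : good A m), ∃ μ, Adh f T A μ ∧ 0 < μ m := by
  intro n
  induction n with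
  | zero =>
    intro m hm A T hT hne hg
    obtain ⟨a, ha⟩ := hne
    rw [List.length_eq_zero_iff] at hm
    have := (hg.2 a).2 (hT ha)
    simp [hm] at this
  | succ n ih =>
    intro m hm A T hT hne hg
    match m, hm, hg with
    | [x], hm, hg =>
      have hA : A = {x} := by ext a; rw [← hg.2]; simp
      have hTx : T = {x} := by
        rw [hA] at hT
        exact (subset_singleton_iff.1 hT).resolve_left hne.ne_empty
      refine ⟨Finsupp.single [x] 1, ?_, by simp⟩
      rw [hTx, hA]; exact adh_base f x
    | z :: x :: rest, hm, hg =>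
      have hzA : z ∈ A := (hg.2 z).1 (by simp)
      have hxA : x ∈ A := (hg.2 x).1 (by simp)
      have hnd := hg.1
      simp only [List.nodup_cons, List.mem_cons, not_or] at hnd
      have hins : insert z (A.erase z) = A := insert_erase hzA
      have hl1 : (x :: rest).length = n := by simpa using hm
      have hup : sub x [z, x] (x :: rest) = z :: x :: rest := by
        have := sub_eq (s := [z, x]) (W := []) (V := rest) (x := x) (by simp) hnd.2.1
        simpa using this
      have hx' : x ∈ A.erase z := mem_erase.2 ⟨fun e => hnd.1.1 e.symm, hxA⟩
      by_cases hzT : z ∈ T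
      · by_cases hxT : x ∈ T
        · have hxT' : x ∈ T.erase z := mem_erase.2 ⟨fun e => hnd.1.1 e.symm, hxT⟩
          obtain ⟨μ, hμ, hp⟩ := ih (x :: rest) hl1 (A.erase z) (T.erase z)
            (erase_subset_erase z hT) ⟨x, hxT'⟩ (good_erase_cons hg)
          have hok := hμ.ok.smul (c := 1 / 2) (by norm_num)
          have := adh_a hxT' (notMem_erase z A) hok hok rfl (by
            convert hμ using 1; module)
          rw [hins, insert_erase hzT] at this
          refine ⟨_, this, ?_⟩
          rw [ins, Finsupp.add_apply]
          have g1 := map_ge hok (sub x [z, x]) (x :: rest)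
          rw [hup, Finsupp.smul_apply, smul_eq_mul] at g1
          have g2 := this.ok
          have hok2 : OK A (((1 / 2 : ℚ) • μ).mapDomain (sub x [x, z])) := by
            have := OK_ins hx' (notMem_erase z A) OK.zero hok
            rw [hins] at this
            simpa [ins] using this
          have := hok2.2 (z :: x :: rest)
          linarith
        · have hT' : T ⊆ A.erase x := fun a ha => mem_erase.2 ⟨by rintro rfl; exact hxT ha, hT ha⟩
          have hg' : good (A.erase x) (z :: rest) := by
            apply good_erase_cons
            refine ⟨?_, fun a => ?_⟩
            · simp only [List.nodup_cons, List.mem_cons, not_or]; grind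
            · have := hg.2 a
              simp only [List.mem_cons] at this ⊢
              grind
          obtain ⟨μ, hμ, hp⟩ := ih (z :: rest) (by simpa using hm) (A.erase x) T hT' hne hg'
          have := adh_b (x := z) (z := x) (hT' hzT) (notMem_erase x A) OK.zero hμ.ok (by
            rw [map_zero]; exact hμ.pos.le) (by rw [zero_add]; exact hμ)
          rw [insert_erase hxA] at this
          refine ⟨_, this, ?_⟩
          have hdn : sub z [z, x] (z :: rest) = z :: x :: rest := by
            have := sub_eq (s := [z, x]) (W := []) (V := rest) (x := z) (by simp) hnd.1.2
            simpa using this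
          have g1 := map_ge hμ.ok (sub z [z, x]) (z :: rest)
          rw [hdn] at g1
          simp only [ins, Finsupp.mapDomain_zero, zero_add]
          linarith
      · have hT' : T ⊆ A.erase z := fun a ha => mem_erase.2 ⟨by rintro rfl; exact hzT ha, hT ha⟩
        obtain ⟨μ, hμ, hp⟩ := ih (x :: rest) hl1 (A.erase z) T hT' hne (good_erase_cons hg)
        have hok := hμ.ok.smul (c := 1 / 2) (by norm_num)
        have := adh_b hx' (notMem_erase z A) hok hok le_rfl (by
            convert hμ using 1; module)
        rw [hins] at this
        refine ⟨_, this, ?_⟩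
        rw [ins, Finsupp.add_apply]
        have g1 := map_ge hok (sub x [z, x]) (x :: rest)
        rw [hup, Finsupp.smul_apply, smul_eq_mul] at g1
        have hok2 : OK A (((1 / 2 : ℚ) • μ).mapDomain (sub x [x, z])) := by
          have := OK_ins hx' (notMem_erase z A) OK.zero hok
          rw [hins] at this
          simpa [ins] using this
        have := hok2.2 (z :: x :: rest)
        linarith

theorem OK_pert {A : Finset ℕ} {β : List ℕ →₀ ℚ} (h : OK A β) {m m'} (hm : good A m)
    {η : ℚ} (hη : 0 ≤ η) (hle : η ≤ β m') :
    OK A (β + Finsupp.single m η - Finsupp.single m' η) := by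
  classical
  have hgood : ∀ l, β l ≠ 0 → good A l := fun l hl => h.1 l (Finsupp.mem_support_iff.2 hl)
  refine ⟨fun l hl => ?_, fun l => ?_⟩
  · rw [Finsupp.mem_support_iff, Finsupp.sub_apply, Finsupp.add_apply, Finsupp.single_apply,
      Finsupp.single_apply] at hl
    by_cases e1 : m = l
    · rw [← e1]; exact hm
    · rw [if_neg e1] at hl
      apply hgood
      intro e0
      split_ifs at hl with e2
      · rw [e2] at hle; apply hl; linarith
      · apply hl; linarith
  · rw [Finsupp.sub_apply, Finsupp.add_apply, Finsupp.single_apply, Finsupp.single_apply]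
    have := h.2 l
    split_ifs with e1 e2 e2
    · linarith
    · linarith
    · rw [e2] at hle; linarith
    · linarith

theorem ev_sub_single (φ : List ℕ → ℝ) (l : List ℕ) (c : ℚ) :
    ev φ (Finsupp.single l c) = (c : ℝ) * φ l := by
  rw [ev_single, Rat.smul_def]

theorem swap_const {f : PSCF} [Nice f] {T A : Finset ℕ} (hTA : T ⊆ A) {φ : List ℕ → ℝ}
    (hφ : ∀ μ, Adh f T A μ → ev φ μ = 0) {x z : ℕ} (hx : x ∈ T) (hz : z ∈ T) (hxz : x ≠ z)
    {m m'} (hm : good (A.erase z) m) (hm' : good (A.erase z) m') :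
    φ (sub x [z, x] m) - φ (sub x [x, z] m) = φ (sub x [z, x] m') - φ (sub x [x, z] m') := by
  have hxT : x ∈ T.erase z := mem_erase.2 ⟨hxz, hx⟩
  have hsub := erase_subset_erase z hTA
  obtain ⟨μ, hμ, hp⟩ := supp (f := f) _ m rfl (A.erase z) (T.erase z) hsub ⟨x, hxT⟩ hm
  obtain ⟨μ', hμ', hp'⟩ := supp (f := f) _ m' rfl (A.erase z) (T.erase z) hsub ⟨x, hxT⟩ hm'
  have hβ := (hμ.add hμ').smul (c := 1 / 2) (by norm_num)
  set β := (1 / 2 : ℚ) • (μ + μ') with hβdef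
  have hbm : 0 < β m := by
    rw [hβdef, Finsupp.smul_apply, Finsupp.add_apply, smul_eq_mul]
    have := hμ'.ok.2 m; linarith
  have hbm' : 0 < β m' := by
    rw [hβdef, Finsupp.smul_apply, Finsupp.add_apply, smul_eq_mul]
    have := hμ.ok.2 m'; linarith
  set η := min (β m) (β m') with hη
  have hη0 : 0 < η := lt_min hbm hbm'
  have o1 := OK_pert hβ.ok (m' := m') hm hη0.le (min_le_right _ _)
  have o2 := OK_pert hβ.ok (m' := m) hm' hη0.le (min_le_left _ _)
  have a1 := adh_a hxT (notMem_erase z A) hβ.ok hβ.ok rfl (hβ.add hβ)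
  have a2 := adh_a hxT (notMem_erase z A) o1 o2 (by simp [map_sub, map_add, mass_single]) (by
    convert hβ.add hβ using 1; abel)
  rw [insert_erase hz, insert_erase (hTA hz)] at a1 a2
  have b1 := hφ _ a1
  have b2 := hφ _ a2
  rw [ev_ins] at b1 b2
  simp only [map_add, map_sub, ev_sub_single] at b2
  have hη' : (0 : ℝ) < (η : ℝ) := by exact_mod_cast hη0
  have key : (η : ℝ) * ((φ (sub x [z, x] m) - φ (sub x [x, z] m)) -
      (φ (sub x [z, x] m') - φ (sub x [x, z] m'))) = 0 := by linarith
  rcases mul_eq_zero.1 key with h | h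
  · linarith
  · linarith

theorem swap_zero {f : PSCF} [Nice f] {T A : Finset ℕ} (hTA : T ⊆ A) (hne : T.Nonempty)
    {φ : List ℕ → ℝ} (hφ : ∀ μ, Adh f T A μ → ev φ μ = 0) {x z : ℕ} (hx : x ∈ A) (hz : z ∈ A)
    (hzT : z ∉ T) (hxz : x ≠ z) {m} (hm : good (A.erase z) m) :
    φ (sub x [z, x] m) = φ (sub x [x, z] m) := by
  have hsub : T ⊆ A.erase z := fun a ha => mem_erase.2 ⟨by rintro rfl; exact hzT ha, hTA ha⟩
  have hx' : x ∈ A.erase z := mem_erase.2 ⟨hxz, hx⟩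
  obtain ⟨μ, hβ, hbm⟩ := supp (f := f) _ m rfl (A.erase z) T hsub hne hm
  have o1 : OK (A.erase z) (Finsupp.single m (μ m)) := OK.single hm hbm.le
  have o2 : OK (A.erase z) (μ + μ - Finsupp.single m (μ m)) := by
    have := OK_pert (hβ.ok.add hβ.ok) (m := m) (m' := m) hm (η := μ m) hbm.le (by
      rw [Finsupp.add_apply]; linarith)
    have h2 := OK_pert hβ.ok (m := m) (m' := m) hm (η := μ m) hbm.le le_rfl
    have h3 : OK (A.erase z) (μ - Finsupp.single m (μ m)) := by
      classical
      refine ⟨fun l hl => ?_, fun l => ?_⟩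
      · rw [Finsupp.mem_support_iff, Finsupp.sub_apply, Finsupp.single_apply] at hl
        by_cases e : m = l
        · rw [← e]; exact hm
        · rw [if_neg e, sub_zero] at hl; exact hβ.ok.1 l (Finsupp.mem_support_iff.2 hl)
      · rw [Finsupp.sub_apply, Finsupp.single_apply]
        split_ifs with e
        · rw [e]; simp
        · simpa using hβ.ok.2 l
    rw [add_sub_assoc]; exact hβ.ok.add h3
  have hle : μ m ≤ mass μ := by
    have := map_ge hβ.ok (fun _ => []) m
    rw [map_const, Finsupp.single_eq_same] at this
    exact this
  have a1 := adh_b hx' (notMem_erase z A) OK.zero (hβ.ok.add hβ.ok) (by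
    rw [map_zero]; exact (hβ.add hβ).pos.le) (by rw [zero_add]; exact hβ.add hβ)
  have a2 := adh_b hx' (notMem_erase z A) o1 o2 (by
    rw [map_sub, map_add, mass_single]; linarith) (by
    convert hβ.add hβ using 1; abel)
  rw [insert_erase hz] at a1 a2
  have b1 := hφ _ a1
  have b2 := hφ _ a2
  rw [ev_ins] at b1 b2
  simp only [map_add, map_sub, map_zero, ev_sub_single] at b1 b2
  have hη' : (0 : ℝ) < ((μ m : ℚ) : ℝ) := by exact_mod_cast hbm
  have key : ((μ m : ℚ) : ℝ) * (φ (sub x [z, x] m) - φ (sub x [x, z] m)) = 0 := by linarith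
  rcases mul_eq_zero.1 key with h | h
  · linarith
  · linarith

theorem adj_form {A : Finset ℕ} {W V : List ℕ} {z x : ℕ} (h : good A (W ++ z :: x :: V)) :
    x ≠ z ∧ z ∈ A ∧ x ∈ A ∧ good (A.erase z) (W ++ x :: V) ∧
      sub x [z, x] (W ++ x :: V) = W ++ z :: x :: V ∧
      sub x [x, z] (W ++ x :: V) = W ++ x :: z :: V := by
  have hn := h.1
  have h2 := h.2
  rw [List.nodup_append, List.nodup_cons, List.nodup_cons] at hn
  simp only [List.mem_append, List.mem_cons] at hn h2
  have hxW : x ∉ W := by grind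
  have hxV : x ∉ V := by grind
  refine ⟨by grind, by grind, by grind, ⟨?_, fun a => ?_⟩, ?_, ?_⟩
  · rw [List.nodup_append, List.nodup_cons]; simp only [List.mem_cons]; grind
  · have := h2 a
    simp only [List.mem_append, List.mem_cons, mem_erase]; grind
  · rw [sub_eq hxW hxV]; simp
  · rw [sub_eq hxW hxV]; simp

theorem good_swap {A : Finset ℕ} {W V : List ℕ} {z x : ℕ} (h : good A (W ++ z :: x :: V)) :
    good A (W ++ x :: z :: V) := by
  have hp : (W ++ z :: x :: V).Perm (W ++ x :: z :: V) := (List.Perm.swap x z V).append_left W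
  exact ⟨hp.nodup_iff.1 h.1, fun a => by rw [← hp.mem_iff]; exact h.2 a⟩

structure Sw (T A : Finset ℕ) (φ : List ℕ → ℝ) (c : ℕ → ℕ → ℝ) : Prop where
  anti : ∀ a b, c a b = - c b a
  off : ∀ a b, a ∉ T ∨ b ∉ T → c a b = 0
  adj : ∀ W V z x, good A (W ++ z :: x :: V) →
    φ (W ++ z :: x :: V) - φ (W ++ x :: z :: V) = c z x
  rep : ∀ μ, OK A μ → ev φ μ = 1 / 4 * ∑ a ∈ A, ∑ b ∈ A, c a b * ((ev (fun l => sg l a b) μ : ℚ) : ℝ)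

theorem sg_swap {A : Finset ℕ} {W V : List ℕ} {z x : ℕ} (h : good A (W ++ z :: x :: V)) (a b : ℕ) :
    sg (W ++ z :: x :: V) a b - sg (W ++ x :: z :: V) a b =
      2 * ((if a = z ∧ b = x then 1 else 0) - (if a = x ∧ b = z then 1 else 0)) := by
  obtain ⟨hxz, hz, hx, hg, e1, e2⟩ := adj_form h
  have hgs := good_swap h
  by_cases c1 : a = z ∧ b = x
  · rw [c1.1, c1.2, sg_adj h.1, sg_neg, sg_adj hgs.1]
    rw [if_pos ⟨rfl, rfl⟩, if_neg (by rintro ⟨h, _⟩; exact hxz h.symm)]; norm_num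
  by_cases c2 : a = x ∧ b = z
  · rw [c2.1, c2.2, sg_adj hgs.1, sg_neg, sg_adj h.1]
    rw [if_neg (by rintro ⟨h, _⟩; exact hxz h), if_pos ⟨rfl, rfl⟩]; norm_num
  rw [if_neg c1, if_neg c2, ← e1, ← e2, sg_sub (mem_erase.2 ⟨hxz, hx⟩) (notMem_erase z A) hg
    (Or.inl rfl) ⟨c2, c1⟩, sg_sub (mem_erase.2 ⟨hxz, hx⟩) (notMem_erase z A) hg
    (Or.inr rfl) ⟨c2, c1⟩]
  ring

theorem good_exists (A : Finset ℕ) : good A A.toList := ⟨A.nodup_toList, by simp⟩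

theorem sw_aux {x z : ℕ} (hxz : x ≠ z) (c : ℕ → ℕ → ℝ) (a b : ℕ) :
    c a b * (2 * (((if a = z ∧ b = x then 1 else 0 : ℚ) : ℝ) -
      ((if a = x ∧ b = z then 1 else 0 : ℚ) : ℝ))) =
      (if b = x then (if a = z then 2 * c z x else 0) else 0) -
        (if b = z then (if a = x then 2 * c x z else 0) else 0) := by
  by_cases h1 : b = x
  · by_cases h2 : a = z
    · subst h1 h2; simp [hxz]; ring
    · subst h1; simp [hxz, h2]
  · by_cases h3 : b = z
    · by_cases h2 : a = x
      · subst h3 h2; simp [Ne.symm hxz]; ring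
      · subst h3; simp [h1, h2]
    · simp [h1, h3]

theorem exists_sw {f : PSCF} [Nice f] {T A : Finset ℕ} (hTA : T ⊆ A) (hne : T.Nonempty)
    {φ : List ℕ → ℝ} (hφ : ∀ μ, Adh f T A μ → ev φ μ = 0) : ∃ c, Sw T A φ c := by
  classical
  have hind : ∀ z x W V W' V', good A (W ++ z :: x :: V) → good A (W' ++ z :: x :: V') →
      φ (W ++ z :: x :: V) - φ (W ++ x :: z :: V) =
      φ (W' ++ z :: x :: V') - φ (W' ++ x :: z :: V') ∧
      (z ∉ T ∨ x ∉ T → φ (W ++ z :: x :: V) - φ (W ++ x :: z :: V) = 0) := by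
    intro z x W V W' V' h h'
    have h0 : ∀ W V, good A (W ++ z :: x :: V) → z ∉ T ∨ x ∉ T →
        φ (W ++ z :: x :: V) - φ (W ++ x :: z :: V) = 0 := by
      intro W V h hzx
      obtain ⟨hxz, hz, hx, hg, e1, e2⟩ := adj_form h
      rcases hzx with hzT | hxT
      · rw [← e1, ← e2, swap_zero hTA hne hφ hx hz hzT hxz hg, sub_self]
      · obtain ⟨hxz, hz, hx, hg, e1, e2⟩ := adj_form (good_swap h)
        rw [← e1, ← e2, swap_zero hTA hne hφ hx hz hxT hxz hg, sub_self]
    refine ⟨?_, h0 W V h⟩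
    by_cases hT : z ∈ T ∧ x ∈ T
    · obtain ⟨hxz, hz, hx, hg, e1, e2⟩ := adj_form h
      obtain ⟨-, -, -, hg', e1', e2'⟩ := adj_form h'
      rw [← e1, ← e2, ← e1', ← e2']
      exact swap_const hTA hφ hT.2 hT.1 hxz hg hg'
    · rw [h0 W V h (by tauto), h0 W' V' h' (by tauto)]
  set c : ℕ → ℕ → ℝ := fun z x => if h : ∃ WV : List ℕ × List ℕ, good A (WV.1 ++ z :: x :: WV.2) then
    φ (h.choose.1 ++ z :: x :: h.choose.2) - φ (h.choose.1 ++ x :: z :: h.choose.2) else 0 with hc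
  have hadj : ∀ W V z x, good A (W ++ z :: x :: V) →
      φ (W ++ z :: x :: V) - φ (W ++ x :: z :: V) = c z x := by
    intro W V z x h
    have hex : ∃ WV : List ℕ × List ℕ, good A (WV.1 ++ z :: x :: WV.2) := ⟨(W, V), h⟩
    simp only [hc]
    rw [dif_pos hex]
    exact (hind z x _ _ _ _ h hex.choose_spec).1
  have hnot : ∀ z x, (¬ ∃ W V, good A (W ++ z :: x :: V)) → c z x = 0 := by
    intro z x h
    simp only [hc]
    rw [dif_neg]
    rintro ⟨WV, hWV⟩; exact h ⟨_, _, hWV⟩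
  have hanti : ∀ a b, c a b = - c b a := by
    intro a b
    by_cases h : ∃ W V, good A (W ++ a :: b :: V)
    · obtain ⟨W, V, h⟩ := h
      rw [← hadj W V a b h, ← hadj W V b a (good_swap h)]; ring
    · rw [hnot a b h, hnot b a (by rintro ⟨W, V, h'⟩; exact h ⟨W, V, good_swap h'⟩), neg_zero]
  have hoff : ∀ a b, a ∉ T ∨ b ∉ T → c a b = 0 := by
    intro a b hab
    by_cases h : ∃ W V, good A (W ++ a :: b :: V)
    · obtain ⟨W, V, h⟩ := h
      rw [← hadj W V a b h, (hind a b W V W V h h).2 hab]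
    · exact hnot a b h
  set ψ : List ℕ → ℝ := fun l => φ l - 1 / 4 * ∑ a ∈ A, ∑ b ∈ A, c a b * ((sg l a b : ℚ) : ℝ) with hψ
  have hstep : ∀ W V z x, good A (W ++ z :: x :: V) → ψ (W ++ z :: x :: V) = ψ (W ++ x :: z :: V) := by
    intro W V z x h
    have h1 := hadj W V z x h
    have hxz : x ≠ z := (adj_form h).1
    have hzA : z ∈ A := (h.2 z).1 (by simp)
    have hxA : x ∈ A := (h.2 x).1 (by simp)
    have h2 : ∑ a ∈ A, ∑ b ∈ A, c a b * ((sg (W ++ z :: x :: V) a b : ℚ) : ℝ) -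
        ∑ a ∈ A, ∑ b ∈ A, c a b * ((sg (W ++ x :: z :: V) a b : ℚ) : ℝ) = 4 * c z x := by
      rw [← Finset.sum_sub_distrib]
      have e : ∀ a ∈ A, ∑ b ∈ A, c a b * ((sg (W ++ z :: x :: V) a b : ℚ) : ℝ) -
        ∑ b ∈ A, c a b * ((sg (W ++ x :: z :: V) a b : ℚ) : ℝ) =
          (if a = z then 2 * c z x else 0) - (if a = x then 2 * c x z else 0) := by
        intro a _
        rw [← Finset.sum_sub_distrib]
        have e : ∀ b ∈ A, c a b * ((sg (W ++ z :: x :: V) a b : ℚ) : ℝ) -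
          c a b * ((sg (W ++ x :: z :: V) a b : ℚ) : ℝ) =
            (if b = x then (if a = z then 2 * c z x else 0) else 0) -
            (if b = z then (if a = x then 2 * c x z else 0) else 0) := by
          intro b _
          rw [← mul_sub, ← Rat.cast_sub, sg_swap h]
          push_cast
          exact sw_aux hxz c a b
        rw [Finset.sum_congr rfl e, Finset.sum_sub_distrib, Finset.sum_ite_eq', Finset.sum_ite_eq',
          if_pos hxA, if_pos hzA]
      rw [Finset.sum_congr rfl e, Finset.sum_sub_distrib, Finset.sum_ite_eq', Finset.sum_ite_eq',
          if_pos hxA, if_pos hzA, hanti x z]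
      ring
    simp only [hψ]
    linarith
  have hperm : ∀ l l' : List ℕ, l.Perm l' → ∀ W, good A (W ++ l) → ψ (W ++ l) = ψ (W ++ l') := by
    intro l l' h
    induction h with
    | nil => intro W _; rfl
    | cons a _ ih =>
      intro W hW
      have := ih (W ++ [a]) (by simpa using hW)
      simpa using this
    | swap a b V => intro W hW; exact hstep W V b a hW
    | trans h1 h2 ih1 ih2 =>
      intro W hW
      rw [ih1 W hW, ih2 W]
      have hp := h1.append_left W
      exact ⟨hp.nodup_iff.1 hW.1, fun a => by rw [← hp.mem_iff]; exact hW.2 a⟩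
  have hconst : ∀ l, good A l → ψ l = ψ A.toList := by
    intro l hl
    have hp : l.Perm A.toList := by
      rw [List.perm_ext_iff_of_nodup hl.1 A.nodup_toList]
      intro a; rw [hl.2]; simp
    simpa using hperm _ _ hp [] (by simpa using hl)
  have hev : ∀ μ, OK A μ → ev φ μ = ψ A.toList * ((mass μ : ℚ) : ℝ) +
      1 / 4 * ∑ a ∈ A, ∑ b ∈ A, c a b * ((ev (fun l => sg l a b) μ : ℚ) : ℝ) := by
    intro μ hμ
    have h1 : ev φ μ = ∑ l ∈ μ.support, ((μ l : ℚ) : ℝ) * (ψ A.toList +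
        1 / 4 * ∑ a ∈ A, ∑ b ∈ A, c a b * ((sg l a b : ℚ) : ℝ)) := by
      rw [ev_eq_sum]
      refine Finset.sum_congr rfl (fun l hl => ?_)
      rw [Rat.smul_def, ← hconst l (hμ.1 l hl)]
      simp only [hψ]; ring
    rw [h1]
    simp only [mass, ev_eq_sum, smul_eq_mul, mul_one, Rat.cast_sum, Rat.cast_mul, mul_add,
      Finset.sum_add_distrib, Finset.mul_sum]
    congr 1
    · exact Finset.sum_congr rfl (fun l _ => by ring)
    · rw [Finset.sum_comm]
      refine Finset.sum_congr rfl (fun a _ => ?_)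
      rw [Finset.sum_comm]
      refine Finset.sum_congr rfl (fun b _ => ?_)
      exact Finset.sum_congr rfl (fun l _ => by ring)
  obtain ⟨μ0, hμ0, -⟩ := supp (f := f) _ A.toList rfl A T hTA hne (good_exists A)
  have hk : ψ A.toList = 0 := by
    have h1 := hev μ0 hμ0.ok
    rw [hφ μ0 hμ0] at h1
    have h2 : ∑ a ∈ A, ∑ b ∈ A, c a b * ((ev (fun l => sg l a b) μ0 : ℚ) : ℝ) = 0 := by
      refine Finset.sum_eq_zero (fun a _ => Finset.sum_eq_zero (fun b _ => ?_))
      by_cases hT : a ∈ T ∧ b ∈ T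
      · rw [hμ0.mar a hT.1 b hT.2]; simp
      · rw [hoff a b (by tauto), zero_mul]
    rw [h2, mul_zero, add_zero] at h1
    have hpos : (0 : ℝ) < ((mass μ0 : ℚ) : ℝ) := by exact_mod_cast hμ0.pos
    rcases mul_eq_zero.1 h1.symm with h | h
    · exact h
    · exact absurd h hpos.ne'
  refine ⟨c, hanti, hoff, hadj, fun μ hμ => ?_⟩
  rw [hev μ hμ, hk, zero_mul, zero_add]

theorem lim_nonneg {a b : ℝ} (h : ∀ ε : ℚ, 0 < ε → 0 ≤ a + (ε : ℝ) * b) : 0 ≤ a := by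
  by_contra hn
  push Not at hn
  obtain ⟨q, hq0, hq⟩ := exists_rat_btwn (show (0 : ℝ) < -a / (|b| + 1) by
    apply div_pos <;> [linarith; positivity])
  have hq0' : 0 < q := by exact_mod_cast hq0
  have h1 := h q hq0'
  rw [lt_div_iff₀ (by positivity)] at hq
  have h2 : (q : ℝ) * b ≤ q * |b| := mul_le_mul_of_nonneg_left (le_abs_self b) hq0.le
  nlinarith

theorem SO.list {f : PSCF} {A p R} (h : SO f A p R) : ∃ μ, S f A p μ ∧ toProf μ = R := by
  obtain ⟨μ, h1, h2⟩ := exists_list h.2.1 h.2.2.1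
  exact ⟨μ, ⟨h1, by rw [h2]; exact h⟩, h2⟩

theorem ev_real {A : Finset ℕ} {μ : List ℕ →₀ ℚ} (h : ∀ l ∈ μ.support, good A l)
    (g : Finset (ℕ × ℕ) → ℝ) :
    ∑ r ∈ linOrders A, g r * ((toProf μ r : ℚ) : ℝ) = ev (fun l => g (ord l)) μ := by
  rw [← sum_toProf h]
  exact Finset.sum_congr rfl (fun r _ => by rw [Rat.smul_def, mul_comm])

theorem diff_univ {f : PSCF} [Nice f] {A p q} (hp : ∃ μ, S f A p μ) (hq : ∃ μ, S f A q μ)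
    (H : ∀ φ : List ℕ → ℝ, (∀ μ, S f A p μ → 0 ≤ ev φ μ) → (∀ μ, S f A q μ → ev φ μ ≤ 0) →
      ∀ l, good A l → φ l = 0) (x : Finset (ℕ × ℕ) → ℚ) (hx : ∀ r, r ∉ linOrders A → x r = 0) :
    ∃ k1 k2, SO f A p k1 ∧ SO f A q k2 ∧ x = k1 - k2 := by
  obtain ⟨μp, hμp⟩ := hp
  obtain ⟨μq, hμq⟩ := hq
  refine sep (linOrders A) {x | ∃ k1 k2, SO f A p k1 ∧ SO f A q k2 ∧ x = k1 - k2}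
    ⟨_, _, _, hμp.2, hμq.2, rfl⟩ ?_ ?_ ?_ ?_ x hx
  · rintro _ ⟨a, b, ha, hb, rfl⟩ _ ⟨a', b', ha', hb', rfl⟩
    exact ⟨_, _, ha.add ha', hb.add hb', by abel⟩
  · rintro c hc _ ⟨a, b, ha, hb, rfl⟩
    exact ⟨_, _, ha.smul hc, hb.smul hc, smul_sub _ _ _⟩
  · rintro _ ⟨a, b, ha, hb, rfl⟩ r hr
    rw [Pi.sub_apply, ha.2.1 r hr, hb.2.1 r hr, sub_zero]
  · intro φ hφ r hr
    have key : ∀ μ ν, S f A p μ → S f A q ν → 0 ≤ ev (fun l => φ (ord l)) μ - ev (fun l => φ (ord l)) ν := by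
      intro μ ν h1 h2
      have := hφ _ ⟨_, _, h1.2, h2.2, rfl⟩
      rw [← ev_real h1.ok.1, ← ev_real h2.ok.1, ← Finset.sum_sub_distrib]
      convert this using 2
      rw [Pi.sub_apply]; push_cast; ring
    obtain ⟨l, hl, rfl⟩ := ord_surj _ A rfl r hr
    refine H (fun l => φ (ord l)) (fun μ h => ?_) (fun ν h => ?_) l hl
    · refine lim_nonneg (b := - ev (fun l => φ (ord l)) μq) (fun ε hε => ?_)
      have := key μ (ε • μq) h (hμq.smul hε)
      rw [map_smul, Rat.smul_def] at this
      linarith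
    · refine neg_nonneg.1 (lim_nonneg (b := ev (fun l => φ (ord l)) μp) (fun ε hε => ?_))
      have := key (ε • μp) ν (hμp.smul hε) h
      rw [map_smul, Rat.smul_def] at this
      linarith

def Int' (f : PSCF) (A : Finset ℕ) (p : ℕ → ℚ) (v : Finset (ℕ × ℕ) → ℚ) : Prop :=
  SO f A p v ∧ ∀ r ∈ linOrders A, SO f A p (v + Pi.single r 1) ∧ SO f A p (v - Pi.single r 1)

theorem Int'.add {f : PSCF} [Nice f] {A p v k} (h : Int' f A p v) (h' : SO f A p k) :
    Int' f A p (v + k) := by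
  refine ⟨h.1.add h', fun r hr => ⟨?_, ?_⟩⟩
  · convert (h.2 r hr).1.add h' using 1; abel
  · convert (h.2 r hr).2.add h' using 1; abel

theorem exists_int {f : PSCF} [Nice f] {A p} (hp : ∃ μ, S f A p μ)
    (H : ∀ φ : List ℕ → ℝ, (∀ μ, S f A p μ → ev φ μ = 0) → ∀ l, good A l → φ l = 0) :
    ∃ v, Int' f A p v := by
  classical
  have hd := diff_univ hp hp (fun φ h1 h2 => H φ (fun μ h => le_antisymm (h2 μ h) (h1 μ h)))
  obtain ⟨μ, hμ⟩ := hp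
  have : ∀ s ⊆ linOrders A, ∃ v, SO f A p v ∧
      ∀ r ∈ s, SO f A p (v + Pi.single r 1) ∧ SO f A p (v - Pi.single r 1) := by
    intro s
    induction s using Finset.induction_on with
    | empty => intro _; exact ⟨_, hμ.2, by simp⟩
    | insert r s hr ih =>
      intro hs
      obtain ⟨v, hv, hvs⟩ := ih (fun a ha => hs (mem_insert_of_mem ha))
      obtain ⟨a, b, ha, hb, e⟩ := hd (Pi.single r 1) (fun r' hr' => by
        rw [Pi.single_apply, if_neg]; rintro rfl; exact hr' (hs (mem_insert_self _ _)))
      refine ⟨v + a + b, (hv.add ha).add hb, fun r' hr' => ?_⟩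
      rcases mem_insert.1 hr' with rfl | hr'
      · rw [e]
        constructor
        · convert (hv.add ha).add ha using 1; abel
        · convert (hv.add hb).add hb using 1; abel
      · constructor
        · convert ((hvs r' hr').1.add ha).add hb using 1; abel
        · convert ((hvs r' hr').2.add ha).add hb using 1; abel
  obtain ⟨v, h1, h2⟩ := this _ subset_rfl
  exact ⟨v, h1, h2⟩

theorem Int'.ball {f : PSCF} [Nice f] {A p v} (h : Int' f A p v) {w : Finset (ℕ × ℕ) → ℚ}
    (hw : ∀ r, r ∉ linOrders A → w r = 0) (hs : ∑ r ∈ linOrders A, |w r| < 1) :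
    SO f A p (v + w) := by
  classical
  have : ∀ s ⊆ linOrders A, ∀ c : ℚ, 0 < c → ∀ w : Finset (ℕ × ℕ) → ℚ, (∀ r, r ∉ s → w r = 0) →
      ∑ r ∈ s, |w r| < c → SO f A p (c • v + w) := by
    intro s
    induction s using Finset.induction_on with
    | empty =>
      intro _ c hc w hw _
      have : w = 0 := by ext r; exact hw r (by simp)
      rw [this, add_zero]; exact h.1.smul hc
    | insert r s hr ih =>
      intro hs c hc w hw hsum
      rw [sum_insert hr] at hsum
      have h1 := ih (fun a ha => hs (mem_insert_of_mem ha)) (c - |w r|) (by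
        have : 0 ≤ ∑ r ∈ s, |w r| := sum_nonneg (fun _ _ => abs_nonneg _)
        linarith) (w - Pi.single r (w r)) (fun r' hr' => by
          rw [Pi.sub_apply, Pi.single_apply]
          split_ifs with e
          · rw [e, sub_self]
          · rw [hw r' (by simp [e, hr']), sub_zero]) (by
        rw [Finset.sum_congr rfl (g := fun r => |w r|)]
        · linarith
        · intro a ha
          rw [Pi.sub_apply, Pi.single_apply, if_neg (by rintro rfl; exact hr ha), sub_zero])
      have hsg : ∀ t : ℚ, (Pi.single r t : Finset (ℕ × ℕ) → ℚ) = t • Pi.single r 1 := by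
        intro t; rw [← Pi.single_smul, smul_eq_mul, mul_one]
      have hrA := hs (mem_insert_self _ _)
      rcases lt_trichotomy (w r) 0 with h0 | h0 | h0
      · convert h1.add ((h.2 r hrA).2.smul (neg_pos.2 h0)) using 1
        rw [hsg, abs_of_neg h0]; module
      · rw [h0] at h1; simpa using h1
      · convert h1.add ((h.2 r hrA).1.smul h0) using 1
        rw [hsg, abs_of_pos h0]; module
  have := this _ subset_rfl 1 one_pos w hw hs
  rwa [one_smul] at this

theorem Int'.unique {f : PSCF} [Nice f] {A p q v} (h : Int' f A p v) (h' : Int' f A q v) : p = q := by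
  have hm := h.1.2.2.2.1
  set M := ∑ r ∈ linOrders A, v r with hM
  have hprof : IsProfile A (M⁻¹ • v) := normalize h.1.2.1 h.1.2.2.1 hm
  obtain ⟨R', hR', hd, p0, hp0⟩ := f.decisive A h.1.1 _ hprof M⁻¹ (inv_pos.2 hm)
  have hw0 : ∀ r, r ∉ linOrders A → (M • R' - v) r = 0 := by
    intro r hr
    rw [Pi.sub_apply, Pi.smul_apply, hR'.1 r hr, h.1.2.1 r hr]; simp
  have hw1 : ∑ r ∈ linOrders A, |(M • R' - v) r| < 1 := by
    have : ∑ r ∈ linOrders A, |(M • R' - v) r| = M * profileDist A (M⁻¹ • v) R' := by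
      unfold profileDist
      rw [Finset.mul_sum]
      refine Finset.sum_congr rfl (fun r _ => ?_)
      rw [← abs_of_pos hm, ← abs_mul, abs_of_pos hm, ← abs_neg]
      congr 1
      simp only [Pi.sub_apply, Pi.smul_apply, smul_eq_mul]
      field_simp
      ring
    rw [this]
    calc M * profileDist A (M⁻¹ • v) R' < M * M⁻¹ := mul_lt_mul_of_pos_left hd hm
      _ = 1 := mul_inv_cancel₀ hm.ne'
  have key : ∀ u, Int' f A u v → u = p0 := by
    intro u hu
    have h1 := (hu.ball hw0 hw1).2.2.2.2
    have e : v + (M • R' - v) = M • R' := by abel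
    rw [e] at h1
    have e2 : ∑ r ∈ linOrders A, (M • R') r = M := by
      simp only [Pi.smul_apply, smul_eq_mul]
      rw [← Finset.mul_sum, hR'.2.2, mul_one]
    rw [e2, smul_smul, inv_mul_cancel₀ hm.ne', one_smul, hp0] at h1
    exact h1
  rw [key p h, key q h']

theorem mem_ord_map (π : Equiv.Perm ℕ) (l : List ℕ) (a b : ℕ) :
    (π a, π b) ∈ ord (l.map π) ↔ (a, b) ∈ ord l := by
  induction l with
  | nil => simp [mem_ord_nil]
  | cons c l ih => simp [mem_ord_cons, ih]

theorem sg_map (π : Equiv.Perm ℕ) (l : List ℕ) (a b : ℕ) :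
    sg (l.map π) (π a) (π b) = sg l a b := by
  unfold sg
  simp only [mem_ord_map]

theorem mar_map (π : Equiv.Perm ℕ) (μ : List ℕ →₀ ℚ) (a b : ℕ) :
    ev (fun l => sg l (π a) (π b)) (μ.mapDomain (List.map π)) = ev (fun l => sg l a b) μ := by
  rw [ev_map]
  simp only [sg_map]

theorem neutP {f : PSCF} [Nice f] {T A : Finset ℕ} (hTA : T ⊆ A) {p : ℕ → ℚ}
    (hp : ∀ a ∈ T, ∀ b ∈ T, p a = p b) {μ} (h : S f A p μ) (σ : Equiv.Perm {x // x ∈ T}) :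
    S f A p (μ.mapDomain (List.map (Equiv.Perm.ofSubtype σ : Equiv.Perm ℕ))) := by
  induction σ using Equiv.Perm.swap_induction_on with
  | one => simpa using h
  | swap_mul σ x y hxy ih =>
    have h2 := neut2 (hTA x.2) (hTA y.2) ih
    rw [map_mul, Equiv.Perm.ofSubtype_swap_eq]
    convert h2 using 1
    · ext a
      simp only [Function.comp_apply, Equiv.swap_apply_def]
      split_ifs with h1 h2
      · rw [h1]; exact hp _ x.2 _ y.2
      · rw [h2]; exact hp _ y.2 _ x.2
      · rfl
    · rw [← Finsupp.mapDomain_comp]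
      congr 1
      ext l : 1
      simp [List.map_map]

section alg
variable {ι : Type} [Fintype ι] [DecidableEq ι]

theorem sum_perm_const (d : ι → ℝ) (a b : ι) :
    ∑ σ : Equiv.Perm ι, d (σ a) = ∑ σ : Equiv.Perm ι, d (σ b) := by
  refine Fintype.sum_equiv (Equiv.mulRight (Equiv.swap a b)) _ _ (fun σ => ?_)
  simp

theorem sum_perm (d s : ι → ℝ) (a0 : ι) :
    ∑ σ : Equiv.Perm ι, ∑ a, d (σ a) * s a = (∑ σ : Equiv.Perm ι, d (σ a0)) * ∑ a, s a := by
  rw [Finset.sum_comm, Finset.mul_sum]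
  refine Finset.sum_congr rfl (fun a _ => ?_)
  rw [← Finset.sum_mul, sum_perm_const d a a0]

theorem alg1 (d s : ι → ℝ) (hs : ∑ a, s a = 0) (h : ∀ σ : Equiv.Perm ι, 0 ≤ ∑ a, d (σ a) * s a)
    (x : ι) (hx : s x ≠ 0) : ∀ u v, d u = d v := by
  have h0 := sum_perm d s x
  rw [hs, mul_zero, Finset.sum_eq_zero_iff_of_nonneg (fun σ _ => h σ)] at h0
  have hy : ∃ y, s x ≠ s y := by
    by_contra hn
    push Not at hn
    have : ∑ a, s a = (Fintype.card ι : ℝ) * s x := by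
      rw [Finset.sum_congr rfl (fun a _ => (hn a).symm)]; simp
    rw [hs] at this
    have hc : (Fintype.card ι : ℝ) ≠ 0 := by
      have := Fintype.card_pos_iff.2 ⟨x⟩
      positivity
    exact (mul_ne_zero hc hx) this.symm
  obtain ⟨y, hxy⟩ := hy
  have hne : x ≠ y := by rintro rfl; exact hxy rfl
  have key : ∀ σ : Equiv.Perm ι, d (σ x) = d (σ y) := by
    intro σ
    have h1 := h0 σ (mem_univ _)
    have h2 := h0 (σ * Equiv.swap x y) (mem_univ _)
    have h3 : ∑ a, (d (σ a) * s a - d ((σ * Equiv.swap x y) a) * s a) =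
        ∑ a, ((if a = x then (d (σ x) - d (σ y)) * s x else 0) +
          (if a = y then (d (σ y) - d (σ x)) * s y else 0)) := by
      refine Finset.sum_congr rfl (fun a _ => ?_)
      rw [Equiv.Perm.mul_apply, Equiv.swap_apply_def]
      by_cases e1 : a = x
      · subst e1; simp [hne]; ring
      · by_cases e2 : a = y
        · subst e2; simp [e1]; ring
        · simp [e1, e2]
    rw [Finset.sum_sub_distrib, h1, h2, Finset.sum_add_distrib, Finset.sum_ite_eq',
      Finset.sum_ite_eq', if_pos (mem_univ _), if_pos (mem_univ _)] at h3
    have h4 : (d (σ x) - d (σ y)) * (s x - s y) = 0 := by linarith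
    rcases mul_eq_zero.1 h4 with h5 | h5
    · linarith
    · exact absurd (by linarith) hxy
  intro u v
  by_cases huv : u = v
  · rw [huv]
  have h1 := key (Equiv.swap (Equiv.swap x u y) v * Equiv.swap x u)
  have e : (Equiv.swap (Equiv.swap x u y) v * Equiv.swap x u) x = u := by
    rw [Equiv.Perm.mul_apply, Equiv.swap_apply_left, Equiv.swap_apply_of_ne_of_ne _ huv]
    intro e
    have e2 := congrArg (Equiv.swap x u) e
    rw [Equiv.swap_apply_right, Equiv.swap_apply_self] at e2
    exact hne e2
  have e' : (Equiv.swap (Equiv.swap x u y) v * Equiv.swap x u) y = v := by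
    rw [Equiv.Perm.mul_apply, Equiv.swap_apply_left]
  rwa [e, e'] at h1

theorem alg2 (c t : ι → ℝ) (hc : ∀ a, c a ≤ 0) (ht : 0 < ∑ a, t a)
    (h : ∀ σ : Equiv.Perm ι, 0 ≤ ∑ a, c (σ a) * t a) : ∀ u, c u = 0 := by
  intro u
  have h0 := sum_perm c t u
  have h1 : 0 ≤ (∑ σ : Equiv.Perm ι, c (σ u)) * ∑ a, t a := by
    rw [← h0]; exact Finset.sum_nonneg (fun σ _ => h σ)
  have h2 : 0 ≤ ∑ σ : Equiv.Perm ι, c (σ u) := nonneg_of_mul_nonneg_left h1 ht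
  have h3 : ∑ σ : Equiv.Perm ι, c (σ u) ≤ c u := by
    rw [← Finset.add_sum_erase univ (fun σ : Equiv.Perm ι => c (σ u)) (mem_univ 1)]
    have := Finset.sum_nonpos (s := univ.erase 1) (f := fun σ : Equiv.Perm ι => c (σ u))
      (fun _ _ => hc _)
    simpa using this
  exact le_antisymm (hc u) (h2.trans h3)
end alg

theorem ev_good {A : Finset ℕ} {φ : List ℕ → ℝ} (h : ∀ μ, OK A μ → ev φ μ = 0) (l)
    (hl : good A l) : φ l = 0 := by
  have := h _ (OK.single hl zero_le_one)
  rwa [ev_single, one_smul] at this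

theorem Sw.zero {T A : Finset ℕ} {φ c} (h : Sw T A φ c) (hc : ∀ a ∈ T, ∀ b ∈ T, c a b = 0) (l)
    (hl : good A l) : φ l = 0 := by
  refine ev_good (fun μ hμ => ?_) l hl
  rw [h.rep μ hμ, Finset.sum_eq_zero, mul_zero]
  refine fun a _ => Finset.sum_eq_zero (fun b _ => ?_)
  by_cases hT : a ∈ T ∧ b ∈ T
  · rw [hc a hT.1 b hT.2, zero_mul]
  · rw [h.off a b (by tauto), zero_mul]

theorem Adh.nonneg {f : PSCF} [Nice f] {T A μ} (h : Adh f T A μ) {T'} (hT : T' ⊆ T)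
    (hne : T'.Nonempty) {p} (hp : IsLottery A p) (hpT : ∀ a, 0 < p a ↔ a ∈ T') {φ : List ℕ → ℝ}
    (hφ : ∀ μ, S f A p μ → 0 ≤ ev φ μ) : 0 ≤ ev φ μ := by
  obtain ⟨ν, -, -, h3⟩ := h.per T' hT hne
  refine lim_nonneg (b := ev φ ν) (fun ε hε => ?_)
  have := hφ _ (h3 ε hε p hp hpT)
  rwa [map_add, map_smul, Rat.smul_def] at this

theorem Adh.nonpos {f : PSCF} [Nice f] {T A μ} (h : Adh f T A μ) {T'} (hT : T' ⊆ T)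
    (hne : T'.Nonempty) {p} (hp : IsLottery A p) (hpT : ∀ a, 0 < p a ↔ a ∈ T') {φ : List ℕ → ℝ}
    (hφ : ∀ μ, S f A p μ → ev φ μ ≤ 0) : ev φ μ ≤ 0 := by
  obtain ⟨ν, -, -, h3⟩ := h.per T' hT hne
  refine neg_nonneg.1 (lim_nonneg (b := - ev φ ν) (fun ε hε => ?_))
  have := hφ _ (h3 ε hε p hp hpT)
  rw [map_add, map_smul, Rat.smul_def] at this
  linarith

theorem deg_pos (y a : ℕ) : 0 < degLottery y a ↔ a ∈ ({y} : Finset ℕ) := by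
  unfold degLottery; split_ifs with h <;> simp [h]

theorem uni_lot {T A : Finset ℕ} (hTA : T ⊆ A) (hne : T.Nonempty) : IsLottery A (uniLottery T) := by
  have hc : (0 : ℚ) < T.card := by exact_mod_cast hne.card_pos
  refine ⟨fun a ha => if_neg (fun h => ha (hTA h)), fun a => ?_, ?_⟩
  · unfold uniLottery; split_ifs <;> positivity
  · unfold uniLottery
    rw [Finset.sum_ite_mem, inter_eq_right.2 hTA]
    simp [hc.ne']

theorem uni_pos {T : Finset ℕ} (a : ℕ) : 0 < uniLottery T a ↔ a ∈ T := by
  unfold uniLottery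
  split_ifs with h
  · have : 0 < T.card := Finset.card_pos.2 ⟨a, h⟩
    simp [h, this]
  · simp [h]

theorem exists_S {f : PSCF} [Nice f] {T A : Finset ℕ} (hTA : T ⊆ A) (hne : T.Nonempty) {p}
    (hp : IsLottery A p) (hpT : ∀ a, 0 < p a ↔ a ∈ T) : ∃ μ, S f A p μ := by
  obtain ⟨μ, hμ, -⟩ := supp (f := f) _ _ rfl A T hTA hne (good_exists A)
  obtain ⟨ν, -, -, h3⟩ := hμ.per T subset_rfl hne
  exact ⟨_, h3 1 one_pos p hp hpT⟩

theorem deg_int {f : PSCF} [Nice f] {A : Finset ℕ} {y} (hy : y ∈ A) :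
    ∃ v, Int' f A (degLottery y) v := by
  have hT : ({y} : Finset ℕ) ⊆ A := singleton_subset_iff.2 hy
  refine exists_int (exists_S hT (singleton_nonempty y) (lot_deg hy) (deg_pos y))
    (fun φ hφ => ?_)
  obtain ⟨c, hc⟩ := exists_sw (f := f) hT (singleton_nonempty y) (φ := φ) (fun μ hμ => le_antisymm
    (hμ.nonpos subset_rfl (singleton_nonempty y) (lot_deg hy) (deg_pos y) (fun μ h => (hφ μ h).le))
    (hμ.nonneg subset_rfl (singleton_nonempty y) (lot_deg hy) (deg_pos y) (fun μ h => (hφ μ h).ge)))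
  refine hc.zero (fun a ha b hb => ?_)
  rw [mem_singleton] at ha hb
  rw [ha, hb]
  linarith [hc.anti y y]

theorem sub_sub {a x : ℕ} {s t l : List ℕ} (h : x = a ∨ x ∉ l) :
    sub x s (sub a t l) = sub a (sub x s t) l := by
  induction l with
  | nil => rfl
  | cons u l ih =>
    have ih' := ih (by rcases h with h | h <;> simp_all)
    unfold sub at ih' ⊢
    rw [List.flatMap_cons, List.flatMap_append, ih', List.flatMap_cons]
    congr 1
    by_cases e : u = a
    · rw [if_pos e, if_pos e]
    · have : u ≠ x := by
        rcases h with h | h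
        · rw [h]; exact e
        · rintro rfl; exact h (by simp)
      rw [if_neg e, if_neg e]; simp [this]

theorem map_sub_sub {A : Finset ℕ} {μ : List ℕ →₀ ℚ} (hμ : OK A μ) {a x : ℕ} {s t : List ℕ}
    (h : x = a ∨ x ∉ A) :
    (μ.mapDomain (sub a t)).mapDomain (sub x s) = μ.mapDomain (sub a (sub x s t)) := by
  rw [← Finsupp.mapDomain_comp]
  refine Finsupp.mapDomain_congr (fun l hl => ?_)
  exact sub_sub (h.imp id (fun h h' => h (((hμ.1 l hl).2 x).1 h')))

/-- the uniform lottery is chosen on a three-cycle -/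
theorem cyc3 {f : PSCF} [Nice f] {a b c : ℕ} (hab : a ≠ b) (hbc : b ≠ c) (hac : a ≠ c) {k : ℚ}
    (hk : 0 < k) :
    S f {a, b, c} (uniLottery {a, b, c}) (Finsupp.single [a, b, c] k + Finsupp.single [b, c, a] k +
      Finsupp.single [c, a, b] k) := by
  have g1 : good {a, b, c} [a, b, c] := ⟨by simp [*], by simp⟩
  have g2 : good {a, b, c} [b, c, a] := ⟨by simp [*, Ne.symm hab, Ne.symm hac], by simp; tauto⟩
  have g3 : good {a, b, c} [c, a, b] := ⟨by simp [*, Ne.symm hbc, Ne.symm hac], by simp; tauto⟩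
  set μ := Finsupp.single [a, b, c] k + Finsupp.single [b, c, a] k + Finsupp.single [c, a, b] k with hμ
  have ok : OK {a, b, c} μ := ((OK.single g1 hk.le).add (OK.single g2 hk.le)).add (OK.single g3 hk.le)
  obtain ⟨q, hq⟩ := S_exists f (by simp) ok (by simp [hμ, map_add, mass_single]; linarith)
  have rot : ∀ q, S f {a, b, c} q μ →
      S f {a, b, c} ((q ∘ Equiv.swap a b) ∘ Equiv.swap a c) μ := by
    intro q hq
    have h1 := neut2 (x := a) (z := c) (by simp) (by simp)
      (neut2 (x := a) (z := b) (by simp) (by simp) hq)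
    convert h1 using 1
    rw [hμ]
    simp [Finsupp.mapDomain_add, Finsupp.mapDomain_single, Equiv.swap_apply_def, hab, hbc, hac,
      hab.symm, hbc.symm, hac.symm]
    abel
  have h1 := rot q hq
  have h2 := rot _ h1
  have h3 := (hq.conv h1 (t := 1 / 2) (by norm_num) (by norm_num)).conv h2 (t := 2 / 3)
    (by norm_num) (by norm_num)
  convert h3 using 1
  have hs := hq.lot.2.2
  rw [sum_insert (by simp [*]), sum_insert (by simp [*]), sum_singleton] at hs
  have hcard : ({a, b, c} : Finset ℕ).card = 3 := by
    rw [card_insert_of_notMem (by simp [*]), card_insert_of_notMem (by simp [*]), card_singleton]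
  ext x
  unfold uniLottery
  rw [hcard]
  by_cases e1 : x = a
  · subst e1
    simp [Equiv.swap_apply_def, *, hab.symm, hbc.symm, hac.symm]; linarith
  by_cases e2 : x = b
  · subst e2
    simp [Equiv.swap_apply_def, *, hab.symm, hbc.symm, hac.symm]; linarith
  by_cases e3 : x = c
  · subst e3
    simp [Equiv.swap_apply_def, *, hab.symm, hbc.symm, hac.symm]; linarith
  have := hq.lot.1 x (by simp [*])
  simp [Equiv.swap_apply_def, *]

theorem sub_fin3 {f : PSCF} [Nice f] {A : Finset ℕ} {a b c : ℕ} (ha : a ∈ A) (hb : b ∉ A) (hc : c ∉ A)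
    (hbc : b ≠ c) {p μ} (h : S f A p μ) :
    S f (insert c (insert b A)) (compLottery {a, b, c} a p (uniLottery {a, b, c}))
      (μ.mapDomain (sub a [a, b, c]) + μ.mapDomain (sub a [b, c, a]) +
        μ.mapDomain (sub a [c, a, b])) := by
  have hab : a ≠ b := by rintro rfl; exact hb ha
  have hac : a ≠ c := by rintro rfl; exact hc ha
  have g1 : good {a, b, c} [a, b, c] := ⟨by simp [*], by simp⟩
  have g2 : good {a, b, c} [b, c, a] := ⟨by simp [*, Ne.symm hab, Ne.symm hac], by simp; tauto⟩
  have g3 : good {a, b, c} [c, a, b] := ⟨by simp [*, Ne.symm hbc, Ne.symm hac], by simp; tauto⟩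
  have hi : A ∩ {a, b, c} = {a} := by ext u; simp; grind
  have hu : A ∪ {a, b, c} = insert c (insert b A) := by ext u; simp; grind
  have := (S_subs (f := f) (univ : Finset (Fin 3)) hi (s := ![[a, b, c], [b, c, a], [c, a, b]])
    (by intro i; fin_cases i <;> assumption) (μ := fun _ => μ) (fun _ => h.ok)
    (compLottery {a, b, c} a p (uniLottery {a, b, c}))).2 ⟨p, _, ?_, ?_, rfl⟩
  · rw [hu, Fin.sum_univ_three] at this
    exact this
  · rw [Fin.sum_univ_three]; exact (h.add h).add h
  · rw [Fin.sum_univ_three]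
    exact cyc3 hab hbc hac h.pos

theorem block {f : PSCF} [Nice f] {A T : Finset ℕ} {a b c : ℕ} (ha : a ∈ A) (haT : a ∈ T) (hb : b ∉ A)
    (hc : c ∉ A) (hbc : b ≠ c) {μ} (h : Adh f T A μ) {φ : List ℕ → ℝ}
    (hφ : ∀ ν, S f (insert c (insert b A)) (uniLottery (insert c (insert b T))) ν → 0 ≤ ev φ ν) :
    0 ≤ ev φ (μ.mapDomain (sub a [a, b, c])) + ev φ (μ.mapDomain (sub a [b, c, a])) +
        ev φ (μ.mapDomain (sub a [c, a, b])) := by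
  have hab : a ≠ b := by rintro rfl; exact hb ha
  have hac : a ≠ c := by rintro rfl; exact hc ha
  have hbT : b ∉ T := fun e => hb (h.sub e)
  have hcT : c ∉ T := fun e => hc (h.sub e)
  have hTA : insert c (insert b T) ⊆ insert c (insert b A) :=
    insert_subset_insert _ (insert_subset_insert _ h.sub)
  set n : ℚ := ((insert c (insert b T)).card : ℚ) with hn
  have hnT : n = T.card + 1 + 1 := by
    rw [hn, card_insert_of_notMem (by simp [hcT, Ne.symm hbc]), card_insert_of_notMem hbT]; push_cast; ring
  have hn0 : 0 < n := by rw [hnT]; positivity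
  set p : ℕ → ℚ := fun x => if x ∈ T then (if x = a then 3 * n⁻¹ else n⁻¹) else 0 with hp
  have hpl : IsLottery A p := by
    refine ⟨fun x hx => if_neg (fun e => hx (h.sub e)), fun x => ?_, ?_⟩
    · simp only [hp]; split_ifs <;> positivity
    · have e : ∀ x, p x = if x ∈ T then (n⁻¹ + (if x = a then 2 * n⁻¹ else 0)) else 0 := by
        intro x; simp only [hp]; split_ifs <;> ring
      simp only [e]
      rw [Finset.sum_ite_mem, inter_eq_right.2 h.sub, Finset.sum_add_distrib, Finset.sum_ite_eq',
        if_pos haT, Finset.sum_const, nsmul_eq_mul]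
      field_simp
      rw [hnT]; ring
  have hpT : ∀ x, 0 < p x ↔ x ∈ T := by
    intro x
    simp only [hp]
    split_ifs with h1 h2
    · simp [h1, hn0]
    · simp [h1, hn0]
    · simp [h1]
  have hcard : ({a, b, c} : Finset ℕ).card = 3 := by
    rw [card_insert_of_notMem (by simp [*]), card_insert_of_notMem (by simp [*]), card_singleton]
  have hcomp : compLottery {a, b, c} a p (uniLottery {a, b, c}) =
      uniLottery (insert c (insert b T)) := by
    ext x
    unfold compLottery uniLottery
    rw [← hn, hcard]
    by_cases h1 : x ∈ ({a, b, c} : Finset ℕ)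
    · have h2 : x ∈ insert c (insert b T) := by
        simp only [mem_insert, mem_singleton] at h1 ⊢
        rcases h1 with rfl | rfl | rfl <;> simp [haT]
      rw [if_pos h1, if_pos h1, if_pos h2]
      simp only [hp, if_pos haT, if_true]
      push_cast
      ring
    · rw [if_neg h1]
      simp only [mem_insert, mem_singleton, not_or] at h1
      simp [hp, h1]
  obtain ⟨ν, -, -, h3⟩ := h.per T subset_rfl ⟨a, haT⟩
  set E : (List ℕ →₀ ℚ) → ℝ := fun μ => ev φ (μ.mapDomain (sub a [a, b, c])) +
    ev φ (μ.mapDomain (sub a [b, c, a])) + ev φ (μ.mapDomain (sub a [c, a, b])) with hE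
  refine lim_nonneg (a := E μ) (b := E ν) (fun ε hε => ?_)
  have h4 := sub_fin3 ha hb hc hbc (h3 ε hε p hpl hpT)
  rw [hcomp] at h4
  have h5 := hφ _ h4
  simp only [map_add, Finsupp.mapDomain_add, Finsupp.mapDomain_smul, map_smul, Rat.smul_def] at h5
  simp only [hE]
  linarith

theorem ev_diff {μ : List ℕ →₀ ℚ} {φ : List ℕ → ℝ} {g g' : List ℕ → List ℕ} {k : ℝ}
    (h : ∀ l ∈ μ.support, φ (g l) - φ (g' l) = k) :
    ev φ (μ.mapDomain g) - ev φ (μ.mapDomain g') = ((mass μ : ℚ) : ℝ) * k := by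
  unfold mass
  rw [ev_map, ev_map, ev_eq_sum, ev_eq_sum, ev_eq_sum, ← Finset.sum_sub_distrib, Rat.cast_sum,
    Finset.sum_mul]
  refine Finset.sum_congr rfl (fun l hl => ?_)
  rw [← smul_sub, h l hl, Rat.smul_def]; simp

theorem cocycle {f : PSCF} [Nice f] {T A : Finset ℕ} (hTA : T ⊆ A) {φ : List ℕ → ℝ} {C}
    (hsw : Sw T A φ C) (hadh : ∀ μ, Adh f T A μ → ev φ μ = 0)
    (hφ : ∀ μ, S f A (uniLottery T) μ → 0 ≤ ev φ μ) {a b c : ℕ} (ha : a ∈ T) (hb : b ∈ T)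
    (hc : c ∈ T) (hab : a ≠ b) (hbc : b ≠ c) (hac : a ≠ c) : C a b + C b c + C c a = 0 := by
  set A0 := (A.erase c).erase b with hA0
  set T0 := (T.erase c).erase b with hT0
  have haT : a ∈ T0 := by simp [hT0, *]
  have haA : a ∈ A0 := by simp [hA0, *, hTA ha]
  have hbA : b ∉ A0 := by simp [hA0]
  have hcA : c ∉ A0 := by simp [hA0]
  have eA : insert c (insert b A0) = A := by
    rw [hA0, insert_erase (mem_erase.2 ⟨hbc, hTA hb⟩), insert_erase (hTA hc)]
  have eT : insert c (insert b T0) = T := by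
    rw [hT0, insert_erase (mem_erase.2 ⟨hbc, hb⟩), insert_erase hc]
  have eA' : insert b (insert c A0) = A := by rw [Finset.insert_comm, eA]
  have eT' : insert b (insert c T0) = T := by rw [Finset.insert_comm, eT]
  obtain ⟨μ, h, -⟩ := supp (f := f) _ _ rfl A0 T0 (erase_subset_erase _ (erase_subset_erase _ hTA))
    ⟨a, haT⟩ (good_exists A0)
  have b1 := block haA haT hbA hcA hbc h (φ := φ) (by rw [eA, eT]; exact hφ)
  have b2 := block haA haT hcA hbA hbc.symm h (φ := φ) (by rw [eA', eT']; exact hφ)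
  have okP : OK (insert b A0) (μ.mapDomain (sub a [b, a])) := by
    simpa [ins] using OK_ins haA hbA h.ok OK.zero
  have okQ : OK (insert b A0) (μ.mapDomain (sub a [a, b])) := by
    simpa [ins] using OK_ins haA hbA OK.zero h.ok
  have h1 := adh_a haT hbA h.ok h.ok rfl (h.add h)
  rw [ins] at h1
  have hcA' : c ∉ insert b A0 := by simp [hcA, hbc.symm]
  have c1 := adh_a (x := a) (mem_insert_of_mem haT) hcA' okQ okP (by rw [mass_map, mass_map])
    (by rw [add_comm]; exact h1)
  have c2 := adh_a (x := a) (mem_insert_of_mem haT) hcA' okP okQ (by rw [mass_map, mass_map]) h1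
  have c3 := adh_a (x := b) (mem_insert_self _ _) hcA' okP okQ (by rw [mass_map, mass_map]) h1
  rw [eA, eT, ins, map_sub_sub h.ok (Or.inl rfl), map_sub_sub h.ok (Or.inl rfl)] at c1 c2
  rw [eA, eT, ins, map_sub_sub h.ok (Or.inr hbA), map_sub_sub h.ok (Or.inr hbA)] at c3
  have d1 := hadh _ c1
  have d2 := hadh _ c2
  have d3 := hadh _ c3
  have e1 : sub a [c, a] [a, b] = [c, a, b] := by simp [sub, hab.symm]
  have e2 : sub a [a, c] [b, a] = [b, a, c] := by simp [sub, hab.symm]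
  have e3 : sub a [c, a] [b, a] = [b, c, a] := by simp [sub, hab.symm]
  have e4 : sub a [a, c] [a, b] = [a, c, b] := by simp [sub, hab.symm]
  have e5 : sub b [c, b] [b, a] = [c, b, a] := by simp [sub, hab]
  have e6 : sub b [b, c] [a, b] = [a, b, c] := by simp [sub, hab]
  rw [e1, e2, map_add] at d1
  rw [e3, e4, map_add] at d2
  rw [e5, e6, map_add] at d3
  have hi : A0 ∩ {a, b, c} = {a} := by ext u; simp; grind
  have hu : A0 ∪ {a, b, c} = A := by rw [← eA]; ext u; simp; grind
  have g1 : good {a, b, c} [a, b, c] := ⟨by simp [*], by simp⟩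
  have g2 : good {a, b, c} [b, c, a] := ⟨by simp [*, Ne.symm hab, Ne.symm hac], by simp; tauto⟩
  have g3 : good {a, b, c} [c, a, b] := ⟨by simp [*, Ne.symm hbc, Ne.symm hac], by simp; tauto⟩
  have f1 : ev φ (μ.mapDomain (sub a [a, b, c])) - ev φ (μ.mapDomain (sub a [a, c, b])) =
      ((mass μ : ℚ) : ℝ) * C b c := by
    refine ev_diff (fun l hl => ?_)
    have hg := sub_good hi (h.ok.1 l hl) g1
    obtain ⟨W, V, rfl, hW, hV⟩ := good_split (h.ok.1 l hl) haA
    rw [hu, sub_eq hW hV] at hg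
    rw [sub_eq hW hV, sub_eq hW hV]
    simpa using hsw.adj (W ++ [a]) V b c (by simpa using hg)
  have f2 : ev φ (μ.mapDomain (sub a [b, c, a])) - ev φ (μ.mapDomain (sub a [b, a, c])) =
      ((mass μ : ℚ) : ℝ) * C c a := by
    refine ev_diff (fun l hl => ?_)
    have hg := sub_good hi (h.ok.1 l hl) g2
    obtain ⟨W, V, rfl, hW, hV⟩ := good_split (h.ok.1 l hl) haA
    rw [hu, sub_eq hW hV] at hg
    rw [sub_eq hW hV, sub_eq hW hV]
    simpa using hsw.adj (W ++ [b]) V c a (by simpa using hg)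
  have f3 : ev φ (μ.mapDomain (sub a [c, a, b])) - ev φ (μ.mapDomain (sub a [c, b, a])) =
      ((mass μ : ℚ) : ℝ) * C a b := by
    refine ev_diff (fun l hl => ?_)
    have hg := sub_good hi (h.ok.1 l hl) g3
    obtain ⟨W, V, rfl, hW, hV⟩ := good_split (h.ok.1 l hl) haA
    rw [hu, sub_eq hW hV] at hg
    rw [sub_eq hW hV, sub_eq hW hV]
    simpa using hsw.adj (W ++ [c]) V a b (by simpa using hg)
  have hpos : (0 : ℝ) < ((mass μ : ℚ) : ℝ) := by exact_mod_cast h.pos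
  have key : ((mass μ : ℚ) : ℝ) * (C a b + C b c + C c a) = 0 := by linarith
  rcases mul_eq_zero.1 key with h | h
  · exact absurd h hpos.ne'
  · exact h

theorem G0 {f : PSCF} [Nice f] {T A : Finset ℕ} (hTA : T ⊆ A) (hne : T.Nonempty) {φ : List ℕ → ℝ}
    (hadh : ∀ μ, Adh f T A μ → ev φ μ = 0)
    (hφ : ∀ μ, S f A (uniLottery T) μ → 0 ≤ ev φ μ) {μ} (hμ : S f A (uniLottery T) μ) {a0 : ℕ}
    (ha0 : a0 ∈ T) (hs : ∑ b ∈ T, ev (fun l => sg l a0 b) μ ≠ 0) : ∀ l, good A l → φ l = 0 := by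
  obtain ⟨C, hsw⟩ := exists_sw hTA hne hadh
  set d : ℕ → ℝ := fun a => C a a0 with hd
  have h00 : ∀ a, C a a = 0 := fun a => by linarith [hsw.anti a a]
  have hC : ∀ a ∈ T, ∀ b ∈ T, C a b = d a - d b := by
    intro a ha b hb
    simp only [hd]
    by_cases e1 : a = b
    · rw [e1, h00]; ring
    by_cases e2 : a = a0
    · rw [e2, h00, hsw.anti]; ring
    by_cases e3 : b = a0
    · rw [e3, h00]; ring
    have := cocycle hTA hsw hadh hφ ha hb ha0 e1 e3 e2
    have := hsw.anti a a0
    linarith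
  set m : (List ℕ →₀ ℚ) → ℕ → ℕ → ℝ := fun μ a b => ((ev (fun l => sg l a b) μ : ℚ) : ℝ) with hm
  have hmneg : ∀ μ a b, m μ a b = - m μ b a := by
    intro μ a b; simp only [hm]; rw [mar_neg]; push_cast; rfl
  have hrep : ∀ μ, OK A μ → ev φ μ = 1 / 2 * ∑ a ∈ T, d a * ∑ b ∈ T, m μ a b := by
    intro μ hμ
    have e1 : ∑ a ∈ A, ∑ b ∈ A, C a b * m μ a b = ∑ a ∈ T, ∑ b ∈ T, (d a - d b) * m μ a b := by
      rw [← Finset.sum_subset hTA]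
      · refine Finset.sum_congr rfl (fun a ha => ?_)
        rw [← Finset.sum_subset hTA]
        · exact Finset.sum_congr rfl (fun b hb => by rw [hC a ha b hb])
        · intro b _ hb; rw [hsw.off a b (Or.inr hb), zero_mul]
      · intro a _ ha
        exact Finset.sum_eq_zero (fun b _ => by rw [hsw.off a b (Or.inl ha), zero_mul])
    have e2 : ∑ a ∈ T, ∑ b ∈ T, d b * m μ a b = - ∑ a ∈ T, ∑ b ∈ T, d a * m μ a b := by
      rw [Finset.sum_comm, ← Finset.sum_neg_distrib]
      refine Finset.sum_congr rfl (fun a _ => ?_)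
      rw [← Finset.sum_neg_distrib]
      refine Finset.sum_congr rfl (fun b _ => ?_)
      rw [hmneg μ b a]; ring
    rw [hsw.rep μ hμ]
    change 1 / 4 * ∑ a ∈ A, ∑ b ∈ A, C a b * m μ a b = _
    rw [e1]
    simp only [sub_mul, Finset.sum_sub_distrib, Finset.mul_sum] at e2 ⊢
    rw [e2]
    simp only [← Finset.mul_sum]; ring
  have hconst : ∀ u v : {x // x ∈ T}, d u = d v := by
    classical
    refine alg1 (fun a : {x // x ∈ T} => d a) (fun a => ∑ b ∈ T, m μ a b) ?_ (fun σ => ?_)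
      ⟨a0, ha0⟩ ?_
    · rw [Finset.univ_eq_attach, Finset.sum_attach T (fun a => ∑ b ∈ T, m μ a b)]
      have e : ∑ a ∈ T, ∑ b ∈ T, m μ a b = - ∑ a ∈ T, ∑ b ∈ T, m μ a b := by
        conv_lhs => rw [Finset.sum_comm]
        rw [← Finset.sum_neg_distrib]
        refine Finset.sum_congr rfl (fun a _ => ?_)
        rw [← Finset.sum_neg_distrib]
        exact Finset.sum_congr rfl (fun b _ => hmneg μ b a)
      linarith
    · have h1 := neutP hTA (fun a ha b hb => by simp [uniLottery, ha, hb]) hμ σ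
      have h2 := hφ _ h1
      rw [hrep _ h1.ok] at h2
      have e : ∑ a ∈ T, d a * ∑ b ∈ T, m (μ.mapDomain (List.map (Equiv.Perm.ofSubtype σ : Equiv.Perm ℕ))) a b
          = ∑ a : {x // x ∈ T}, d (σ a) * ∑ b ∈ T, m μ a b := by
        rw [← Finset.sum_attach T, ← Finset.univ_eq_attach]
        rw [← Equiv.sum_comp σ]
        refine Finset.sum_congr rfl (fun a _ => ?_)
        congr 1
        rw [← Finset.sum_attach T, ← Finset.sum_attach T (fun b => m μ a b), ← Finset.univ_eq_attach,
          ← Equiv.sum_comp σ]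
        refine Finset.sum_congr rfl (fun b _ => ?_)
        simp only [hm]
        congr 1
        have := mar_map (Equiv.Perm.ofSubtype σ : Equiv.Perm ℕ) μ a b
        rw [Equiv.Perm.ofSubtype_apply_coe, Equiv.Perm.ofSubtype_apply_coe] at this
        exact this
      rw [e] at h2
      linarith
    · simp only [hm]
      rw [← Rat.cast_sum]
      exact_mod_cast hs
  refine hsw.zero (fun a ha b hb => ?_)
  rw [hC a ha b hb, hconst ⟨a, ha⟩ ⟨b, hb⟩, sub_self]

theorem G {f : PSCF} [Nice f] {T A : Finset ℕ} (hTA : T ⊆ A) {μ} (hμ : S f A (uniLottery T) μ) {y : ℕ}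
    (hy : y ∈ T) (hs : ∑ b ∈ T, ev (fun l => sg l y b) μ ≠ 0) : False := by
  have hne : T.Nonempty := ⟨y, hy⟩
  have hyT : ({y} : Finset ℕ) ⊆ T := singleton_subset_iff.2 hy
  have lp := uni_lot hTA hne
  have ly := lot_deg (hTA hy)
  have hd := diff_univ (f := f) ⟨μ, hμ⟩ (exists_S (singleton_subset_iff.2 (hTA hy))
    (singleton_nonempty y) ly (deg_pos y)) (fun φ h1 h2 => G0 hTA hne (fun ν hν => le_antisymm
      (hν.nonpos hyT (singleton_nonempty y) ly (deg_pos y) h2)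
      (hν.nonneg subset_rfl hne lp uni_pos h1)) h1 hμ hy hs)
  obtain ⟨j1, hj1⟩ := exists_int (f := f) ⟨μ, hμ⟩ (fun φ h1 => G0 hTA hne (fun ν hν => le_antisymm
      (hν.nonpos subset_rfl hne lp uni_pos (fun ν h => (h1 ν h).le))
      (hν.nonneg subset_rfl hne lp uni_pos (fun ν h => (h1 ν h).ge))) (fun ν h => (h1 ν h).ge) hμ hy hs)
  obtain ⟨j2, hj2⟩ := deg_int (f := f) (hTA hy)
  obtain ⟨k1, k2, hk1, hk2, e⟩ := hd (j2 - j1) (fun r hr => by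
    rw [Pi.sub_apply, hj1.1.2.1 r hr, hj2.1.2.1 r hr, sub_zero])
  have e2 : j1 + k1 = j2 + k2 := by
    have : j2 + k2 = (j2 - j1) + (j1 + k2) := by abel
    rw [this, e]; abel
  have h1 := hj1.add hk1
  rw [e2] at h1
  have h2 := h1.unique (hj2.add hk2)
  apply hs
  have hT : T = {y} := by
    refine subset_antisymm (fun b hb => ?_) hyT
    have := (uni_pos b).2 hb
    rw [h2] at this
    exact (deg_pos y b).1 this
  rw [hT, Finset.sum_singleton]
  linarith [mar_neg y y μ]

theorem updn {f : PSCF} [Nice f] {T A : Finset ℕ} (hTA : T ⊆ A) {φ : List ℕ → ℝ} {C}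
    (hsw : Sw T A φ C) (hadh : ∀ μ, Adh f T A μ → ev φ μ = 0) {x z : ℕ} (hx : x ∈ T) (hz : z ∈ T)
    (hxz : x ≠ z) : ∃ μ, Adh f (T.erase z) (A.erase z) μ ∧
      ev φ (ins x z μ 0) + ev φ (ins x z 0 μ) = 0 ∧
      ev φ (ins x z μ 0) - ev φ (ins x z 0 μ) = ((mass μ : ℚ) : ℝ) * C z x := by
  have hxT : x ∈ T.erase z := mem_erase.2 ⟨hxz, hx⟩
  have hxA : x ∈ A.erase z := mem_erase.2 ⟨hxz, hTA hx⟩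
  have hzA := notMem_erase z A
  obtain ⟨μ, h, -⟩ := supp (f := f) _ _ rfl (A.erase z) (T.erase z) (erase_subset_erase _ hTA)
    ⟨x, hxT⟩ (good_exists _)
  refine ⟨μ, h, ?_, ?_⟩
  · have h1 := adh_a hxT hzA h.ok h.ok rfl (h.add h)
    rw [insert_erase hz, insert_erase (hTA hz)] at h1
    rw [← hadh _ h1, ← map_add, ins_add, add_zero, zero_add]
  · simp only [ins, Finsupp.mapDomain_zero, add_zero, zero_add]
    refine ev_diff (fun l hl => ?_)
    have hg := sub_good (inter_pair hxA hzA) (h.ok.1 l hl) (good_pair' hxz)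
    rw [union_pair hxA, insert_erase (hTA hz)] at hg
    obtain ⟨W, V, rfl, hW, hV⟩ := good_split (h.ok.1 l hl) hxA
    rw [sub_eq hW hV] at hg
    rw [sub_eq hW hV, sub_eq hW hV]
    simpa using hsw.adj W V z x (by simpa using hg)

theorem ev_ins_dn (φ : List ℕ → ℝ) (x z μ) :
    ev φ (ins x z 0 μ) = ev (fun l => φ (sub x [x, z] l)) μ := by
  rw [ev_ins, map_zero, zero_add]

theorem ev_ins_up (φ : List ℕ → ℝ) (x z μ) :
    ev φ (ins x z μ 0) = ev (fun l => φ (sub x [z, x] l)) μ := by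
  rw [ev_ins, map_zero, add_zero]

theorem Z0 {f : PSCF} [Nice f] {T A : Finset ℕ} (hTA : T ⊆ A) (hne : T.Nonempty) {y : ℕ} (hy : y ∈ A)
    (hyT : y ∉ T) {φ : List ℕ → ℝ} (h1 : ∀ μ, S f A (uniLottery T) μ → 0 ≤ ev φ μ)
    (h2 : ∀ μ, S f A (degLottery y) μ → ev φ μ ≤ 0) {μ} (hμ : S f A (uniLottery T) μ)
    (hs : 0 < ∑ b ∈ T, ev (fun l => sg l y b) μ) : ∀ l, good A l → φ l = 0 := by
  have hUA : insert y T ⊆ A := insert_subset hy hTA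
  have hyU : ({y} : Finset ℕ) ⊆ insert y T := by simp
  have ly := lot_deg hy
  have hadh : ∀ μ, Adh f (insert y T) A μ → ev φ μ = 0 := fun ν hν => le_antisymm
    (hν.nonpos hyU (singleton_nonempty y) ly (deg_pos y) h2)
    (hν.nonneg (subset_insert _ _) hne (uni_lot hTA hne) uni_pos h1)
  obtain ⟨C, hsw⟩ := exists_sw hUA ⟨y, mem_insert_self _ _⟩ hadh
  have h00 : ∀ a, C a a = 0 := fun a => by linarith [hsw.anti a a]
  have hCT : ∀ a ∈ T, ∀ b ∈ T, C a b = 0 := by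
    intro z hz x hx
    by_cases hxz : x = z
    · rw [hxz, h00]
    have hyz : y ≠ z := by rintro rfl; exact hyT hz
    have hyx : x ≠ y := by rintro rfl; exact hyT hx
    obtain ⟨ν, hν, e1, e2⟩ := updn hUA hsw hadh (mem_insert_of_mem hx) (mem_insert_of_mem hz) hxz
    have hxA : x ∈ A.erase z := mem_erase.2 ⟨hxz, hTA hx⟩
    have hzA := notMem_erase z A
    have hsub : ({y} : Finset ℕ) ⊆ (insert y T).erase z := by simp [hyz]
    have hly := lot_deg (mem_erase.2 ⟨hyz, hy⟩ : y ∈ A.erase z)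
    have hd : degLottery y x = 0 := if_neg hyx
    have f1 : ev φ (ins x z ν 0) ≤ 0 := by
      rw [ev_ins_up]
      refine hν.nonpos hsub (singleton_nonempty y) hly (deg_pos y) (fun κ hκ => ?_)
      rw [← ev_ins_up]
      apply h2
      have := ins_zero hxA hzA hκ.ok OK.zero (by rw [add_zero]; exact hκ) hd
      rwa [insert_erase (hTA hz)] at this
    have f2 : ev φ (ins x z 0 ν) ≤ 0 := by
      rw [ev_ins_dn]
      refine hν.nonpos hsub (singleton_nonempty y) hly (deg_pos y) (fun κ hκ => ?_)
      rw [← ev_ins_dn]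
      apply h2
      have := ins_zero hxA hzA OK.zero hκ.ok (by rw [zero_add]; exact hκ) hd
      rwa [insert_erase (hTA hz)] at this
    have hpos : (0 : ℝ) < ((mass ν : ℚ) : ℝ) := by exact_mod_cast hν.pos
    have key : ((mass ν : ℚ) : ℝ) * C z x = 0 := by linarith
    rcases mul_eq_zero.1 key with h | h
    · exact absurd h hpos.ne'
    · exact h
  have hCy : ∀ b ∈ T, C y b ≤ 0 := by
    intro z hz
    have hyz : y ≠ z := by rintro rfl; exact hyT hz
    obtain ⟨ν, hν, e1, e2⟩ := updn hUA hsw hadh (mem_insert_self y T) (mem_insert_of_mem hz) hyz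
    have hyA : y ∈ A.erase z := mem_erase.2 ⟨hyz, hy⟩
    have hzA := notMem_erase z A
    have hsub : ({y} : Finset ℕ) ⊆ (insert y T).erase z := by simp [hyz]
    have f2 : ev φ (ins y z 0 ν) ≤ 0 := by
      rw [ev_ins_dn]
      refine hν.nonpos hsub (singleton_nonempty y) (lot_deg hyA) (deg_pos y) (fun κ hκ => ?_)
      rw [← ev_ins_dn]
      apply h2
      have := ins_lt hyA hzA OK.zero hκ.ok (by rw [map_zero]; exact hκ.pos)
        (by rw [zero_add]; exact hκ)
      rwa [insert_erase (hTA hz)] at this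
    have hpos : (0 : ℝ) < ((mass ν : ℚ) : ℝ) := by exact_mod_cast hν.pos
    have key : 0 ≤ C z y * ((mass ν : ℚ) : ℝ) := by linarith
    have := nonneg_of_mul_nonneg_left key hpos
    rw [hsw.anti]; linarith
  set m : (List ℕ →₀ ℚ) → ℕ → ℕ → ℝ := fun μ a b => ((ev (fun l => sg l a b) μ : ℚ) : ℝ) with hm
  have hmneg : ∀ μ a b, m μ a b = - m μ b a := by
    intro μ a b; simp only [hm]; rw [mar_neg]; push_cast; rfl
  have hrep : ∀ μ, OK A μ → ev φ μ = 1 / 2 * ∑ b ∈ T, C y b * m μ y b := by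
    intro μ hμ
    have e1 : ∑ a ∈ A, ∑ b ∈ A, C a b * m μ a b =
        ∑ a ∈ insert y T, ∑ b ∈ insert y T, C a b * m μ a b := by
      rw [← Finset.sum_subset hUA]
      · refine Finset.sum_congr rfl (fun a ha => ?_)
        rw [← Finset.sum_subset hUA]
        intro b _ hb; rw [hsw.off a b (Or.inr hb), zero_mul]
      · intro a _ ha
        exact Finset.sum_eq_zero (fun b _ => by rw [hsw.off a b (Or.inl ha), zero_mul])
    have e2 : ∀ a ∈ T, ∑ b ∈ insert y T, C a b * m μ a b = C y a * m μ y a := by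
      intro a ha
      rw [sum_insert hyT, Finset.sum_eq_zero (fun b hb => by rw [hCT a ha b hb, zero_mul]), add_zero,
        hsw.anti, hmneg]; ring
    rw [hsw.rep μ hμ]
    change 1 / 4 * ∑ a ∈ A, ∑ b ∈ A, C a b * m μ a b = _
    rw [e1, sum_insert hyT, Finset.sum_congr rfl e2, sum_insert hyT, h00]
    ring
  have hCy0 : ∀ u : {x // x ∈ T}, C y u = 0 := by
    classical
    refine alg2 (fun a : {x // x ∈ T} => C y a) (fun a => m μ y a) (fun a => hCy a a.2) ?_ (fun σ => ?_)
    · rw [Finset.univ_eq_attach, Finset.sum_attach T (fun a => m μ y a)]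
      simp only [hm]
      rw [← Rat.cast_sum]
      exact_mod_cast hs
    · have h3 := neutP hTA (fun a ha b hb => by simp [uniLottery, ha, hb]) hμ σ
      have h4 := h1 _ h3
      rw [hrep _ h3.ok, ← Finset.sum_attach T, ← Finset.univ_eq_attach, ← Equiv.sum_comp σ] at h4
      have e : ∀ a : {x // x ∈ T}, m (μ.mapDomain (List.map (Equiv.Perm.ofSubtype σ : Equiv.Perm ℕ))) y (σ a)
          = m μ y a := by
        intro a
        simp only [hm]
        congr 1
        have := mar_map (Equiv.Perm.ofSubtype σ : Equiv.Perm ℕ) μ y a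
        rw [Equiv.Perm.ofSubtype_apply_coe, Equiv.Perm.ofSubtype_apply_of_not_mem σ hyT] at this
        exact this
      simp only [e] at h4
      linarith
  refine hsw.zero (fun a ha b hb => ?_)
  rcases mem_insert.1 ha with ea | ha' <;> rcases mem_insert.1 hb with eb | hb'
  · rw [ea, eb]; exact h00 _
  · rw [ea]; exact hCy0 ⟨b, hb'⟩
  · rw [eb, hsw.anti, hCy0 ⟨a, ha'⟩, neg_zero]
  · exact hCT a ha' b hb'

theorem uni_insert {T : Finset ℕ} (hne : T.Nonempty) {y : ℕ} (hy : y ∉ T) :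
    uniLottery (insert y T) = fun x => ((T.card : ℚ) / (T.card + 1)) * uniLottery T x +
      (1 - (T.card : ℚ) / (T.card + 1)) * degLottery y x := by
  have hc : (0 : ℚ) < T.card := by exact_mod_cast hne.card_pos
  ext x
  unfold uniLottery degLottery
  rw [card_insert_of_notMem hy]
  push_cast
  by_cases e : x = y
  · subst e; simp [hy]; field_simp; ring
  · by_cases e' : x ∈ T
    · simp [e, e']; field_simp
    · simp [e, e']

theorem Zc {f : PSCF} [Nice f] {T A : Finset ℕ} (hTA : T ⊆ A) (hne : T.Nonempty) {y : ℕ} (hy : y ∈ A)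
    (hyT : y ∉ T) {μ} (hμ : S f A (uniLottery T) μ)
    (hs : 0 < ∑ b ∈ T, ev (fun l => sg l y b) μ) : False := by
  have hd := diff_univ (f := f) ⟨μ, hμ⟩ (exists_S (singleton_subset_iff.2 hy)
    (singleton_nonempty y) (lot_deg hy) (deg_pos y)) (fun φ h1 h2 => Z0 hTA hne hy hyT h1 h2 hμ hs)
  obtain ⟨j2, hj2⟩ := deg_int (f := f) hy
  obtain ⟨k1, k2, hk1, hk2, e⟩ := hd j2 hj2.1.2.1
  have hi := hj2.add hk2
  have e2 : j2 + k2 = k1 := by rw [e]; abel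
  rw [e2] at hi
  obtain ⟨ν, hν, rfl⟩ := hk1.list
  have hm := hμ.pos
  set t : ℚ := (2 * mass μ)⁻¹ with ht
  have ht0 : 0 < t := by positivity
  have hb := hi.ball (w := t • toProf μ) (fun r hr => by
    rw [Pi.smul_apply, toProf_supp hμ.ok.1 r hr, smul_zero]) (by
    have : ∀ r ∈ linOrders A, |(t • toProf μ) r| = t * toProf μ r := fun r _ =>
      abs_of_nonneg (mul_nonneg ht0.le (toProf_nonneg hμ.ok.2 r))
    rw [Finset.sum_congr rfl this, ← Finset.mul_sum, sum_toProf_mass hμ.ok.1, ht]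
    field_simp
    norm_num)
  have s1 : S f A (degLottery y) ν := ⟨hν.ok, hi.1⟩
  have s2 : S f A (uniLottery T) (ν + t • μ) := hν.add (hμ.smul ht0)
  have s3 : S f A (degLottery y) (ν + t • μ) := ⟨s2.ok, by rw [map_add, map_smul]; exact hb⟩
  have hc : (0 : ℚ) < T.card := by exact_mod_cast hne.card_pos
  have ht0' : (0 : ℚ) ≤ (T.card : ℚ) / (T.card + 1) := by positivity
  have ht1' : (T.card : ℚ) / (T.card + 1) ≤ 1 := by rw [div_le_one (by positivity)]; linarith
  have key : ∀ κ, S f A (uniLottery T) κ → S f A (degLottery y) κ →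
      ∑ b ∈ T, ev (fun l => sg l y b) κ = 0 := by
    intro κ a1 a2
    have a3 := a1.conv a2 ht0' ht1'
    rw [← uni_insert hne hyT] at a3
    by_contra hn
    refine G (insert_subset hy hTA) a3 (mem_insert_self _ _) ?_
    rw [sum_insert hyT]
    have := mar_neg y y κ
    intro h0
    apply hn
    linarith
  have k1 := key _ hν s1
  have k2 := key _ s2 s3
  simp only [map_add, map_smul, Finset.sum_add_distrib, smul_eq_mul, ← Finset.mul_sum] at k2
  rw [k1, zero_add] at k2
  exact (mul_pos ht0 hs).ne' k2

theorem clone {f : PSCF} [Nice f] (N : ℕ) (hN : 0 < N) : ∀ (n : ℕ) (A : Finset ℕ) (p : ℕ → ℚ) (k : ℕ → ℕ)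
    (μ : List ℕ →₀ ℚ) (_ : S f A p μ) (_ : ∀ x, p x = k x / N) (y : ℕ) (_ : y ∈ A)
    (_ : ∑ x ∈ A, p x * ev (fun l => sg l x y) μ < 0) (_ : ∑ x ∈ A, (k x - 1) = n), False := by
  have hN' : (0 : ℚ) < N := by exact_mod_cast hN
  intro n
  induction n using Nat.strong_induction_on with
  | _ n ih =>
  intro A p k μ hS hk y hy hlt hn
  by_cases hbig : ∃ x ∈ A, 2 ≤ k x
  · obtain ⟨x, hx, hkx⟩ := hbig
    obtain ⟨z, hz⟩ := Infinite.exists_notMem_finset A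
    have hxz : x ≠ z := by rintro rfl; exact hz hx
    have hyz : y ≠ z := by rintro rfl; exact hz hy
    set μ' := (1 / 2 : ℚ) • μ with hμ'
    have ok : OK A μ' := hS.ok.smul (by norm_num)
    have hadd : μ' + μ' = μ := by rw [hμ', ← add_smul]; norm_num
    set k' : ℕ → ℕ := fun a => if a = x then k x - 1 else if a = z then 1 else k a with hk'
    have hkz : k z = 0 := by
      have h1 := hk z
      rw [hS.lot.1 z hz, eq_comm, div_eq_zero_iff] at h1
      rcases h1 with h1 | h1
      · exact_mod_cast h1
      · exact absurd h1 hN'.ne'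
    have k'x : k' x = k x - 1 := by simp [hk']
    have k'z : k' z = 1 := by simp [hk', hxz.symm]
    have k'o : ∀ a, a ≠ x → a ≠ z → k' a = k a := fun a h1 h2 => by simp [hk', h1, h2]
    have hcast : ((k x - 1 : ℕ) : ℚ) = k x - 1 := by
      rw [Nat.cast_sub (by omega)]; simp
    have hkx' : (2 : ℚ) ≤ k x := by exact_mod_cast hkx
    have hS' : S f (insert z A) (fun a => (k' a : ℚ) / N) (ins x z μ' μ') := by
      refine ins_eq hx hz ok ok rfl (by rw [hadd]; exact hS) (fun a h1 h2 => ?_) ?_ ?_ ?_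
      · rw [k'o a h1 h2, hk]
      · rw [k'x, k'z, hk, hcast]; push_cast; ring
      · rw [k'x, hcast]; apply div_pos _ hN'; linarith
      · rw [k'z]; push_cast; positivity
    refine ih (∑ a ∈ insert z A, (k' a - 1)) ?_ (insert z A) _ k' _ hS' (fun _ => rfl) y
      (mem_insert_of_mem hy) ?_ rfl
    · rw [sum_insert hz, k'z, ← hn, Nat.sub_self, zero_add]
      refine Finset.sum_lt_sum (fun a ha => ?_) ⟨x, hx, by rw [k'x]; omega⟩
      by_cases e : a = x
      · rw [e, k'x]; omega
      · rw [k'o a e (by rintro rfl; exact hz ha)]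
    · have hmar : ∀ w, ev (fun l => sg l w y) (ins x z μ' μ') = ev (fun l => sg l (rho x z w) y) μ := by
        intro w
        by_cases hw : w = z ∧ y = x
        · rw [hw.1, hw.2, mar_ins_zx hx hz ok ok, sub_self]
          have : rho x z z = x := by simp [rho]
          rw [this]
          linarith [mar_neg x x μ]
        · rw [mar_ins hx hz ok ok ⟨fun h => hyz h.2, hw⟩, hadd]
          have : rho x z y = y := by simp [rho, hyz]
          rw [this]
      simp only [hmar]
      rw [sum_insert hz]
      have hrz : rho x z z = x := by simp [rho]
      have e : ∀ w ∈ A, (k' w : ℚ) / N * ev (fun l => sg l (rho x z w) y) μ =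
          p w * ev (fun l => sg l w y) μ - (if w = x then (1 : ℚ) / N * ev (fun l => sg l x y) μ else 0) := by
        intro w hw
        have hwz : w ≠ z := by rintro rfl; exact hz hw
        have hr : rho x z w = w := by simp [rho, hwz]
        rw [hr]
        by_cases e : w = x
        · rw [e, if_pos rfl, k'x, hk, hcast]; ring
        · rw [if_neg e, k'o w e hwz, hk, sub_zero]
      rw [Finset.sum_congr rfl e, Finset.sum_sub_distrib, Finset.sum_ite_eq', if_pos hx, hrz, k'z]
      push_cast
      linarith
  · push Not at hbig
    set T := A.filter (fun x => k x = 1) with hT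
    have hTA : T ⊆ A := filter_subset _ _
    have hpe : ∀ x, p x = if x ∈ T then (N : ℚ)⁻¹ else 0 := by
      intro x
      by_cases hxA : x ∈ A
      · have := hbig x hxA
        rcases (by omega : k x = 0 ∨ k x = 1) with h | h
        · rw [hk, h, if_neg (by simp [hT, h])]; simp
        · rw [hk, h, if_pos (by simp [hT, h, hxA])]; simp
      · rw [hS.lot.1 x hxA, if_neg (fun h => hxA (hTA h))]
    have hsum := hS.lot.2.2
    simp only [hpe] at hsum
    rw [Finset.sum_ite_mem, inter_eq_right.2 hTA, Finset.sum_const, nsmul_eq_mul] at hsum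
    have hTN : (T.card : ℚ) = N := by
      field_simp at hsum; exact hsum
    have hp : p = uniLottery T := by
      ext x; rw [hpe, uniLottery, hTN]
    have hne : T.Nonempty := by
      rw [← Finset.card_pos]
      have : T.card = N := by exact_mod_cast hTN
      omega
    have hlt' : 0 < ∑ b ∈ T, ev (fun l => sg l y b) μ := by
      have e : ∑ x ∈ A, p x * ev (fun l => sg l x y) μ =
          - ((N : ℚ)⁻¹ * ∑ b ∈ T, ev (fun l => sg l y b) μ) := by
        simp only [hpe, ite_mul, zero_mul]
        rw [Finset.sum_ite_mem, inter_eq_right.2 hTA, Finset.mul_sum, ← Finset.sum_neg_distrib]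
        exact Finset.sum_congr rfl (fun b _ => by rw [mar_neg]; ring)
      rw [e, neg_lt_zero] at hlt
      exact pos_of_mul_pos_right hlt (by positivity)
    rw [hp] at hS
    by_cases hyT : y ∈ T
    · exact G hTA hS hyT hlt'.ne'
    · exact Zc hTA hne hy hyT hS hlt'

theorem common_den (A : Finset ℕ) (p : ℕ → ℚ) (h : IsLottery A p) :
    ∃ N : ℕ, 0 < N ∧ ∃ k : ℕ → ℕ, ∀ x, p x = k x / N := by
  refine ⟨∏ x ∈ A, (p x).den, Finset.prod_pos (fun x _ => (p x).den_pos), ?_⟩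
  suffices ∀ x, ∃ k : ℕ, p x = k / ((∏ x ∈ A, (p x).den : ℕ) : ℚ) from ⟨fun x => (this x).choose,
    fun x => (this x).choose_spec⟩
  intro x
  by_cases hx : x ∈ A
  · obtain ⟨q, hq⟩ := Finset.dvd_prod_of_mem (fun x => (p x).den) hx
    have hpos : 0 < ∏ x ∈ A, (p x).den := Finset.prod_pos (fun x _ => (p x).den_pos)
    rw [hq] at hpos
    have hq0 : (q : ℚ) ≠ 0 := by
      rintro e
      have : q = 0 := by exact_mod_cast e
      simp [this] at hpos
    refine ⟨(p x).num.toNat * q, ?_⟩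
    rw [hq]
    have h1 : (((p x).num.toNat : ℕ) : ℚ) = ((p x).num : ℚ) := by
      have : (((p x).num.toNat : ℕ) : ℤ) = (p x).num := Int.toNat_of_nonneg (Rat.num_nonneg.2 (h.2.1 x))
      exact_mod_cast this
    push_cast
    rw [h1, mul_div_mul_right _ _ hq0, Rat.num_div_den]
  · exact ⟨0, by rw [h.1 x hx]; simp⟩

theorem main_thm {f : PSCF} [Nice f] (A : Finset ℕ) (hA : A.Nonempty)
    (R : Finset (ℕ × ℕ) → ℚ) (hR : IsProfile A R) :
    f.choice A R ⊆ ML A R := by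
  intro p hp
  have hl := f.subset_lotteries A hA R hR hp
  refine ⟨hl, fun q hq => ?_⟩
  by_contra hn
  push Not at hn
  have hy : ∃ y ∈ A, ∑ x ∈ A, p x * margin A R x y < 0 := by
    by_contra hcon
    push Not at hcon
    apply not_le.2 hn
    rw [Finset.sum_comm]
    refine Finset.sum_nonneg (fun y hy => ?_)
    rw [← Finset.sum_mul]
    exact mul_nonneg (hcon y hy) (hq.2.1 y)
  obtain ⟨y, hyA, hlt⟩ := hy
  obtain ⟨μ, ok, rfl⟩ := exists_list hR.1 hR.2.1
  have hS : S f A p μ := ⟨ok, hA, hR.1, hR.2.1, by rw [hR.2.2]; exact one_pos, by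
    rw [hR.2.2, inv_one, one_smul]; exact hp⟩
  obtain ⟨N, hN, k, hk⟩ := common_den A p hl
  simp only [margin_toProf ok.1] at hlt
  exact clone N hN _ A p k μ hS hk y hyA hlt rfl

/-- Every population-consistent and composition-consistent PSCF yields only maximal
lotteries. -/
theorem pscf_subset_ml (f : PSCF) (hpop : PopulationConsistent f)
    (hcomp : CompositionConsistent f) (A : Finset ℕ) (hA : A.Nonempty)
    (R : Finset (ℕ × ℕ) → ℚ) (hR : IsProfile A R) :
    f.choice A R ⊆ ML A R := by
  haveI : Nice f := ⟨hpop, hcomp⟩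
  exact main_thm A hA R hR

end PSC
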